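/- In the renormalization setting: set C₁ := −min{v_x(z,t) : z ∈ [1,3], t ∈ [t₁, t₃]} (where v_x at the free boundary means the left spatial derivative). Then C₁ > 0, for every y > 3 one has v_x(x, t_y) ≥ −C₁ for all x ∈ [y−1, y], and consequently 0 ≤ v(x,t) ≤ C₁ (b(t) − x) for every t > t₃ and every x ∈ [b(t) − 1, b(t)]. -/

import Mathlib

open MeasureTheory Set Filter

noncomputable section

/-- Condition (F1): `f` and `κ` are `C²`, 1-periodic in `x`, `f(x,0)=0`, and there is `θ > 0`
with `f(x,u) > 0` for `u > θ` and `κ(x) > θ`. -/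
def CondF1 (f : ℝ → ℝ → ℝ) (κ : ℝ → ℝ) (θ : ℝ) : Prop :=
  ContDiff ℝ 2 (Function.uncurry f) ∧ ContDiff ℝ 2 κ ∧
  (∀ x u, f (x + 1) u = f x u) ∧ (∀ x, κ (x + 1) = κ x) ∧
  (∀ x, f x 0 = 0) ∧ 0 < θ ∧ (∀ x u, θ < u → 0 < f x u) ∧ (∀ x, θ < κ x)

/-- `κ₀ := min κ` (over a period). -/
def kappaMin (κ : ℝ → ℝ) : ℝ := sInf (κ '' Icc 0 1)

/-- `κ⁰ := max κ` (over a period). -/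
def kappaMax (κ : ℝ → ℝ) : ℝ := sSup (κ '' Icc 0 1)

/-- Condition (F2): existence of a compactly supported traveling subsolution profile `φ₀`
with speed `c₀`. -/
def CondF2 (m : ℝ) (f : ℝ → ℝ → ℝ) (κ : ℝ → ℝ) (c₀ l₀ : ℝ) (φ₀ : ℝ → ℝ) : Prop :=
  0 < c₀ ∧ 0 < l₀ ∧ ContDiffOn ℝ 2 φ₀ (Icc (-l₀) l₀) ∧
  φ₀ (-l₀) = 0 ∧ φ₀ l₀ = 0 ∧ (∀ z ∈ Ioo (-l₀) l₀, 0 < φ₀ z) ∧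
  c₀ < -(derivWithin φ₀ (Icc (-l₀) l₀) l₀) ∧
  ∀ (x : ℝ), ∀ z ∈ Icc (-l₀) l₀,
    0 ≤ derivWithin (derivWithin (fun w => φ₀ w ^ m) (Icc (-l₀) l₀)) (Icc (-l₀) l₀) z
        + c₀ * derivWithin φ₀ (Icc (-l₀) l₀) z
        + f x (φ₀ z) * (κ x - φ₀ z)

/-- A (bounded, continuous) very weak solution of `u_t = (u^m)_{xx} + f(x,u)(κ(x)-u)`
on `ℝ × (0,τ)` with initial data `u₀`. -/
def VeryWeakSol (m : ℝ) (f : ℝ → ℝ → ℝ) (κ : ℝ → ℝ) (τ : ℝ)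
    (u₀ : ℝ → ℝ) (u : ℝ → ℝ → ℝ) : Prop :=
  ContinuousOn (fun q : ℝ × ℝ => u q.1 q.2) (univ ×ˢ Ioc (0:ℝ) τ) ∧
  (∃ M : ℝ, ∀ x : ℝ, ∀ t ∈ Ioc (0:ℝ) τ, |u x t| ≤ M) ∧
  ∀ φ : ℝ → ℝ → ℝ, ContDiff ℝ (⊤ : ℕ∞) (Function.uncurry φ) →
    HasCompactSupport (Function.uncurry φ) →
    ∫ x : ℝ, u x τ * φ x τ =
      (∫ x : ℝ, u₀ x * φ x 0)
      + (∫ t in Ioo (0:ℝ) τ, ∫ x : ℝ, f x (u x t) * (κ x - u x t) * φ x t)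
      + (∫ t in Ioo (0:ℝ) τ, ∫ x : ℝ,
          (u x t * deriv (fun s => φ x s) t + u x t ^ m * deriv (deriv (fun y => φ y t)) x))

/-- A global very weak solution: a very weak solution on `ℝ × (0,τ)` for every `τ > 0`. -/
def GlobalVeryWeakSol (m : ℝ) (f : ℝ → ℝ → ℝ) (κ : ℝ → ℝ)
    (u₀ : ℝ → ℝ) (u : ℝ → ℝ → ℝ) : Prop :=
  ∀ τ > (0:ℝ), VeryWeakSol m f κ τ u₀ u

/-- Left spatial derivative of the pressure `v = (m/(m-1)) u^{m-1}` at the point `z`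
(at time `t`). -/
def pressureDx (m : ℝ) (u : ℝ → ℝ → ℝ) (z t : ℝ) : ℝ :=
  derivWithin (fun y => (m / (m - 1)) * u y t ^ (m - 1)) (Iic z) z

/-- The renormalization setting: (F1), (F2), a positive 1-periodic stationary solution `p`
with `p ≥ κ₀` lying strictly above all translates of `φ₀`, a global very weak solution `u`
with Heaviside-type initial data `p·H(-x)` possessing a `C¹`, strictly increasing free
boundary `b → ∞` along which Darcy's law holds with nonnegative speed, and the crossing
times `ty y` defined by `b (ty y) = y` for `y > 0`. -/
def RenormSetting (m : ℝ) (f : ℝ → ℝ → ℝ) (κ : ℝ → ℝ) (θ c₀ l₀ : ℝ) (φ₀ p : ℝ → ℝ)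
    (u : ℝ → ℝ → ℝ) (b : ℝ → ℝ) (ty : ℝ → ℝ) : Prop :=
  CondF1 f κ θ ∧ CondF2 m f κ c₀ l₀ φ₀ ∧
  ContDiff ℝ 2 p ∧ (∀ x, 0 < p x) ∧ (∀ x, p (x + 1) = p x) ∧
  (∀ x, deriv (deriv (fun y => p y ^ m)) x + f x (p x) * (κ x - p x) = 0) ∧
  (∀ x, kappaMin κ ≤ p x) ∧
  (∀ x₀ : ℝ, ∀ x ∈ Icc (x₀ - l₀) (x₀ + l₀), φ₀ (x - x₀) < p x) ∧
  GlobalVeryWeakSol m f κ (fun x => if x ≤ 0 then p x else 0) u ∧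
  (∀ t > (0:ℝ), DifferentiableAt ℝ b t) ∧
  ContinuousOn (deriv b) (Ioi 0) ∧
  (∀ t > (0:ℝ), ∀ x : ℝ, (x < b t → 0 < u x t) ∧ (b t ≤ x → u x t = 0)) ∧
  StrictMonoOn b (Ioi 0) ∧
  Tendsto b atTop atTop ∧
  (∀ x t : ℝ, 0 < t → 0 < u x t →
      DifferentiableAt ℝ (fun s => u x s) t ∧
      DifferentiableAt ℝ (fun y => u y t) x ∧
      DifferentiableAt ℝ (deriv (fun y => u y t)) x) ∧
  (∀ t > (0:ℝ), deriv b t = -(pressureDx m u (b t) t) ∧ 0 ≤ deriv b t) ∧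
  (∀ y > (0:ℝ), 0 < ty y ∧ b (ty y) = y)

/-- The second-order difference quotient with step `h`. -/
def lap (h : ℝ) (q : ℝ → ℝ) (x : ℝ) : ℝ := (q (x + h) - 2 * q x + q (x - h)) / h ^ 2

/-- The average of `q` around `x` against the hat function of half-width `h`. -/
def avg (h : ℝ) (q : ℝ → ℝ) (x : ℝ) : ℝ :=
  ∫ ξ in (0 : ℝ)..1, (1 - ξ) * (q (x + h * ξ) + q (x - h * ξ))

/-- The weight `1 / cosh (2x)`. -/
def wt (x : ℝ) : ℝ := (Real.cosh (2 * x))⁻¹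

/-- The weighted `L¹` norm. -/
def wnorm (q : ℝ → ℝ) : ℝ := ∫ x, |q x| * wt x

lemma wt_pos (x : ℝ) : 0 < wt x := inv_pos.2 (Real.cosh_pos _)

lemma wt_nonneg (x : ℝ) : 0 ≤ wt x := (wt_pos x).le

@[fun_prop]
lemma continuous_wt : Continuous wt := by
  unfold wt
  exact (Real.continuous_cosh.comp (by fun_prop)).inv₀ fun x => (Real.cosh_pos _).ne'

lemma one_add_sq_div_two_le_cosh (x : ℝ) : 1 + x ^ 2 / 2 ≤ Real.cosh x := by
  have h : Real.cosh x = 1 + 2 * Real.sinh (x / 2) ^ 2 := by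
    have h1 := Real.cosh_two_mul (x / 2)
    have h2 := Real.cosh_sq (x / 2)
    rw [show 2 * (x / 2) = x by ring] at h1
    linarith
  have h3 : |x / 2| ≤ |Real.sinh (x / 2)| := by
    rcases le_total 0 (x / 2) with hx | hx
    · have h4 := Real.self_le_sinh_iff.2 hx
      rwa [abs_of_nonneg hx, abs_of_nonneg (hx.trans h4)]
    · have h4 := Real.sinh_le_self_iff.2 hx
      rw [abs_of_nonpos hx, abs_of_nonpos (h4.trans hx)]
      linarith
  have h5 := sq_le_sq.2 h3
  rw [h]
  nlinarith

lemma cosh_sub_one_le (x : ℝ) (hx : |x| ≤ 1) : Real.cosh x - 1 ≤ x ^ 2 := by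
  have h1 := Real.cosh_le_exp_half_sq x
  have h2 : x ^ 2 ≤ 1 := by
    rw [← sq_abs]; nlinarith [abs_nonneg x]
  have h4 : |x ^ 2 / 2| = x ^ 2 / 2 := abs_of_nonneg (by positivity)
  have h3 := Real.abs_exp_sub_one_le (x := x ^ 2 / 2) (by rw [h4]; linarith)
  rw [h4] at h3
  have := le_abs_self (Real.exp (x ^ 2 / 2) - 1)
  linarith

lemma cosh_add_add_cosh_sub (x h : ℝ) :
    Real.cosh (x + h) + Real.cosh (x - h) = 2 * Real.cosh x * Real.cosh h := by
  rw [Real.cosh_add, Real.cosh_sub]; ring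

lemma lap_cosh_le {h : ℝ} (hh : 0 < h) (h1 : h ≤ 1) (x : ℝ) :
    lap h Real.cosh x ≤ 2 * Real.cosh x := by
  unfold lap
  rw [div_le_iff₀ (by positivity)]
  have := cosh_add_add_cosh_sub x h
  have h2 := cosh_sub_one_le h (by rw [abs_of_pos hh]; exact h1)
  have h3 := Real.cosh_pos x
  nlinarith

lemma lap_wt_le {h : ℝ} (hh : 0 < h) (h1 : h ≤ 1 / 2) (x : ℝ) :
    lap h wt x ≤ 8 * wt x := by
  have key : wt (x + h) + wt (x - h) ≤ 2 * Real.cosh (2 * h) * wt x := by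
    unfold wt
    have e1 := cosh_add_add_cosh_sub (2 * x) (2 * h)
    have e2 : Real.cosh (2 * x + 2 * h) * Real.cosh (2 * x - 2 * h) =
        Real.cosh (2 * x) ^ 2 + Real.sinh (2 * h) ^ 2 := by
      rw [Real.cosh_add, Real.cosh_sub]
      have a := Real.cosh_sq (2 * x)
      have b := Real.cosh_sq (2 * h)
      calc _ = Real.cosh (2 * x) ^ 2 * Real.cosh (2 * h) ^ 2
            - Real.sinh (2 * x) ^ 2 * Real.sinh (2 * h) ^ 2 := by ring
        _ = _ := by rw [a, b]; ring
    have p1 := Real.cosh_pos (2 * x + 2 * h)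
    have p2 := Real.cosh_pos (2 * x - 2 * h)
    have p3 := Real.cosh_pos (2 * x)
    have p4 := Real.cosh_pos (2 * h)
    rw [mul_add, mul_sub, inv_add_inv p1.ne' p2.ne', e1, e2, ← div_eq_mul_inv,
      div_le_div_iff₀ (by positivity) p3]
    have : 0 ≤ 2 * Real.cosh (2 * h) * Real.sinh (2 * h) ^ 2 := by positivity
    nlinarith
  unfold lap
  rw [div_le_iff₀ (by positivity)]
  have h2 := cosh_sub_one_le (2 * h) (by rw [abs_of_pos (by linarith)]; linarith)
  have h3 := wt_pos x
  nlinarith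

lemma cosh_add_le (x y : ℝ) : Real.cosh (x + y) ≤ Real.exp |y| * Real.cosh x := by
  rw [Real.cosh_eq, Real.cosh_eq, mul_div_assoc', div_le_div_iff_of_pos_right two_pos, mul_add,
    ← Real.exp_add, ← Real.exp_add]
  exact add_le_add (Real.exp_le_exp.2 (by linarith [le_abs_self y]))
    (Real.exp_le_exp.2 (by linarith [neg_abs_le y]))

lemma cosh_add_le_three {x y : ℝ} (hy : |y| ≤ 1) : Real.cosh (x + y) ≤ 3 * Real.cosh x := by
  refine (cosh_add_le x y).trans ?_
  have : Real.exp |y| ≤ Real.exp 1 := Real.exp_le_exp.2 hy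
  have := Real.exp_one_lt_d9
  have := Real.cosh_pos x
  gcongr
  linarith

lemma integrable_wt_mul_cosh : Integrable fun x => Real.cosh x * wt x := by
  refine (integrable_inv_one_add_sq.const_mul 2).mono'
    (by fun_prop (disch := exact Real.continuous_cosh)) ?_
  refine Eventually.of_forall fun x => ?_
  have p := Real.cosh_pos x
  rw [Real.norm_of_nonneg (mul_nonneg p.le (wt_nonneg x))]
  unfold wt
  have h1 := one_add_sq_div_two_le_cosh x
  have h2 := Real.one_le_cosh x
  have h3 : Real.cosh x ^ 2 ≤ Real.cosh (2 * x) := by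
    rw [Real.cosh_two_mul]; nlinarith [sq_nonneg (Real.sinh x)]
  rw [← div_eq_mul_inv, ← div_eq_mul_inv, div_le_div_iff₀ (Real.cosh_pos _) (by positivity)]
  nlinarith

lemma integrable_wt : Integrable wt := by
  refine integrable_wt_mul_cosh.mono' (by fun_prop) (Eventually.of_forall fun x => ?_)
  rw [Real.norm_of_nonneg (wt_nonneg x)]
  exact le_mul_of_one_le_left (wt_nonneg x) (Real.one_le_cosh x)

/-- The weighted mass of `cosh`. -/
def coshMass : ℝ := ∫ x, Real.cosh x * wt x

lemma coshMass_nonneg : 0 ≤ coshMass :=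
  integral_nonneg fun x => mul_nonneg (Real.cosh_pos x).le (wt_nonneg x)

/-- Bounded measurable functions. -/
def BddMeas (q : ℝ → ℝ) : Prop := Measurable q ∧ ∃ B, ∀ x, |q x| ≤ B

namespace BddMeas

variable {q r : ℝ → ℝ}

lemma meas (hq : BddMeas q) : Measurable q := hq.1

lemma add (hq : BddMeas q) (hr : BddMeas r) : BddMeas fun x => q x + r x := by
  obtain ⟨B, hB⟩ := hq.2
  obtain ⟨C, hC⟩ := hr.2
  exact ⟨hq.1.add hr.1, B + C, fun x => (abs_add_le _ _).trans (add_le_add (hB x) (hC x))⟩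

lemma const_mul (c : ℝ) (hq : BddMeas q) : BddMeas fun x => c * q x := by
  obtain ⟨B, hB⟩ := hq.2
  refine ⟨hq.1.const_mul c, |c| * B, fun x => ?_⟩
  rw [abs_mul]
  exact mul_le_mul_of_nonneg_left (hB x) (abs_nonneg c)

lemma sub (hq : BddMeas q) (hr : BddMeas r) : BddMeas fun x => q x - r x := by
  simpa [sub_eq_add_neg] using hq.add (hr.const_mul (-1))

lemma abs (hq : BddMeas q) : BddMeas fun x => |q x| := by
  obtain ⟨B, hB⟩ := hq.2
  exact ⟨hq.1.abs, B, fun x => by rw [abs_abs]; exact hB x⟩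

lemma translate (hq : BddMeas q) (y : ℝ) : BddMeas fun x => q (x + y) := by
  obtain ⟨B, hB⟩ := hq.2
  exact ⟨hq.1.comp (measurable_id.add_const y), B, fun x => hB _⟩

lemma lap (hq : BddMeas q) (h : ℝ) : BddMeas (lap h q) := by
  have e : _root_.lap h q = fun x => (h ^ 2)⁻¹ * ((q (x + h) - 2 * q x) + q (x + -h)) := by
    funext x; rw [_root_.lap, div_eq_inv_mul, sub_eq_add_neg x h]
  rw [e]
  exact (((hq.translate h).sub (hq.const_mul 2)).add (hq.translate (-h))).const_mul _

lemma comp_of_bdd {Φ : ℝ → ℝ} (hq : Measurable q) (hΦ : Continuous Φ) {B : ℝ}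
    (hB : ∀ a, |Φ a| ≤ B) : BddMeas fun x => Φ (q x) :=
  ⟨hΦ.measurable.comp hq, B, fun _ => hB _⟩

lemma integrable (hq : BddMeas q) : Integrable fun x => |q x| * wt x := by
  obtain ⟨B, hB⟩ := hq.2
  refine (integrable_wt.const_mul B).mono'
    ((hq.1.abs.mul continuous_wt.measurable).aestronglyMeasurable)
    (Eventually.of_forall fun x => ?_)
  rw [Real.norm_of_nonneg (mul_nonneg (abs_nonneg _) (wt_nonneg x))]
  exact mul_le_mul_of_nonneg_right (hB x) (wt_nonneg x)

end BddMeas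

lemma wnorm_nonneg (q : ℝ → ℝ) : 0 ≤ wnorm q :=
  integral_nonneg fun x => mul_nonneg (abs_nonneg _) (wt_nonneg x)

lemma wnorm_mono {q r : ℝ → ℝ} (hr : BddMeas r) (h : ∀ x, |q x| ≤ |r x|) :
    wnorm q ≤ wnorm r :=
  integral_mono_of_nonneg (Eventually.of_forall fun x => mul_nonneg (abs_nonneg _) (wt_nonneg x))
    hr.integrable (Eventually.of_forall fun x => mul_le_mul_of_nonneg_right (h x) (wt_nonneg x))

lemma wnorm_add_le {q r : ℝ → ℝ} (hq : BddMeas q) (hr : BddMeas r) :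
    wnorm (fun x => q x + r x) ≤ wnorm q + wnorm r := by
  unfold wnorm
  rw [← integral_add hq.integrable hr.integrable]
  refine integral_mono (hq.add hr).integrable (hq.integrable.add hr.integrable) fun x => ?_
  have := abs_add_le (q x) (r x)
  have := wt_nonneg x
  simp only
  nlinarith

lemma wnorm_const_mul (c : ℝ) (q : ℝ → ℝ) : wnorm (fun x => c * q x) = |c| * wnorm q := by
  unfold wnorm
  rw [← integral_const_mul]
  congr 1; funext x; rw [abs_mul]; ring

lemma wnorm_sub_comm (q r : ℝ → ℝ) :
    wnorm (fun x => q x - r x) = wnorm (fun x => r x - q x) := by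
  unfold wnorm; congr 1; funext x; rw [abs_sub_comm]

lemma wnorm_sub_le {p q r : ℝ → ℝ} (hp : BddMeas p) (hq : BddMeas q) (hr : BddMeas r) :
    wnorm (fun x => p x - r x) ≤ wnorm (fun x => p x - q x) + wnorm (fun x => q x - r x) := by
  have := wnorm_add_le (hp.sub hq) (hq.sub hr)
  simpa using this

lemma wnorm_le_of_le_cosh {q : ℝ → ℝ} {c : ℝ} (h : ∀ x, |q x| ≤ c * Real.cosh x) :
    wnorm q ≤ c * coshMass := by
  unfold wnorm coshMass
  rw [← integral_const_mul]
  refine integral_mono_of_nonneg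
    (Eventually.of_forall fun x => mul_nonneg (abs_nonneg _) (wt_nonneg x))
    (integrable_wt_mul_cosh.const_mul c) (Eventually.of_forall fun x => ?_)
  have := mul_le_mul_of_nonneg_right (h x) (wt_nonneg x)
  simpa only [mul_assoc] using this

lemma integral_abs_lap_mul_wt_le {h : ℝ} (hh : 0 < h) (h1 : h ≤ 1 / 2) {d : ℝ → ℝ}
    (hd : BddMeas d) :
    ∫ x, lap h (fun y => |d y|) x * wt x ≤ 8 * wnorm d := by
  obtain ⟨B, hB⟩ := hd.2
  have hint : ∀ y : ℝ, Integrable fun x => |d x| * wt (x + y) := fun y => by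
    refine ((integrable_wt.comp_add_right y).const_mul B).mono'
      ((hd.1.abs.mul (continuous_wt.measurable.comp
        (measurable_id.add_const y))).aestronglyMeasurable)
      (Eventually.of_forall fun x => ?_)
    rw [Real.norm_of_nonneg (mul_nonneg (abs_nonneg _) (wt_nonneg _))]
    exact mul_le_mul_of_nonneg_right (hB x) (wt_nonneg _)
  have hshift : ∀ y : ℝ, ∫ x, |d (x + y)| * wt x = ∫ x, |d x| * wt (x - y) := fun y => by
    have := integral_add_right_eq_self (μ := (volume : Measure ℝ))
      (fun x => |d x| * wt (x - y)) y
    simpa using this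
  have hI : ∀ y : ℝ, Integrable fun x => |d (x + y)| * wt x := fun y =>
    (hd.translate y).integrable
  have e1 : ∫ x, lap h (fun y => |d y|) x * wt x =
      ∫ x, |d x| * lap h wt x := by
    have a1 : ∀ x, lap h (fun y => |d y|) x * wt x =
        (h ^ 2)⁻¹ * ((|d (x + h)| * wt x - 2 * (|d x| * wt x)) + |d (x + -h)| * wt x) := by
      intro x; unfold lap; rw [div_eq_inv_mul, sub_eq_add_neg x h]; ring
    have a2 : ∀ x, |d x| * lap h wt x =
        (h ^ 2)⁻¹ * ((|d x| * wt (x + -h) - 2 * (|d x| * wt x)) + |d x| * wt (x + h)) := by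
      intro x; unfold lap; rw [div_eq_inv_mul, sub_eq_add_neg x h]; ring
    simp_rw [a1, a2]
    have h0 : Integrable fun x => 2 * (|d x| * wt x) := hd.integrable.const_mul 2
    have h2 : Integrable fun x => |d (x + h)| * wt x - 2 * (|d x| * wt x) := (hI h).sub h0
    have h3 : Integrable fun x => |d x| * wt (x + -h) - 2 * (|d x| * wt x) := (hint (-h)).sub h0
    rw [integral_const_mul, integral_const_mul,
      integral_add h2 (hI (-h)), integral_sub (hI h) h0,
      integral_add h3 (hint h), integral_sub (hint (-h)) h0,
      hshift h, hshift (-h)]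
    simp only [sub_neg_eq_add, ← sub_eq_add_neg]
  rw [e1, wnorm, ← integral_const_mul]
  refine integral_mono ?_ (hd.integrable.const_mul 8) fun x => ?_
  · have a2 : ∀ x, |d x| * lap h wt x =
        (h ^ 2)⁻¹ * ((|d x| * wt (x + -h) - 2 * (|d x| * wt x)) + |d x| * wt (x + h)) := by
      intro x; unfold lap; rw [div_eq_inv_mul, sub_eq_add_neg x h]; ring
    simp_rw [a2]
    exact (((hint (-h)).sub (hd.integrable.const_mul 2)).add (hint h)).const_mul _
  · have := mul_le_mul_of_nonneg_left (lap_wt_le hh h1 x) (abs_nonneg (d x))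
    simp only
    linarith

/-- One step of the explicit scheme is almost a contraction for the weighted `L¹` norm. -/
lemma wnorm_step_le {h τ L : ℝ} (hh : 0 < h) (h1 : h ≤ 1 / 2) (hτ : 0 ≤ τ)
    (hcfl : 2 * L * τ ≤ h ^ 2) {z d s z' : ℝ → ℝ} (hz : BddMeas z) (hd : BddMeas d)
    (hs : BddMeas s) (hdz : ∀ x, ∃ a, 0 ≤ a ∧ a ≤ L ∧ d x = a * z x)
    (hz' : ∀ x, z' x = z x + τ * lap h d x + s x) :
    wnorm z' ≤ (1 + 8 * L * τ) * wnorm z + wnorm s := by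
  have hpt : ∀ x, |z' x| ≤ |z x| + τ * lap h (fun y => |d y|) x + |s x| := by
    intro x
    obtain ⟨a, ha0, haL, had⟩ := hdz x
    have e : z' x = (1 - 2 * (τ / h ^ 2) * a) * z x + (τ / h ^ 2) * d (x + h)
        + (τ / h ^ 2) * d (x - h) + s x := by
      rw [hz', lap, had]; ring
    have hlam : 0 ≤ τ / h ^ 2 := by positivity
    have hc : 0 ≤ 1 - 2 * (τ / h ^ 2) * a := by
      have : 2 * (τ / h ^ 2) * a ≤ 2 * (τ / h ^ 2) * L := by gcongr
      have h2 : 2 * (τ / h ^ 2) * L ≤ 1 := by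
        rw [show 2 * (τ / h ^ 2) * L = (2 * L * τ) / h ^ 2 by ring, div_le_one (by positivity)]
        exact hcfl
      linarith
    have e2 : |z x| + τ * lap h (fun y => |d y|) x + |s x| =
        (1 - 2 * (τ / h ^ 2) * a) * |z x| + (τ / h ^ 2) * |d (x + h)|
        + (τ / h ^ 2) * |d (x - h)| + |s x| := by
      rw [lap, had, abs_mul, abs_of_nonneg ha0]; ring
    rw [e, e2]
    refine (abs_add_le _ _).trans (add_le_add_left ((abs_add_le _ _).trans (add_le_add
      ((abs_add_le _ _).trans (add_le_add ?_ ?_)) ?_)) _)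
    · rw [abs_mul, abs_of_nonneg hc]
    · rw [abs_mul, abs_of_nonneg hlam]
    · rw [abs_mul, abs_of_nonneg hlam]
  have hL : Integrable fun x => lap h (fun y => |d y|) x * wt x := by
    obtain ⟨B, hB⟩ := (hd.abs.lap h).2
    refine (integrable_wt.const_mul B).mono'
      (((hd.abs.lap h).1.mul continuous_wt.measurable).aestronglyMeasurable)
      (Eventually.of_forall fun x => ?_)
    rw [norm_mul, Real.norm_eq_abs, Real.norm_of_nonneg (wt_nonneg x)]
    exact mul_le_mul_of_nonneg_right (hB x) (wt_nonneg x)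
  have hbound : wnorm z' ≤
      ∫ x, (|z x| * wt x + τ * (lap h (fun y => |d y|) x * wt x) + |s x| * wt x) := by
    refine integral_mono_of_nonneg
      (Eventually.of_forall fun x => mul_nonneg (abs_nonneg _) (wt_nonneg x))
      ((hz.integrable.add (hL.const_mul τ)).add hs.integrable) (Eventually.of_forall fun x => ?_)
    have := mul_le_mul_of_nonneg_right (hpt x) (wt_nonneg x)
    simp only
    linarith
  have hint : Integrable fun x => |z x| * wt x + τ * (lap h (fun y => |d y|) x * wt x) :=
    hz.integrable.add (hL.const_mul τ)
  rw [integral_add hint hs.integrable,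
    integral_add hz.integrable (hL.const_mul τ), integral_const_mul] at hbound
  have hd' : wnorm d ≤ L * wnorm z := by
    obtain ⟨a, ha0, haL, -⟩ := hdz 0
    have h0 := wnorm_const_mul L z
    rw [abs_of_nonneg (ha0.trans haL)] at h0
    rw [← h0]
    refine wnorm_mono (hz.const_mul L) fun x => ?_
    obtain ⟨a, ha0, haL, had⟩ := hdz x
    rw [had, abs_mul, abs_mul, abs_of_nonneg ha0, abs_of_nonneg (ha0.trans haL)]
    gcongr
  have h2 := integral_abs_lap_mul_wt_le hh h1 hd
  have h3 : τ * ∫ x, lap h (fun y => |d y|) x * wt x ≤ τ * (8 * (L * wnorm z)) := by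
    gcongr; linarith
  have e3 : ∫ x, |z x| * wt x = wnorm z := rfl
  have e4 : ∫ x, |s x| * wt x = wnorm s := rfl
  rw [e3, e4] at hbound
  linarith

/-- Structural assumptions on a degenerate diffusion `Φ` and a reaction `g`. -/
structure Coeffs (Φ : ℝ → ℝ) (g : ℝ → ℝ → ℝ) (L : ℝ) : Prop where
  one_le : 1 ≤ L
  mono : Monotone Φ
  lip : ∀ a b, |Φ a - Φ b| ≤ L * |a - b|
  bdd : ∀ a, |Φ a| ≤ L
  gcont : Continuous (Function.uncurry g)
  glip : ∀ x a b, |g x a - g x b| ≤ L * |a - b|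
  gbdd : ∀ x a, |g x a| ≤ L

/-- Solutions of `U_t = (Φ(U))_{xx} + g(x,U)` on `[0,T]` in twice space-integrated form. -/
structure Sol (Φ : ℝ → ℝ) (g : ℝ → ℝ → ℝ) (T : ℝ) (U : ℝ → ℝ → ℝ) : Prop where
  cont : ContinuousOn (Function.uncurry U) (univ ×ˢ Ioi 0)
  meas : Measurable (Function.uncurry U)
  bdd : ∃ B, ∀ x, ∀ t ∈ Icc 0 T, |U x t| ≤ B
  init : ∀ᵐ x, ContinuousAt (fun y => U y 0) x
  eqn : ∀ h, 0 < h → h ≤ 1 → ∀ x, ∀ t ∈ Icc 0 T,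
    avg h (fun y => U y t) x = avg h (fun y => U y 0) x +
      ∫ s in (0 : ℝ)..t, (lap h (fun y => Φ (U y s)) x + avg h (fun y => g y (U y s)) x)

/-- The explicit Euler scheme. -/
def scheme (h τ : ℝ) (Φ : ℝ → ℝ) (g : ℝ → ℝ → ℝ) (V₀ : ℝ → ℝ) : ℕ → ℝ → ℝ
  | 0 => V₀
  | k + 1 => fun x => scheme h τ Φ g V₀ k x +
      τ * (lap h (fun y => Φ (scheme h τ Φ g V₀ k y)) x + g x (scheme h τ Φ g V₀ k x))

lemma gronwall_layer {e b : ℕ → ℝ} {c τ η B₁ B₂ : ℝ} (hc : 0 ≤ c) (hτ : 0 ≤ τ)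
    (hη : 0 ≤ η) (hB₁ : 0 ≤ B₁) (hB₂ : 0 ≤ B₂) (he : 0 ≤ e 0) {K : ℕ}
    (hstep : ∀ k < K, e (k + 1) ≤ (1 + c * τ) * e k + τ * b k)
    (h₁ : ∀ k < K, k * τ < η → b k ≤ B₁) (h₂ : ∀ k < K, η ≤ k * τ → b k ≤ B₂) :
    ∀ k ≤ K, e k ≤ Real.exp (c * (k * τ)) * (e 0 + B₁ * (η + τ) + B₂ * (k * τ)) := by
  have key : ∀ k ≤ K, e k ≤ Real.exp (c * (k * τ)) *
      (e 0 + B₁ * min (k * τ) (η + τ) + B₂ * (k * τ)) := by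
    intro k
    induction k with
    | zero => intro _; simp [min_eq_left (add_nonneg hη hτ)]
    | succ k ih =>
      intro hk
      have ih := ih (by omega)
      have hk' : k < K := by omega
      have hb : τ * b k ≤ B₁ * (min ((k + 1 : ℕ) * τ) (η + τ) - min (k * τ) (η + τ))
          + B₂ * τ := by
        push_cast
        rcases lt_or_ge (k * τ) η with hlt | hge
        · rw [min_eq_left (by linarith), min_eq_left (by linarith)]
          have := mul_le_mul_of_nonneg_left (h₁ k hk' hlt) hτ
          have : 0 ≤ B₂ * τ := by positivity
          nlinarith
        · have h3 := mul_le_mul_of_nonneg_left (h₂ k hk' hge) hτ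
          have h4 : min (k * τ) (η + τ) ≤ min ((k + 1) * τ) (η + τ) := by
            gcongr; linarith
          have h5 := mul_nonneg hB₁ (sub_nonneg.2 h4)
          linarith
      have hexp : 1 + c * τ ≤ Real.exp (c * τ) := by
        linarith [Real.add_one_le_exp (c * τ)]
      set S := e 0 + B₁ * min (k * τ) (η + τ) + B₂ * (k * τ) with hS
      have hmin : 0 ≤ min (k * τ) (η + τ) := le_min (by positivity) (by positivity)
      have hmin' : 0 ≤ min (((k + 1 : ℕ) : ℝ) * τ) (η + τ) := le_min (by positivity) (by positivity)
      have hS0 : 0 ≤ S := by positivity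
      have e1 : Real.exp (c * ((k + 1 : ℕ) * τ)) =
          Real.exp (c * τ) * Real.exp (c * (k * τ)) := by
        rw [← Real.exp_add]; congr 1; push_cast; ring
      have hc1 : 0 ≤ 1 + c * τ := by positivity
      have h6 : (1 + c * τ) * e k ≤ Real.exp (c * ((k + 1 : ℕ) * τ)) * S := by
        rw [e1, mul_assoc]
        calc (1 + c * τ) * e k ≤ (1 + c * τ) * (Real.exp (c * (k * τ)) * S) := by gcongr
          _ ≤ _ := by gcongr
      have h7 : 1 ≤ Real.exp (c * ((k + 1 : ℕ) * τ)) := Real.one_le_exp (by positivity)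
      have h8 : 0 ≤ B₁ * (min ((k + 1 : ℕ) * τ) (η + τ) - min (k * τ) (η + τ)) + B₂ * τ := by
        have h4 : min (k * τ) (η + τ) ≤ min ((k + 1 : ℕ) * τ) (η + τ) := by
          push_cast
          gcongr; linarith
        have h5 := mul_nonneg hB₁ (sub_nonneg.2 h4)
        positivity
      have h9 := le_mul_of_one_le_left h8 h7
      have h10 := hstep k hk'
      have : (Real.exp (c * ((k + 1 : ℕ) * τ))) *
          (e 0 + B₁ * min ((k + 1 : ℕ) * τ) (η + τ) + B₂ * ((k + 1 : ℕ) * τ)) =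
          Real.exp (c * ((k + 1 : ℕ) * τ)) * S + Real.exp (c * ((k + 1 : ℕ) * τ)) *
          (B₁ * (min ((k + 1 : ℕ) * τ) (η + τ) - min (k * τ) (η + τ)) + B₂ * τ) := by
        rw [hS]; push_cast; ring
      rw [this]
      linarith
  intro k hk
  refine (key k hk).trans ?_
  have := min_le_right (k * τ) (η + τ)
  gcongr

section average

lemma intervalIntegrable_hat {h : ℝ} {q : ℝ → ℝ} (hq : BddMeas q) (x : ℝ) :
    IntervalIntegrable (fun ξ => (1 - ξ) * (q (x + h * ξ) + q (x - h * ξ))) volume 0 1 := by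
  obtain ⟨B, hB⟩ := hq.2
  have h1 : Measurable fun ξ : ℝ => (1 - ξ) * (q (x + h * ξ) + q (x - h * ξ)) :=
    (measurable_const.sub measurable_id).mul
      ((hq.1.comp (by fun_prop)).add (hq.1.comp (by fun_prop)))
  refine IntervalIntegrable.mono_fun' (g := fun _ => 2 * B) (by simp)
    h1.aestronglyMeasurable ?_
  rw [uIoc_of_le zero_le_one]
  filter_upwards [ae_restrict_mem measurableSet_Ioc] with ξ hξ
  rw [norm_mul, Real.norm_eq_abs, Real.norm_eq_abs]
  have h2 : |1 - ξ| ≤ 1 := by rw [abs_le]; constructor <;> linarith [hξ.1, hξ.2]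
  have h3 := abs_add_le (q (x + h * ξ)) (q (x - h * ξ))
  have h4 := hB (x + h * ξ)
  have h5 := hB (x - h * ξ)
  nlinarith [abs_nonneg (1 - ξ), abs_nonneg (q (x + h * ξ) + q (x - h * ξ))]

lemma avg_const_mul (h c : ℝ) (q : ℝ → ℝ) (x : ℝ) :
    avg h (fun y => c * q y) x = c * avg h q x := by
  unfold avg
  rw [← intervalIntegral.integral_const_mul]
  congr 1; funext ξ; ring

lemma avg_const (h c x : ℝ) : avg h (fun _ => c) x = c := by
  unfold avg
  have : ∫ ξ in (0 : ℝ)..1, (1 - ξ) = 1 / 2 := by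
    rw [intervalIntegral.integral_sub (by simp) (by simp)]; simp; norm_num
  rw [intervalIntegral.integral_mul_const, this]; ring

lemma avg_mono {h : ℝ} {q r : ℝ → ℝ} (hh : 0 ≤ h) (hq : BddMeas q) (hr : BddMeas r) (x : ℝ)
    (hqr : ∀ w, |w| ≤ h → q (x + w) ≤ r (x + w)) : avg h q x ≤ avg h r x := by
  refine intervalIntegral.integral_mono_on zero_le_one (intervalIntegrable_hat hq x)
    (intervalIntegrable_hat hr x) fun ξ hξ => ?_
  have h1 : |h * ξ| ≤ h := by
    rw [abs_mul, abs_of_nonneg hh, abs_of_nonneg hξ.1]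
    exact mul_le_of_le_one_right hh hξ.2
  have h2 := hqr (h * ξ) h1
  have h3 := hqr (-(h * ξ)) (by rwa [abs_neg])
  rw [← sub_eq_add_neg] at h3
  have : 0 ≤ 1 - ξ := by linarith [hξ.2]
  gcongr

lemma bddMeas_const (c : ℝ) : BddMeas fun _ => c := ⟨measurable_const, |c|, fun _ => le_rfl⟩

lemma abs_avg_sub_le {h : ℝ} {q : ℝ → ℝ} (hh : 0 ≤ h) (hq : BddMeas q) {x a c : ℝ}
    (hqr : ∀ w, |w| ≤ h → |q (x + w) - a| ≤ c) : |avg h q x - a| ≤ c := by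
  have h1 := avg_mono hh hq (bddMeas_const (a + c)) x
    fun w hw => by linarith [(abs_le.1 (hqr w hw)).2]
  have h2 := avg_mono hh (bddMeas_const (a - c)) hq x
    fun w hw => by linarith [(abs_le.1 (hqr w hw)).1]
  rw [avg_const] at h1 h2
  rw [abs_le]; constructor <;> linarith

lemma abs_avg_le {h : ℝ} {q : ℝ → ℝ} (hh : 0 ≤ h) (hq : BddMeas q) {c : ℝ}
    (hqr : ∀ y, |q y| ≤ c) (x : ℝ) : |avg h q x| ≤ c := by
  have := abs_avg_sub_le (x := x) (a := 0) (c := c) hh hq fun w _ => by simpa using hqr _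
  simpa using this

lemma measurable_avg {F : ℝ → ℝ → ℝ} (hF : Measurable (Function.uncurry F)) (h : ℝ) :
    Measurable fun p : ℝ × ℝ => avg h (fun y => F y p.2) p.1 := by
  unfold avg
  simp only [intervalIntegral.integral_of_le zero_le_one]
  have h1 : Measurable fun z : (ℝ × ℝ) × ℝ => F (z.1.1 + h * z.2) z.1.2 :=
    hF.comp (f := fun z : (ℝ × ℝ) × ℝ => (z.1.1 + h * z.2, z.1.2)) (by fun_prop)
  have h2 : Measurable fun z : (ℝ × ℝ) × ℝ => F (z.1.1 - h * z.2) z.1.2 :=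
    hF.comp (f := fun z : (ℝ × ℝ) × ℝ => (z.1.1 - h * z.2, z.1.2)) (by fun_prop)
  have h3 : Measurable fun z : (ℝ × ℝ) × ℝ =>
      (1 - z.2) * (F (z.1.1 + h * z.2) z.1.2 + F (z.1.1 - h * z.2) z.1.2) :=
    (by fun_prop : Measurable fun z : (ℝ × ℝ) × ℝ => 1 - z.2).mul (h1.add h2)
  exact (h3.stronglyMeasurable.integral_prod_right (ν := volume.restrict (Ioc (0 : ℝ) 1))).measurable

lemma BddMeas.avg {q : ℝ → ℝ} (hq : BddMeas q) {h : ℝ} (hh : 0 ≤ h) : BddMeas (avg h q) := by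
  obtain ⟨B, hB⟩ := hq.2
  have h1 : Measurable (Function.uncurry fun x (_ : ℝ) => q x) := hq.1.comp measurable_fst
  exact ⟨(measurable_avg h1 h).comp (f := fun x : ℝ => (x, (0 : ℝ))) (by fun_prop), B,
    abs_avg_le hh hq hB⟩

/-- Time integrals of jointly measurable bounded functions. -/
lemma BddMeas.integral {F : ℝ → ℝ → ℝ} (hF : Measurable (Function.uncurry F)) {B : ℝ}
    (hB : ∀ x s, |F x s| ≤ B) (a b : ℝ) : BddMeas fun x => ∫ s in a..b, F x s := by
  refine ⟨?_, B * |b - a|, fun x => ?_⟩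
  · simp only [intervalIntegral.intervalIntegral_eq_integral_uIoc]
    exact ((hF.stronglyMeasurable.integral_prod_right
      (ν := volume.restrict (uIoc a b))).measurable).const_smul (if a ≤ b then (1 : ℝ) else -1)
  · have := intervalIntegral.norm_integral_le_of_norm_le_const (a := a) (b := b)
      (f := fun s => F x s) (C := B) fun s _ => hB x s
    simpa using this

lemma intervalIntegrable_of_bdd {F : ℝ → ℝ} (hF : BddMeas F) (a b : ℝ) :
    IntervalIntegrable F volume a b := by
  obtain ⟨B, hB⟩ := hF.2
  exact IntervalIntegrable.mono_fun' (g := fun _ => B) (by simp)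
    hF.1.aestronglyMeasurable (Eventually.of_forall fun s => hB s)

end average

/-- `F` varies by at most `δ cosh x` over distances at most `ρ`, between times `η` and `T`. -/
def Modulus (F : ℝ → ℝ → ℝ) (η T δ ρ : ℝ) : Prop :=
  ∀ x y s s', s ∈ Icc η T → s' ∈ Icc η T → |s' - s| ≤ ρ → |y| ≤ ρ →
    |F (x + y) s' - F x s| ≤ δ * Real.cosh x

lemma exists_modulus {F : ℝ → ℝ → ℝ} (hF : ContinuousOn (Function.uncurry F) (univ ×ˢ Ioi 0))
    {T B : ℝ} (hB : ∀ x, ∀ t ∈ Icc 0 T, |F x t| ≤ B) {η δ : ℝ} (hη : 0 < η) (hδ : 0 < δ) :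
    ∃ ρ > 0, Modulus F η T δ ρ := by
  set R := 2 * |B| / δ + 1 with hR
  have hR0 : 0 < R := by positivity
  have hcpt : IsCompact (Icc (-(R + 1)) (R + 1) ×ˢ Icc η T) := isCompact_Icc.prod isCompact_Icc
  have huc := hcpt.uniformContinuousOn_of_continuous (f := Function.uncurry F)
    (hF.mono fun z hz => ⟨mem_univ _, lt_of_lt_of_le hη hz.2.1⟩)
  rw [Metric.uniformContinuousOn_iff] at huc
  obtain ⟨ρ, hρ, hu⟩ := huc δ hδ
  refine ⟨min (ρ / 2) 1, by positivity, fun x y s s' hs hs' h1 h2 => ?_⟩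
  have hc1 := Real.one_le_cosh x
  rcases le_or_gt |x| R with hx | hx
  · have hy1 : |y| ≤ 1 := h2.trans (min_le_right _ _)
    have hx' := abs_le.1 hx
    have hy' := abs_le.1 hy1
    have := hu (x + y, s') ⟨⟨by linarith [hx'.1, hy'.1], by linarith [hx'.2, hy'.2]⟩, hs'⟩
      (x, s) ⟨⟨by linarith, by linarith⟩, hs⟩ (by
        rw [Prod.dist_eq]
        refine max_lt ?_ ?_
        · simp only [Real.dist_eq, add_sub_cancel_left]
          exact lt_of_le_of_lt (h2.trans (min_le_left _ _)) (by linarith)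
        · simp only [Real.dist_eq]
          exact lt_of_le_of_lt (h1.trans (min_le_left _ _)) (by linarith))
    rw [Real.dist_eq] at this
    simp only [Function.uncurry] at this
    nlinarith
  · have h3 : |F (x + y) s' - F x s| ≤ 2 * |B| := by
      have a1 := hB (x + y) s' ⟨hη.le.trans hs'.1, hs'.2⟩
      have a2 := hB x s ⟨hη.le.trans hs.1, hs.2⟩
      have a3 := abs_sub (F (x + y) s') (F x s)
      linarith [le_abs_self B]
    have h4 : R ≤ Real.cosh x := by
      have := one_add_sq_div_two_le_cosh x
      rw [← sq_abs] at this
      nlinarith [sq_nonneg (|x| - 1), abs_nonneg x]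
    have h5 : 2 * |B| ≤ δ * R := by
      rw [hR, mul_add, mul_div_cancel₀ _ hδ.ne']; linarith
    nlinarith

lemma Modulus.avg_sub_le {F : ℝ → ℝ → ℝ} {η T δ ρ : ℝ} (hF : Modulus F η T δ ρ)
    {h x y s s' : ℝ} (hh : 0 ≤ h) (hm : BddMeas fun z => F z s') (hs : s ∈ Icc η T)
    (hs' : s' ∈ Icc η T) (h1 : |s' - s| ≤ ρ) (h2 : |y| + h ≤ ρ) :
    |avg h (fun z => F z s') (x + y) - F x s| ≤ δ * Real.cosh x :=
  abs_avg_sub_le hh hm fun w hw => by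
    rw [add_assoc]
    exact hF x (y + w) s s' hs hs' h1 ((abs_add_le _ _).trans (by linarith))

lemma wnorm_sum_le {ι : Type*} (s : Finset ι) {q : ι → ℝ → ℝ} (hq : ∀ i ∈ s, BddMeas (q i))
    {ω : ℝ} (hω : ∀ i ∈ s, wnorm (q i) ≤ ω) :
    BddMeas (fun x => ∑ i ∈ s, q i x) ∧ wnorm (fun x => ∑ i ∈ s, q i x) ≤ s.card * ω := by
  classical
  induction s using Finset.induction_on with
  | empty => exact ⟨by simpa using bddMeas_const 0, by simp [wnorm]⟩
  | insert a s ha ih =>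
    obtain ⟨h1, h2⟩ := ih (fun i hi => hq i (Finset.mem_insert_of_mem hi))
      (fun i hi => hω i (Finset.mem_insert_of_mem hi))
    have h3 := hq a (Finset.mem_insert_self _ _)
    simp only [Finset.sum_insert ha]
    refine ⟨h3.add h1, (wnorm_add_le h3 h1).trans ?_⟩
    have := hω a (Finset.mem_insert_self _ _)
    rw [Finset.card_insert_of_notMem ha]
    push_cast
    linarith

lemma sum_lap_eq (E : ℝ → ℝ) (h : ℝ) (J : ℕ) (x : ℝ) :
    ∑ j ∈ Finset.range J, ∑ i ∈ Finset.range J, lap h E (x + ((i : ℝ) - j) * h) =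
      (J : ℝ) ^ 2 * lap (J * h) E x := by
  rcases Nat.eq_zero_or_pos J with rfl | hJ
  · simp
  have hJ' : (0 : ℝ) < J := by exact_mod_cast hJ
  let b : ℕ → ℕ → ℝ := fun i j => E (x + ((i : ℝ) - j) * h)
  have h1 : ∀ i j : ℕ, lap h E (x + ((i : ℝ) - j) * h) =
      ((b (i + 1) j - b i j) - (b (i + 1) (j + 1) - b i (j + 1))) / h ^ 2 := by
    intro i j
    simp only [lap, b]
    push_cast
    rw [show x + ((i : ℝ) + 1 - j) * h = x + ((i : ℝ) - j) * h + h by ring,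
      show x + ((i : ℝ) + 1 - (j + 1)) * h = x + ((i : ℝ) - j) * h by ring,
      show x + ((i : ℝ) - (j + 1)) * h = x + ((i : ℝ) - j) * h - h by ring]
    ring
  simp_rw [h1, ← Finset.sum_div, Finset.sum_sub_distrib]
  have h2 : ∀ j, ∑ i ∈ Finset.range J, b (i + 1) j - ∑ i ∈ Finset.range J, b i j =
      b J j - b 0 j := fun j => by
    rw [← Finset.sum_sub_distrib]; exact Finset.sum_range_sub (fun i => b i j) J
  have h3 : ∑ j ∈ Finset.range J, ∑ i ∈ Finset.range J, b (i + 1) j -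
      ∑ j ∈ Finset.range J, ∑ i ∈ Finset.range J, b i j -
      (∑ j ∈ Finset.range J, ∑ i ∈ Finset.range J, b (i + 1) (j + 1) -
      ∑ j ∈ Finset.range J, ∑ i ∈ Finset.range J, b i (j + 1)) =
      (b J 0 - b 0 0) - (b J J - b 0 J) := by
    rw [← Finset.sum_sub_distrib, ← Finset.sum_sub_distrib]
    simp_rw [h2]
    rw [← Finset.sum_sub_distrib]
    exact Finset.sum_range_sub' (fun j => b J j - b 0 j) J
  rw [h3]
  simp only [b, lap]
  rw [mul_pow, mul_div_assoc', mul_div_mul_left _ _ (by positivity)]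
  simp only [Nat.cast_zero, sub_self, zero_mul, add_zero, sub_zero, zero_sub, neg_mul,
    ← sub_eq_add_neg]
  ring

/-- A function with small translation modulus which is a second difference of a small function
is small. -/
lemma wnorm_le_of_lap {E z : ℝ → ℝ} {h ρ e ω : ℝ} (hh : 0 < h) (hhρ : h ≤ ρ) (hρ : ρ ≤ 1)
    (he : 0 ≤ e) (hz : BddMeas z) (hE : ∀ x, |E x| ≤ e * Real.cosh x)
    (hzE : ∀ x, z x = lap h E x)
    (hω : ∀ y, |y| ≤ ρ → wnorm (fun x => z (x + y) - z x) ≤ ω) :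
    wnorm z ≤ 32 * e * coshMass / ρ ^ 2 + ω := by
  have hρ0 : 0 < ρ := hh.trans_le hhρ
  set J := ⌊ρ / h⌋₊ with hJ
  have hJ1 : 1 ≤ J := Nat.le_floor (by rw [Nat.cast_one, one_le_div hh]; exact hhρ)
  have hJ1' : (1 : ℝ) ≤ J := by exact_mod_cast hJ1
  have hJ2 : J * h ≤ ρ := by
    have := Nat.floor_le (show 0 ≤ ρ / h by positivity)
    rwa [le_div_iff₀ hh] at this
  have hJ3 : ρ / 2 ≤ J * h := by
    have := Nat.lt_floor_add_one (ρ / h)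
    rw [div_lt_iff₀ hh] at this
    nlinarith
  let d : ℕ → ℕ → ℝ → ℝ := fun j i x => z (x + ((i : ℝ) - j) * h) - z x
  have hd : ∀ j i, BddMeas (d j i) := fun j i => (hz.translate _).sub hz
  have hdω : ∀ j ∈ Finset.range J, ∀ i ∈ Finset.range J, wnorm (d j i) ≤ ω := by
    intro j hj i hi
    refine hω _ ?_
    rw [abs_mul, abs_of_pos hh]
    refine le_trans ?_ hJ2
    gcongr
    have h1 : (i : ℝ) < J := by exact_mod_cast Finset.mem_range.1 hi
    have h2 : (j : ℝ) < J := by exact_mod_cast Finset.mem_range.1 hj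
    rw [abs_le]; constructor <;> linarith [(Nat.cast_nonneg i : (0 : ℝ) ≤ i),
      (Nat.cast_nonneg j : (0 : ℝ) ≤ j)]
  have h1 : ∀ j ∈ Finset.range J, BddMeas (fun x => ∑ i ∈ Finset.range J, d j i x) ∧
      wnorm (fun x => ∑ i ∈ Finset.range J, d j i x) ≤ J * ω := fun j hj => by
    have := wnorm_sum_le (Finset.range J) (fun i _ => hd j i) (hdω j hj)
    simpa using this
  obtain ⟨h2, h3⟩ := wnorm_sum_le (Finset.range J) (fun j hj => (h1 j hj).1)
    (fun j hj => (h1 j hj).2)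
  rw [Finset.card_range] at h3
  set D : ℝ → ℝ := fun x => ∑ j ∈ Finset.range J, ∑ i ∈ Finset.range J, d j i x with hD
  have hJ0 : (J : ℝ) ≠ 0 := by positivity
  have hDx : ∀ x, D x = (J : ℝ) ^ 2 * (lap (J * h) E x - z x) := by
    intro x
    have := sum_lap_eq E h J x
    simp_rw [← hzE] at this
    simp only [hD, d, Finset.sum_sub_distrib, this]
    simp
    ring
  have hlap : ∀ x, |lap (J * h) E x| ≤ 32 * e / ρ ^ 2 * Real.cosh x := by
    intro x
    have a1 : |(J : ℝ) * h| ≤ 1 := by rw [abs_of_nonneg (by positivity)]; linarith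
    have b1 := (hE (x + J * h)).trans (mul_le_mul_of_nonneg_left (cosh_add_le_three a1) he)
    have b2 : |E (x - J * h)| ≤ e * (3 * Real.cosh x) := by
      refine (hE _).trans (mul_le_mul_of_nonneg_left ?_ he)
      rw [sub_eq_add_neg]
      exact cosh_add_le_three (by rwa [abs_neg])
    have b3 := hE x
    have b4 : |E (x + J * h) - 2 * E x + E (x - J * h)| ≤ 8 * e * Real.cosh x := by
      rw [abs_le] at *
      constructor <;> linarith [b1.1, b1.2, b2.1, b2.2, b3.1, b3.2]
    rw [lap, abs_div, abs_of_nonneg (sq_nonneg ((J : ℝ) * h)), div_le_iff₀ (by positivity)]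
    refine b4.trans ?_
    have b5 : (ρ / 2) ^ 2 ≤ (J * h) ^ 2 := by gcongr
    have b6 : 0 ≤ 32 * e / ρ ^ 2 * Real.cosh x := by
      have := Real.cosh_pos x; positivity
    calc 8 * e * Real.cosh x = 32 * e / ρ ^ 2 * Real.cosh x * (ρ / 2) ^ 2 := by field_simp; ring
      _ ≤ _ := by gcongr
  have hzx : ∀ x, z x = (fun x => z x + (J ^ 2 : ℝ)⁻¹ * D x) x + (-(J ^ 2 : ℝ)⁻¹) * D x := by
    intro x; simp
  have hfin : wnorm z ≤ wnorm (fun x => z x + (J ^ 2 : ℝ)⁻¹ * D x) +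
      wnorm (fun x => (-(J ^ 2 : ℝ)⁻¹) * D x) := by
    have := wnorm_add_le (hz.add (h2.const_mul (J ^ 2 : ℝ)⁻¹)) (h2.const_mul (-(J ^ 2 : ℝ)⁻¹))
    simpa only [← hzx] using this
  have h5 : wnorm (fun x => z x + (J ^ 2 : ℝ)⁻¹ * D x) ≤ 32 * e / ρ ^ 2 * coshMass := by
    refine wnorm_le_of_le_cosh fun x => ?_
    have : z x + (J ^ 2 : ℝ)⁻¹ * D x = lap (J * h) E x := by
      rw [hDx, inv_mul_cancel_left₀ (by positivity)]; ring
    rw [this]; exact hlap x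
  have h6 : wnorm (fun x => (-(J ^ 2 : ℝ)⁻¹) * D x) ≤ ω := by
    rw [wnorm_const_mul, abs_neg, abs_of_nonneg (by positivity)]
    calc (J ^ 2 : ℝ)⁻¹ * wnorm D ≤ (J ^ 2 : ℝ)⁻¹ * (J * (J * ω)) := by gcongr
      _ = ω := by field_simp
  calc _ ≤ _ := hfin
    _ ≤ 32 * e / ρ ^ 2 * coshMass + ω := add_le_add h5 h6
    _ = _ := by ring

/-- Averages and translates of bounded, a.e. continuous functions converge in `wnorm`. -/
lemma exists_wnorm_avg_sub_le {q : ℝ → ℝ} (hq : BddMeas q) (hc : ∀ᵐ x, ContinuousAt q x)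
    {ε : ℝ} (hε : 0 < ε) :
    ∃ ρ > 0, ∀ h y, 0 ≤ h → h ≤ ρ → |y| ≤ ρ → wnorm (fun x => avg h q (x + y) - q x) ≤ ε := by
  obtain ⟨B, hB⟩ := hq.2
  have hlim : Tendsto (fun p : ℝ × ℝ => ∫ x, |avg p.1 q (x + p.2) - q x| * wt x)
      (nhdsWithin (0, 0) (Ici 0 ×ˢ univ)) (nhds (∫ _ : ℝ, (0 : ℝ))) := by
    refine tendsto_integral_filter_of_dominated_convergence (fun x => 2 * B * wt x) ?_ ?_
      (integrable_wt.const_mul _) ?_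
    · filter_upwards [self_mem_nhdsWithin] with p hp
      exact (((hq.avg hp.1).translate p.2).sub hq).integrable.aestronglyMeasurable
    · filter_upwards [self_mem_nhdsWithin] with p hp
      refine Eventually.of_forall fun x => ?_
      rw [Real.norm_of_nonneg (mul_nonneg (abs_nonneg _) (wt_nonneg x))]
      have h1 := abs_avg_le hp.1 hq hB (x + p.2)
      have h2 := hB x
      have h3 := abs_sub (avg p.1 q (x + p.2)) (q x)
      have := wt_nonneg x
      gcongr
      linarith
    · filter_upwards [hc] with x hx
      rw [Metric.tendsto_nhdsWithin_nhds]
      intro r hr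
      have hw := wt_pos x
      obtain ⟨ρ, hρ, hx⟩ := Metric.continuousAt_iff.1 hx (r / (2 * wt x)) (by positivity)
      refine ⟨ρ / 2, by positivity, fun {p} hp hd => ?_⟩
      rw [Prod.dist_eq] at hd
      have d1 := lt_of_le_of_lt (le_max_left _ _) hd
      have d2 := lt_of_le_of_lt (le_max_right _ _) hd
      simp only [Real.dist_eq, sub_zero] at d1 d2
      have : |avg p.1 q (x + p.2) - q x| ≤ r / (2 * wt x) := by
        refine abs_avg_sub_le hp.1 hq fun w hw => ?_
        have := hx (x := x + p.2 + w) (by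
          rw [Real.dist_eq, show x + p.2 + w - x = p.2 + w by ring]
          have := abs_add_le p.2 w
          have := le_abs_self p.1
          linarith)
        exact (Real.dist_eq _ _ ▸ this).le
      rw [Real.dist_eq, sub_zero, abs_mul, abs_abs, abs_of_pos hw]
      calc _ ≤ r / (2 * wt x) * wt x := by gcongr
        _ = r / 2 := by field_simp
        _ < r := by linarith
  rw [integral_zero, Metric.tendsto_nhdsWithin_nhds] at hlim
  obtain ⟨ρ, hρ, hlim⟩ := hlim ε hε
  refine ⟨ρ / 2, by positivity, fun h y h0 h1 h2 => ?_⟩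
  have := hlim (x := (h, y)) ⟨h0, mem_univ _⟩ (by
    rw [Prod.dist_eq]
    simp only [Real.dist_eq, sub_zero]
    refine max_lt ?_ ?_
    · rw [abs_of_nonneg h0]; linarith
    · linarith)
  rw [Real.dist_eq, sub_zero] at this
  exact (le_abs_self _).trans this.le

namespace Coeffs

variable {Φ : ℝ → ℝ} {g : ℝ → ℝ → ℝ} {L : ℝ}

lemma pos (hC : Coeffs Φ g L) : 0 < L := zero_lt_one.trans_le hC.one_le

lemma continuous (hC : Coeffs Φ g L) : Continuous Φ := by
  refine (LipschitzWith.of_dist_le_mul (K := ⟨L, hC.pos.le⟩) fun a b => ?_).continuous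
  rw [Real.dist_eq, Real.dist_eq]
  exact hC.lip a b

lemma exists_slope (hC : Coeffs Φ g L) (p q : ℝ) :
    ∃ a, 0 ≤ a ∧ a ≤ L ∧ Φ p - Φ q = a * (p - q) := by
  rcases eq_or_ne p q with rfl | hne
  · exact ⟨0, le_rfl, hC.pos.le, by simp⟩
  have h1 : p - q ≠ 0 := sub_ne_zero.2 hne
  refine ⟨(Φ p - Φ q) / (p - q), ?_, ?_, (div_mul_cancel₀ _ h1).symm⟩
  · rcases lt_or_gt_of_ne hne with h | h
    · exact div_nonneg_of_nonpos (sub_nonpos.2 (hC.mono h.le)) (by linarith)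
    · exact div_nonneg (sub_nonneg.2 (hC.mono h.le)) (by linarith)
  · refine (le_abs_self _).trans ?_
    rw [abs_div, div_le_iff₀ (abs_pos.2 h1)]
    exact hC.lip p q

lemma bddMeas_comp (hC : Coeffs Φ g L) {q : ℝ → ℝ} (hq : Measurable q) :
    BddMeas fun x => Φ (q x) := BddMeas.comp_of_bdd hq hC.continuous hC.bdd

lemma measurable_reaction (hC : Coeffs Φ g L) {U : ℝ → ℝ → ℝ}
    (hU : Measurable (Function.uncurry U)) :
    Measurable (Function.uncurry fun x s => g x (U x s)) :=
  hC.gcont.measurable.comp (f := fun p : ℝ × ℝ => (p.1, U p.1 p.2)) (measurable_fst.prodMk hU)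

lemma bddMeas_reaction (hC : Coeffs Φ g L) {q : ℝ → ℝ} (hq : Measurable q) :
    BddMeas fun x => g x (q x) :=
  ⟨hC.gcont.measurable.comp (f := fun x => (x, q x)) (measurable_id.prodMk hq), L,
    fun _ => hC.gbdd _ _⟩

lemma bddMeas_scheme (hC : Coeffs Φ g L) (h τ : ℝ) {V₀ : ℝ → ℝ} (hV : BddMeas V₀) (k : ℕ) :
    BddMeas (scheme h τ Φ g V₀ k) := by
  induction k with
  | zero => exact hV
  | succ k ih =>
    exact ih.add ((((hC.bddMeas_comp ih.1).lap h).add (hC.bddMeas_reaction ih.1)).const_mul τ)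

end Coeffs

lemma measurable_slice {U : ℝ → ℝ → ℝ} (hU : Measurable (Function.uncurry U)) (t : ℝ) :
    Measurable fun x => U x t :=
  hU.comp (f := fun x : ℝ => (x, t)) (by fun_prop)

lemma measurable_slice' {U : ℝ → ℝ → ℝ} (hU : Measurable (Function.uncurry U)) (x : ℝ) :
    Measurable fun t => U x t :=
  hU.comp (f := fun t : ℝ => (x, t)) (by fun_prop)

lemma Sol.bddMeas {Φ : ℝ → ℝ} {g : ℝ → ℝ → ℝ} {T : ℝ} {U : ℝ → ℝ → ℝ} (hU : Sol Φ g T U)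
    {t : ℝ} (ht : t ∈ Icc 0 T) : BddMeas fun x => U x t := by
  obtain ⟨B, hB⟩ := hU.bdd
  exact ⟨measurable_slice hU.meas t, B, fun x => hB x t ht⟩

/-- The scheme with averaged exact reaction term. -/
def auxScheme (h τ : ℝ) (Φ : ℝ → ℝ) (g : ℝ → ℝ → ℝ) (U : ℝ → ℝ → ℝ) : ℕ → ℝ → ℝ
  | 0 => avg h fun y => U y 0
  | k + 1 => fun x => auxScheme h τ Φ g U k x +
      τ * lap h (fun y => Φ (auxScheme h τ Φ g U k y)) x +
      ∫ s in (k * τ)..((k + 1) * τ), avg h (fun y => g y (U y s)) x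

/-- Time-integrated flux error of the auxiliary scheme. -/
def fluxErr (h τ : ℝ) (Φ : ℝ → ℝ) (g : ℝ → ℝ → ℝ) (U : ℝ → ℝ → ℝ) (k : ℕ) (x : ℝ) : ℝ :=
  (∫ s in (0 : ℝ)..(k * τ), Φ (U x s)) -
    τ * ∑ i ∈ Finset.range k, Φ (auxScheme h τ Φ g U i x)

section convergence

variable {Φ : ℝ → ℝ} {g : ℝ → ℝ → ℝ} {L T : ℝ} {U : ℝ → ℝ → ℝ}

lemma intervalIntegrable_flux (hC : Coeffs Φ g L) (hU : Sol Φ g T U) (x a b : ℝ) :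
    IntervalIntegrable (fun s => Φ (U x s)) volume a b :=
  intervalIntegrable_of_bdd (hC.bddMeas_comp (measurable_slice' hU.meas x)) a b

lemma intervalIntegrable_avg_reaction (hC : Coeffs Φ g L) (hU : Sol Φ g T U) {h : ℝ}
    (hh : 0 ≤ h) (x a b : ℝ) :
    IntervalIntegrable (fun s => avg h (fun y => g y (U y s)) x) volume a b := by
  have h1 : Measurable (fun p : ℝ × ℝ => avg h (fun y => g y (U y p.2)) p.1) :=
    measurable_avg (hC.measurable_reaction hU.meas) h
  refine intervalIntegrable_of_bdd ⟨h1.comp (f := fun s : ℝ => (x, s)) (by fun_prop), L,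
    fun s => ?_⟩ a b
  exact abs_avg_le hh (hC.bddMeas_reaction (measurable_slice hU.meas s))
    (fun y => hC.gbdd _ _) x

lemma bddMeas_integral_avg_reaction (hC : Coeffs Φ g L) (hU : Sol Φ g T U) {h : ℝ}
    (hh : 0 ≤ h) (a b : ℝ) :
    BddMeas fun x => ∫ s in a..b, avg h (fun y => g y (U y s)) x := by
  have h1 : Measurable (fun p : ℝ × ℝ => avg h (fun y => g y (U y p.2)) p.1) :=
    measurable_avg (hC.measurable_reaction hU.meas) h
  exact BddMeas.integral (F := fun x s => avg h (fun y => g y (U y s)) x) h1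
    (fun x s => abs_avg_le hh (hC.bddMeas_reaction (measurable_slice hU.meas s))
      (fun y => hC.gbdd _ _) x) a b

lemma bddMeas_auxScheme (hC : Coeffs Φ g L) (hU : Sol Φ g T U) (hT : 0 ≤ T) {h : ℝ}
    (hh : 0 ≤ h) (τ : ℝ) (k : ℕ) : BddMeas (auxScheme h τ Φ g U k) := by
  induction k with
  | zero => exact (hU.bddMeas ⟨le_rfl, hT⟩).avg hh
  | succ k ih =>
    exact (ih.add (((hC.bddMeas_comp ih.1).lap h).const_mul τ)).add
      (bddMeas_integral_avg_reaction hC hU hh _ _)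

lemma lap_sum {ι : Type*} (s : Finset ι) (h : ℝ) (q : ι → ℝ → ℝ) (x : ℝ) :
    lap h (fun y => ∑ i ∈ s, q i y) x = ∑ i ∈ s, lap h (q i) x := by
  unfold lap
  rw [← Finset.sum_div, Finset.sum_add_distrib, Finset.sum_sub_distrib, Finset.mul_sum]

lemma auxScheme_eq (hC : Coeffs Φ g L) (hU : Sol Φ g T U) {h : ℝ} (hh : 0 ≤ h) (τ : ℝ)
    (k : ℕ) (x : ℝ) :
    auxScheme h τ Φ g U k x = avg h (fun y => U y 0) x +
      τ * lap h (fun y => ∑ i ∈ Finset.range k, Φ (auxScheme h τ Φ g U i y)) x +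
      ∫ s in (0 : ℝ)..(k * τ), avg h (fun y => g y (U y s)) x := by
  rw [lap_sum]
  induction k with
  | zero => simp [auxScheme]
  | succ k ih =>
    have := intervalIntegral.integral_add_adjacent_intervals
      (intervalIntegrable_avg_reaction hC hU hh x 0 (k * τ))
      (intervalIntegrable_avg_reaction hC hU hh x (k * τ) ((k + 1) * τ))
    simp only [auxScheme]
    rw [ih, Finset.sum_range_succ]
    push_cast
    rw [← this]
    ring

lemma lap_fluxErr (hC : Coeffs Φ g L) (hU : Sol Φ g T U) {h τ : ℝ} (hh : 0 < h) (h1 : h ≤ 1)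
    (hτ : 0 ≤ τ) {k : ℕ} (hk : k * τ ≤ T) (x : ℝ) :
    lap h (fluxErr h τ Φ g U k) x = avg h (fun y => U y (k * τ)) x - auxScheme h τ Φ g U k x := by
  have hfl := fun y => intervalIntegrable_flux hC hU y 0 (k * τ)
  have hlapint : ∫ s in (0 : ℝ)..(k * τ), lap h (fun y => Φ (U y s)) x =
      lap h (fun y => ∫ s in (0 : ℝ)..(k * τ), Φ (U y s)) x := by
    unfold lap
    rw [intervalIntegral.integral_div, intervalIntegral.integral_add
      ((hfl (x + h)).sub ((hfl x).const_mul 2)) (hfl (x - h)),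
      intervalIntegral.integral_sub (hfl (x + h)) ((hfl x).const_mul 2),
      intervalIntegral.integral_const_mul]
  have hli : IntervalIntegrable (fun s => lap h (fun y => Φ (U y s)) x) volume 0 (k * τ) := by
    unfold lap
    exact (((hfl (x + h)).sub ((hfl x).const_mul 2)).add (hfl (x - h))).div_const _
  rw [hU.eqn h hh h1 x (k * τ) ⟨by positivity, hk⟩, auxScheme_eq hC hU hh.le,
    intervalIntegral.integral_add hli (intervalIntegrable_avg_reaction hC hU hh.le x _ _),
    hlapint]
  unfold fluxErr
  unfold lap
  ring

lemma fluxErr_succ (hC : Coeffs Φ g L) (hU : Sol Φ g T U) (h τ : ℝ) (k : ℕ) (x : ℝ) :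
    fluxErr h τ Φ g U (k + 1) x = fluxErr h τ Φ g U k x +
      τ * (Φ (avg h (fun y => U y (k * τ)) x) - Φ (auxScheme h τ Φ g U k x)) +
      ∫ s in (k * τ)..((k + 1) * τ), (Φ (U x s) - Φ (avg h (fun y => U y (k * τ)) x)) := by
  have h1 := intervalIntegral.integral_add_adjacent_intervals
    (intervalIntegrable_flux hC hU x 0 (k * τ))
    (intervalIntegrable_flux hC hU x (k * τ) ((k + 1) * τ))
  rw [intervalIntegral.integral_sub (intervalIntegrable_flux hC hU x _ _) (by simp),
    intervalIntegral.integral_const]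
  unfold fluxErr
  push_cast
  rw [← h1, Finset.sum_range_succ, smul_eq_mul]
  ring

/-- Bound of a time integral over one step. -/
lemma abs_integral_step_le {F : ℝ → ℝ} {τ c : ℝ} {k : ℕ} (hτ : 0 ≤ τ)
    (hF : ∀ s ∈ Icc (k * τ) ((k + 1) * τ), |F s| ≤ c) :
    |∫ s in (k * τ)..((k + 1) * τ), F s| ≤ τ * c := by
  have h0 : (k : ℝ) * τ ≤ (k + 1) * τ := by linarith
  have := intervalIntegral.norm_integral_le_of_norm_le_const (a := k * τ) (b := (k + 1) * τ)
    (f := F) (C := c) fun s hs => by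
      rw [uIoc_of_le h0] at hs
      exact hF s ⟨hs.1.le, hs.2⟩
  rw [Real.norm_eq_abs, abs_of_nonneg (by linarith : (0 : ℝ) ≤ (k + 1) * τ - k * τ)] at this
  linarith

lemma abs_fluxErr_le (hC : Coeffs Φ g L) (hU : Sol Φ g T U) {h τ η δ ρ : ℝ} (hh : 0 < h)
    (h1 : h ≤ 1) (hτ : 0 ≤ τ) (hη : 0 ≤ η) (hδ : 0 ≤ δ) (hcfl : 2 * L * τ ≤ h ^ 2)
    (hmod : Modulus U η T δ ρ) (hhρ : h ≤ ρ) (hτρ : τ ≤ ρ) {K : ℕ} (hK : K * τ ≤ T) :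
    ∀ k ≤ K, ∀ x, |fluxErr h τ Φ g U k x| ≤
      Real.exp (2 * L * T) * (2 * L * (η + τ) + L * δ * T) * Real.cosh x := by
  have hL := hC.pos
  let b : ℕ → ℝ := fun k => if k * τ < η then 2 * L else L * δ
  let e : ℕ → ℝ := fun k => Nat.rec 0 (fun k e => (1 + 2 * L * τ) * e + τ * b k) k
  have hb0 : ∀ k, 0 ≤ b k := fun k => by
    simp only [b]; split_ifs <;> positivity
  have he0 : ∀ k, 0 ≤ e k := by
    intro k
    induction k with
    | zero => exact le_rfl
    | succ k ih => exact add_nonneg (mul_nonneg (by positivity) ih) (mul_nonneg hτ (hb0 k))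
  have hTk : ∀ k ≤ K, k * τ ≤ T := fun k hk =>
    le_trans (by gcongr) hK
  have hmain : ∀ k ≤ K, ∀ x, |fluxErr h τ Φ g U k x| ≤ e k * Real.cosh x := by
    intro k
    induction k with
    | zero => intro _ x; simp [fluxErr, e]
    | succ k ih =>
      intro hk x
      have ih := ih (by omega)
      have hkT := hTk k (by omega)
      have hkT' := hTk (k + 1) hk
      push_cast at hkT'
      have hc := Real.one_le_cosh x
      rw [fluxErr_succ hC hU]
      obtain ⟨a, ha0, haL, ha⟩ := hC.exists_slope (avg h (fun y => U y (k * τ)) x)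
        (auxScheme h τ Φ g U k x)
      rw [ha, ← lap_fluxErr hC hU hh h1 hτ hkT]
      have hr : |∫ s in (k * τ)..((k + 1) * τ), (Φ (U x s) - Φ (avg h (fun y => U y (k * τ)) x))|
          ≤ τ * (b k * Real.cosh x) := by
        refine abs_integral_step_le hτ fun s hs => ?_
        simp only [b]
        split_ifs with hlt
        · have a1 := abs_sub (Φ (U x s)) (Φ (avg h (fun y => U y (k * τ)) x))
          have a2 := hC.bdd (U x s)
          have a3 := hC.bdd (avg h (fun y => U y (k * τ)) x)
          nlinarith
        · push Not at hlt
          refine (hC.lip _ _).trans ?_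
          rw [mul_assoc]
          refine mul_le_mul_of_nonneg_left ?_ hL.le
          rw [abs_sub_comm]
          have := hmod.avg_sub_le (x := x) (y := 0) (s := s) (s' := k * τ) hh.le
            (hU.bddMeas ⟨by positivity, hkT⟩)
            ⟨hlt.trans hs.1, hs.2.trans hkT'⟩ ⟨hlt, hkT⟩ (by
              rw [abs_le]; constructor <;> linarith [hs.1, hs.2]) (by simpa using hhρ)
          simpa using this
      set E := fluxErr h τ Φ g U k with hE
      have hstep : |E x + τ * (a * lap h E x)| ≤ (1 + 2 * L * τ) * e k * Real.cosh x := by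
        have hla : 2 * (τ / h ^ 2) * a ≤ 1 := by
          calc 2 * (τ / h ^ 2) * a ≤ 2 * (τ / h ^ 2) * L := by gcongr
            _ = (2 * L * τ) / h ^ 2 := by ring
            _ ≤ 1 := by rw [div_le_one (by positivity)]; exact hcfl
        have e1 : E x + τ * (a * lap h E x) = (1 - 2 * (τ / h ^ 2) * a) * E x +
            (τ / h ^ 2) * a * E (x + h) + (τ / h ^ 2) * a * E (x - h) := by
          rw [lap]; ring
        have hm0 : 0 ≤ (τ / h ^ 2) * a := by positivity
        have e2 : |E x + τ * (a * lap h E x)| ≤ (1 - 2 * (τ / h ^ 2) * a) * |E x| +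
            (τ / h ^ 2) * a * |E (x + h)| + (τ / h ^ 2) * a * |E (x - h)| := by
          rw [e1]
          refine (abs_add_three _ _ _).trans (le_of_eq ?_)
          rw [abs_mul, abs_mul _ (E (x + h)), abs_mul _ (E (x - h)), abs_of_nonneg hm0,
            abs_of_nonneg (by linarith : 0 ≤ 1 - 2 * (τ / h ^ 2) * a)]
        have hl := lap_cosh_le hh h1 x
        calc _ ≤ _ := e2
          _ ≤ (1 - 2 * (τ / h ^ 2) * a) * (e k * Real.cosh x) +
              (τ / h ^ 2) * a * (e k * Real.cosh (x + h)) +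
              (τ / h ^ 2) * a * (e k * Real.cosh (x - h)) := by
            have i1 := ih x
            have i2 := ih (x + h)
            have i3 := ih (x - h)
            have : 0 ≤ 1 - 2 * (τ / h ^ 2) * a := by linarith
            gcongr
          _ = e k * (Real.cosh x + τ * (a * lap h Real.cosh x)) := by rw [lap]; ring
          _ ≤ e k * (Real.cosh x + τ * (L * (2 * Real.cosh x))) := by
            have := he0 k
            have h3 : a * lap h Real.cosh x ≤ L * (2 * Real.cosh x) := by
              calc a * lap h Real.cosh x ≤ a * (2 * Real.cosh x) := by gcongr
                _ ≤ _ := by gcongr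
            gcongr
          _ = _ := by ring
      have : e (k + 1) = (1 + 2 * L * τ) * e k + τ * b k := rfl
      rw [this]
      refine (abs_add_le _ _).trans ?_
      linarith
  have hg := gronwall_layer (e := e) (b := b) (c := 2 * L) (τ := τ) (η := η) (B₁ := 2 * L)
    (B₂ := L * δ) (K := K) (by positivity) hτ hη (by positivity) (by positivity) le_rfl
    (fun k _ => le_rfl) (fun k _ hk => by simp only [b]; rw [if_pos hk])
    (fun k _ hk => by simp only [b]; rw [if_neg (not_lt.2 hk)])
  intro k hk x
  refine (hmain k hk x).trans ?_
  have hc := Real.one_le_cosh x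
  gcongr
  refine (hg k hk).trans ?_
  have h5 : e 0 = 0 := rfl
  rw [h5, zero_add]
  have h6 := hTk k hk
  have h7 : 0 ≤ (k : ℝ) * τ := by positivity
  gcongr

lemma wnorm_auxScheme_translate_le (hC : Coeffs Φ g L) (hU : Sol Φ g T U) {h τ η δ ρ : ℝ}
    (hh : 0 < h) (h1 : h ≤ 1 / 2) (hτ : 0 ≤ τ) (hη : 0 ≤ η) (hδ : 0 ≤ δ) (hT : 0 ≤ T)
    (hcfl : 2 * L * τ ≤ h ^ 2) (hmod : Modulus (fun x s => g x (U x s)) η T δ ρ)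
    {y : ℝ} (hyρ : |y| + h ≤ ρ) {K : ℕ} (hK : K * τ ≤ T) :
    ∀ k ≤ K, wnorm (fun x => auxScheme h τ Φ g U k (x + y) - auxScheme h τ Φ g U k x) ≤
      Real.exp (8 * L * T) * (wnorm (fun x => avg h (fun y => U y 0) (x + y) -
        avg h (fun y => U y 0) x) + 2 * L * coshMass * (η + τ) + 2 * δ * coshMass * T) := by
  have hL := hC.pos
  have hmass := coshMass_nonneg
  have hTk : ∀ k ≤ K, k * τ ≤ T := fun k hk => le_trans (by gcongr) hK
  set Y := auxScheme h τ Φ g U with hY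
  have hYb : ∀ k, BddMeas (Y k) := bddMeas_auxScheme hC hU hT hh.le τ
  let b : ℕ → ℝ := fun k => if k * τ < η then 2 * L * coshMass else 2 * δ * coshMass
  have hstep : ∀ k < K, wnorm (fun x => Y (k + 1) (x + y) - Y (k + 1) x) ≤
      (1 + 8 * L * τ) * wnorm (fun x => Y k (x + y) - Y k x) + τ * b k := by
    intro k hk
    have hkT := hTk k hk.le
    have hkT' := hTk (k + 1) hk
    push_cast at hkT'
    let S : ℝ → ℝ := fun x => ∫ s in (k * τ)..((k + 1) * τ), avg h (fun y => g y (U y s)) x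
    have hS : BddMeas S := bddMeas_integral_avg_reaction hC hU hh.le _ _
    have hd := (hC.bddMeas_comp (hYb k).1)
    have := wnorm_step_le (z := fun x => Y k (x + y) - Y k x)
      (d := fun x => Φ (Y k (x + y)) - Φ (Y k x)) (s := fun x => S (x + y) - S x)
      (z' := fun x => Y (k + 1) (x + y) - Y (k + 1) x) hh h1 hτ hcfl
      (((hYb k).translate y).sub (hYb k)) ((hd.translate y).sub hd) ((hS.translate y).sub hS)
      (fun x => hC.exists_slope _ _) (fun x => by
        simp only [hY, auxScheme, lap, S]
        rw [show x + y + h = x + h + y by ring, show x + y - h = x - h + y by ring]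
        ring)
    refine this.trans (add_le_add le_rfl ?_)
    have hbS : ∀ x, |S (x + y) - S x| ≤
        τ * (if k * τ < η then 2 * L else 2 * δ) * Real.cosh x := by
      intro x
      have hc := Real.one_le_cosh x
      have e : S (x + y) - S x = ∫ s in (k * τ)..((k + 1) * τ),
          (avg h (fun y => g y (U y s)) (x + y) - avg h (fun y => g y (U y s)) x) := by
        rw [intervalIntegral.integral_sub (intervalIntegrable_avg_reaction hC hU hh.le _ _ _)
          (intervalIntegrable_avg_reaction hC hU hh.le _ _ _)]
      rw [e, mul_assoc]
      refine abs_integral_step_le hτ fun s hs => ?_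
      have hgs := hC.bddMeas_reaction (measurable_slice hU.meas s)
      split_ifs with hlt
      · have a1 := abs_sub (avg h (fun y => g y (U y s)) (x + y)) (avg h (fun y => g y (U y s)) x)
        have a2 := abs_avg_le hh.le hgs (fun y => hC.gbdd _ _) (x + y)
        have a3 := abs_avg_le hh.le hgs (fun y => hC.gbdd _ _) x
        nlinarith
      · push Not at hlt
        have hsI : s ∈ Icc η T := ⟨hlt.trans hs.1, hs.2.trans hkT'⟩
        have hρ0 : 0 ≤ ρ := le_trans (by positivity) hyρ
        have c1 := hmod.avg_sub_le (x := x) (y := y) (s := s) (s' := s) hh.le hgs hsI hsI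
          (by simpa using hρ0) hyρ
        have c2 := hmod.avg_sub_le (x := x) (y := 0) (s := s) (s' := s) hh.le hgs hsI hsI
          (by simpa using hρ0) (by simpa using (le_add_of_nonneg_left (abs_nonneg y)).trans hyρ)
        rw [add_zero] at c2
        rw [abs_le] at *
        constructor <;> linarith [c1.1, c1.2, c2.1, c2.2]
    refine (wnorm_le_of_le_cosh hbS).trans (le_of_eq ?_)
    simp only [b]
    split_ifs <;> ring
  have hg := gronwall_layer (e := fun k => wnorm (fun x => Y k (x + y) - Y k x)) (b := b)
    (c := 8 * L) (τ := τ) (η := η) (B₁ := 2 * L * coshMass) (B₂ := 2 * δ * coshMass) (K := K)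
    (by positivity) hτ hη (by positivity) (by positivity) (wnorm_nonneg _) hstep
    (fun k _ hk => by simp only [b]; rw [if_pos hk])
    (fun k _ hk => by simp only [b]; rw [if_neg (not_lt.2 hk)])
  intro k hk
  refine (hg k hk).trans ?_
  have h6 := hTk k hk
  have h7 : 0 ≤ (k : ℝ) * τ := by positivity
  have h8 := wnorm_nonneg (fun x => Y 0 (x + y) - Y 0 x)
  have h9 : 0 ≤ 2 * L * coshMass * (η + τ) := by positivity
  have h10 : 0 ≤ 2 * δ * coshMass * T := by positivity
  have e0 : (fun x => Y 0 (x + y) - Y 0 x) = fun x => avg h (fun y => U y 0) (x + y) -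
        avg h (fun y => U y 0) x := rfl
  rw [e0]
  rw [e0] at h8
  gcongr

end convergence

lemma exists_small {a ε B : ℝ} (ha : 0 ≤ a) (hε : 0 < ε) (hB : 0 < B) :
    ∃ μ > 0, μ ≤ B ∧ a * μ ≤ ε := by
  refine ⟨min B (ε / (a + 1)), by positivity, min_le_left _ _, ?_⟩
  calc a * min B (ε / (a + 1)) ≤ a * (ε / (a + 1)) := by gcongr; exact min_le_right _ _
    _ ≤ (a + 1) * (ε / (a + 1)) := by gcongr; linarith
    _ = ε := by field_simp

section convergence

variable {Φ : ℝ → ℝ} {g : ℝ → ℝ → ℝ} {L T : ℝ} {U : ℝ → ℝ → ℝ}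

lemma Coeffs.continuousOn_reaction (hC : Coeffs Φ g L) (hU : Sol Φ g T U) :
    ContinuousOn (Function.uncurry fun x s => g x (U x s)) (univ ×ˢ Ioi 0) :=
  hC.gcont.comp_continuousOn (f := fun p : ℝ × ℝ => (p.1, U p.1 p.2))
    (continuousOn_fst.prodMk hU.cont)

lemma cfl_le {h τ : ℝ} (hL : 1 ≤ L) (hh : 0 < h) (h1 : h ≤ 1) (hτ : 0 ≤ τ)
    (hcfl : 2 * L * τ ≤ h ^ 2) : τ ≤ h := by
  have : h ^ 2 ≤ h := by nlinarith
  nlinarith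

lemma exists_auxScheme_close (hC : Coeffs Φ g L) (hU : Sol Φ g T U) (hT : 0 < T) {η ε : ℝ}
    (hη : 0 < η) (hε : 0 < ε) :
    ∃ ρ > 0, ∀ h τ : ℝ, ∀ K : ℕ, 0 < h → h ≤ ρ → 0 ≤ τ → 2 * L * τ ≤ h ^ 2 → K * τ ≤ T →
      ∀ k ≤ K, η ≤ k * τ →
        wnorm (fun x => auxScheme h τ Φ g U k x - U x (k * τ)) ≤ ε := by
  have hL := hC.pos
  have hc := coshMass_nonneg
  set c := coshMass
  obtain ⟨B, hB⟩ := hU.bdd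
  obtain ⟨μ, hμ, hμη, hμε⟩ := exists_small (a := Real.exp (8 * L * T) * (2 + 4 * L * c + 2 * c * T)
    + 2 * c) (ε := ε / 3) (B := η) (by positivity) (by positivity) hη
  have hU0 := hU.bddMeas (t := 0) ⟨le_rfl, hT.le⟩
  obtain ⟨r₀, hr₀, hinit⟩ := exists_wnorm_avg_sub_le hU0 hU.init hμ
  obtain ⟨r₁, hr₁, hmU⟩ := exists_modulus hU.cont hB hμ hμ
  obtain ⟨r₂, hr₂, hmG⟩ := exists_modulus (hC.continuousOn_reaction hU) (T := T)
    (fun x t _ => hC.gbdd x _) hμ hμ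
  set ρ₁ := min (min r₀ (min r₁ r₂) / 2) 1 with hρ₁
  have hρ₁0 : 0 < ρ₁ := by positivity
  have hρ₁1 : ρ₁ ≤ 1 := min_le_right _ _
  have hmin : 2 * ρ₁ ≤ min r₀ (min r₁ r₂) := by
    have := min_le_left (min r₀ (min r₁ r₂) / 2) 1
    linarith
  have hρr₀ : 2 * ρ₁ ≤ r₀ := hmin.trans (min_le_left _ _)
  have hρr₁ : 2 * ρ₁ ≤ r₁ := hmin.trans ((min_le_right _ _).trans (min_le_left _ _))
  have hρr₂ : 2 * ρ₁ ≤ r₂ := hmin.trans ((min_le_right _ _).trans (min_le_right _ _))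
  obtain ⟨ν, hν, hνη, hνε⟩ := exists_small
    (a := 32 * (Real.exp (2 * L * T) * (4 * L + L * T)) * c / ρ₁ ^ 2 + c)
    (ε := ε / 3) (B := μ) (by positivity) (by positivity) hμ
  obtain ⟨r₃, hr₃, hmU'⟩ := exists_modulus hU.cont hB hν hν
  refine ⟨min (min ρ₁ r₃) (min ν (1 / 2)), by positivity,
    fun h τ K hh hhρ hτ hcfl hK k hk hkη => ?_⟩
  have hhρ₁ : h ≤ ρ₁ := hhρ.trans ((min_le_left _ _).trans (min_le_left _ _))
  have hhr₃ : h ≤ r₃ := hhρ.trans ((min_le_left _ _).trans (min_le_right _ _))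
  have hhν : h ≤ ν := hhρ.trans ((min_le_right _ _).trans (min_le_left _ _))
  have hh2 : h ≤ 1 / 2 := hhρ.trans ((min_le_right _ _).trans (min_le_right _ _))
  have hτh := cfl_le hC.one_le hh (by linarith) hτ hcfl
  have hkT : k * τ ≤ T := le_trans (by gcongr) hK
  have hkI : (k : ℝ) * τ ∈ Icc 0 T := ⟨by positivity, hkT⟩
  have hUk := hU.bddMeas hkI
  have hAk := hUk.avg hh.le
  have hYk := bddMeas_auxScheme hC hU hT.le hh.le τ k
  set e := Real.exp (2 * L * T) * (2 * L * (ν + τ) + L * ν * T) with he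
  have he0 : 0 ≤ e := by positivity
  have heν : e ≤ Real.exp (2 * L * T) * (4 * L + L * T) * ν := by
    have : 2 * L * (ν + τ) + L * ν * T ≤ (4 * L + L * T) * ν := by nlinarith
    rw [he, mul_assoc (Real.exp (2 * L * T))]; gcongr
  have htrans : ∀ y, |y| ≤ ρ₁ → wnorm (fun x =>
      (avg h (fun y => U y (k * τ)) (x + y) - auxScheme h τ Φ g U k (x + y)) -
      (avg h (fun y => U y (k * τ)) x - auxScheme h τ Φ g U k x)) ≤ ε / 3 := by
    intro y hy
    have t1 := wnorm_auxScheme_translate_le hC hU hh hh2 hτ hμ.le hμ.le hT.le hcfl hmG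
      (y := y) (by linarith) hK k hk
    have t2 : wnorm (fun x => avg h (fun y => U y 0) (x + y) - avg h (fun y => U y 0) x)
        ≤ 2 * μ := by
      have s1 := hinit h y hh.le (by linarith) (by linarith)
      have s2 := hinit h 0 hh.le (by linarith) (by simpa using hr₀.le)
      simp only [add_zero] at s2
      rw [wnorm_sub_comm] at s2
      have := wnorm_sub_le ((hU0.avg hh.le).translate y) hU0 (hU0.avg hh.le)
      linarith
    have t3 : wnorm (fun x => avg h (fun y => U y (k * τ)) (x + y) -
        avg h (fun y => U y (k * τ)) x) ≤ 2 * μ * c := by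
      refine wnorm_le_of_le_cosh fun x => ?_
      have hkI' : (k : ℝ) * τ ∈ Icc μ T := ⟨hμη.trans hkη, hkT⟩
      have c1 := hmU.avg_sub_le (x := x) (y := y) hh.le hUk hkI' hkI' (by simpa using hr₁.le)
        (by linarith)
      have c2 := hmU.avg_sub_le (x := x) (y := 0) hh.le hUk hkI' hkI' (by simpa using hr₁.le)
        (by simp; linarith)
      rw [add_zero] at c2
      rw [abs_le] at *
      constructor <;> linarith [c1.1, c1.2, c2.1, c2.2]
    have t4 := wnorm_add_le ((hAk.translate y).sub hAk)
      (((hYk.translate y).sub hYk).const_mul (-1))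
    rw [wnorm_const_mul] at t4
    have e4 : (fun x => avg h (fun y => U y (k * τ)) (x + y) - avg h (fun y => U y (k * τ)) x +
        -1 * (auxScheme h τ Φ g U k (x + y) - auxScheme h τ Φ g U k x)) = fun x =>
      (avg h (fun y => U y (k * τ)) (x + y) - auxScheme h τ Φ g U k (x + y)) -
      (avg h (fun y => U y (k * τ)) x - auxScheme h τ Φ g U k x) := by funext x; ring
    rw [e4, abs_neg, abs_one, one_mul] at t4
    have t5 : Real.exp (8 * L * T) * (wnorm (fun x => avg h (fun y => U y 0) (x + y) -
        avg h (fun y => U y 0) x) + 2 * L * c * (μ + τ) + 2 * μ * c * T) ≤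
        Real.exp (8 * L * T) * ((2 + 4 * L * c + 2 * c * T) * μ) := by
      have : 2 * L * c * (μ + τ) ≤ 4 * L * c * μ := by
        have : τ ≤ μ := by linarith
        have := mul_le_mul_of_nonneg_left this (show 0 ≤ 2 * L * c by positivity)
        linarith
      gcongr
      linarith
    linarith
  have hz := wnorm_le_of_lap (E := fluxErr h τ Φ g U k)
    (z := fun x => avg h (fun y => U y (k * τ)) x - auxScheme h τ Φ g U k x) hh hhρ₁ hρ₁1 he0
    (hAk.sub hYk)
    (abs_fluxErr_le hC hU hh (by linarith) hτ hν.le hν.le hcfl hmU' hhr₃ (by linarith) hK k hk)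
    (fun x => (lap_fluxErr hC hU hh (by linarith) hτ hkT x).symm) htrans
  have h8 : 32 * e * coshMass / ρ₁ ^ 2 ≤
      32 * (Real.exp (2 * L * T) * (4 * L + L * T)) * c / ρ₁ ^ 2 * ν := by
    calc 32 * e * coshMass / ρ₁ ^ 2 ≤
        32 * (Real.exp (2 * L * T) * (4 * L + L * T) * ν) * c / ρ₁ ^ 2 := by gcongr
      _ = _ := by ring
  have h9 : wnorm (fun x => avg h (fun y => U y (k * τ)) x - U x (k * τ)) ≤ ν * c := by
    refine wnorm_le_of_le_cosh fun x => ?_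
    have hkI' : (k : ℝ) * τ ∈ Icc ν T := ⟨hνη.trans (hμη.trans hkη), hkT⟩
    have c2 := hmU'.avg_sub_le (x := x) (y := 0) hh.le hUk hkI' hkI' (by simpa using hr₃.le)
      (by simpa using hhr₃)
    rwa [add_zero] at c2
  have h10 := wnorm_sub_le hYk hAk hUk
  rw [wnorm_sub_comm] at hz
  linarith

/-- Convergence of the explicit scheme. -/
theorem exists_scheme_close (hC : Coeffs Φ g L) (hU : Sol Φ g T U) (hT : 0 < T) {ε : ℝ}
    (hε : 0 < ε) :
    ∃ ρ > 0, ∀ h τ : ℝ, ∀ K : ℕ, ∀ V₀ : ℝ → ℝ, 0 < h → h ≤ ρ → 0 ≤ τ → 2 * L * τ ≤ h ^ 2 →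
      K * τ = T → BddMeas V₀ → wnorm (fun x => V₀ x - U x 0) ≤ ρ →
        wnorm (fun x => scheme h τ Φ g V₀ K x - U x T) ≤ ε := by
  have hL := hC.pos
  have hc := coshMass_nonneg
  set c := coshMass
  obtain ⟨μ, hμ, hμT, hμε⟩ := exists_small
    (a := Real.exp (9 * L * T) * (2 + 4 * L * c + (L + c) * T)) (ε := ε / 2) (B := min T (ε / 2))
    (by positivity) (by positivity) (by positivity)
  have hμT' : μ ≤ T := hμT.trans (min_le_left _ _)
  have hμε' : μ ≤ ε / 2 := hμT.trans (min_le_right _ _)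
  have hU0 := hU.bddMeas (t := 0) ⟨le_rfl, hT.le⟩
  obtain ⟨r₀, hr₀, hinit⟩ := exists_wnorm_avg_sub_le hU0 hU.init hμ
  obtain ⟨r₁, hr₁, haux⟩ := exists_auxScheme_close hC hU hT hμ hμ
  obtain ⟨r₂, hr₂, hmG⟩ := exists_modulus (hC.continuousOn_reaction hU) (T := T)
    (fun x t _ => hC.gbdd x _) hμ hμ
  refine ⟨min (min r₀ r₁) (min (min r₂ μ) (1 / 2)), by positivity,
    fun h τ K V₀ hh hhρ hτ hcfl hK hV₀ hV₀U => ?_⟩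
  have hr0 : min (min r₀ r₁) (min (min r₂ μ) (1 / 2)) ≤ μ :=
    (min_le_right _ _).trans ((min_le_left _ _).trans (min_le_right _ _))
  have hhr₀ : h ≤ r₀ := hhρ.trans ((min_le_left _ _).trans (min_le_left _ _))
  have hhr₁ : h ≤ r₁ := hhρ.trans ((min_le_left _ _).trans (min_le_right _ _))
  have hhr₂ : h ≤ r₂ :=
    hhρ.trans ((min_le_right _ _).trans ((min_le_left _ _).trans (min_le_left _ _)))
  have hhμ : h ≤ μ := hhρ.trans hr0
  have hh2 : h ≤ 1 / 2 := hhρ.trans ((min_le_right _ _).trans (min_le_right _ _))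
  have hτh := cfl_le hC.one_le hh (by linarith) hτ hcfl
  have hTk : ∀ k ≤ K, k * τ ≤ T := fun k hk => le_trans (by gcongr) hK.le
  set Y := auxScheme h τ Φ g U with hY
  set V := scheme h τ Φ g V₀ with hV
  have hYb : ∀ k, BddMeas (Y k) := bddMeas_auxScheme hC hU hT.le hh.le τ
  have hVb : ∀ k, BddMeas (V k) := hC.bddMeas_scheme h τ hV₀
  let b : ℕ → ℝ := fun k => if k * τ < μ then 2 * L * c else (L + c) * μ
  have hstep : ∀ k < K, wnorm (fun x => V (k + 1) x - Y (k + 1) x) ≤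
      (1 + 9 * L * τ) * wnorm (fun x => V k x - Y k x) + τ * b k := by
    intro k hk
    have hkT := hTk k hk.le
    have hkT' := hTk (k + 1) hk
    push_cast at hkT'
    have hkI : (k : ℝ) * τ ∈ Icc 0 T := ⟨by positivity, hkT⟩
    have hUk := hU.bddMeas hkI
    let S : ℝ → ℝ := fun x => ∫ s in (k * τ)..((k + 1) * τ), avg h (fun y => g y (U y s)) x
    have hS : BddMeas S := bddMeas_integral_avg_reaction hC hU hh.le _ _
    have hgV := hC.bddMeas_reaction (hVb k).1
    have hgY := hC.bddMeas_reaction (hYb k).1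
    have hzb := (hVb k).sub (hYb k)
    have h0 := wnorm_step_le (z := fun x => V k x - Y k x)
      (d := fun x => Φ (V k x) - Φ (Y k x)) (s := fun x => τ * g x (V k x) - S x)
      (z' := fun x => V (k + 1) x - Y (k + 1) x) hh hh2 hτ hcfl hzb
      ((hC.bddMeas_comp (hVb k).1).sub (hC.bddMeas_comp (hYb k).1)) ((hgV.const_mul τ).sub hS)
      (fun x => hC.exists_slope _ _) (fun x => by
        simp only [hY, hV, scheme, auxScheme, lap, S]
        ring)
    have hs1 : wnorm (fun x => τ * g x (V k x) - S x) ≤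
        wnorm (fun x => τ * g x (V k x) - τ * g x (Y k x)) +
        wnorm (fun x => τ * g x (Y k x) - S x) :=
      wnorm_sub_le (hgV.const_mul τ) (hgY.const_mul τ) hS
    have hs2 : wnorm (fun x => τ * g x (V k x) - τ * g x (Y k x)) ≤
        τ * L * wnorm (fun x => V k x - Y k x) := by
      have := wnorm_const_mul (τ * L) (fun x => V k x - Y k x)
      rw [abs_of_nonneg (by positivity)] at this
      rw [← this]
      refine wnorm_mono (hzb.const_mul _) fun x => ?_
      rw [← mul_sub, abs_mul, abs_mul, abs_of_nonneg hτ,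
        abs_of_nonneg (by positivity : 0 ≤ τ * L), mul_assoc]
      exact mul_le_mul_of_nonneg_left (hC.glip _ _ _) hτ
    have hs3 : wnorm (fun x => τ * g x (Y k x) - S x) ≤ τ * b k := by
      have hint : ∀ x a, τ * a - S x = -∫ s in (k * τ)..((k + 1) * τ),
          (avg h (fun y => g y (U y s)) x - a) := fun x a => by
        rw [intervalIntegral.integral_sub (intervalIntegrable_avg_reaction hC hU hh.le _ _ _)
          (by simp), intervalIntegral.integral_const, smul_eq_mul]
        simp only [S]; ring
      simp only [b]
      split_ifs with hlt
      · rw [mul_comm (2 * L) c, mul_comm c, ← mul_assoc]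
        refine wnorm_le_of_le_cosh fun x => ?_
        rw [hint, abs_neg, mul_assoc]
        refine abs_integral_step_le hτ fun s hs => ?_
        have a1 := abs_sub (avg h (fun y => g y (U y s)) x) (g x (Y k x))
        have a2 := abs_avg_le hh.le (hC.bddMeas_reaction (measurable_slice hU.meas s))
          (fun y => hC.gbdd _ _) x
        have a3 := hC.gbdd x (Y k x)
        have := Real.one_le_cosh x
        nlinarith
      · push Not at hlt
        have hgU := hC.bddMeas_reaction hUk.1
        have p1 := wnorm_sub_le (hgY.const_mul τ) (hgU.const_mul τ) hS
        have p2 : wnorm (fun x => τ * g x (Y k x) - τ * g x (U x (k * τ))) ≤ τ * L * μ := by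
          have := wnorm_const_mul (τ * L) (fun x => Y k x - U x (k * τ))
          rw [abs_of_nonneg (by positivity)] at this
          have h5 := haux h τ K hh hhr₁ hτ hcfl hK.le k hk.le hlt
          refine le_trans ?_ (mul_le_mul_of_nonneg_left h5 (by positivity : 0 ≤ τ * L))
          rw [← this]
          refine wnorm_mono (((hYb k).sub hUk).const_mul _) fun x => ?_
          rw [← mul_sub, abs_mul, abs_mul, abs_of_nonneg hτ,
            abs_of_nonneg (by positivity : 0 ≤ τ * L), mul_assoc]
          exact mul_le_mul_of_nonneg_left (hC.glip _ _ _) hτ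
        have p3 : wnorm (fun x => τ * g x (U x (k * τ)) - S x) ≤ τ * μ * c := by
          refine wnorm_le_of_le_cosh fun x => ?_
          rw [hint, abs_neg, mul_assoc]
          refine abs_integral_step_le hτ fun s hs => ?_
          have := hmG.avg_sub_le (x := x) (y := 0) (s := k * τ) (s' := s) hh.le
            (hC.bddMeas_reaction (measurable_slice hU.meas s)) ⟨hlt, hkT⟩
            ⟨hlt.trans hs.1, hs.2.trans hkT'⟩ (by
              rw [abs_le]; constructor <;> linarith [hs.1, hs.2]) (by simpa using hhr₂)
          simpa using this
        linarith
    linarith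
  have hg := gronwall_layer (e := fun k => wnorm (fun x => V k x - Y k x)) (b := b)
    (c := 9 * L) (τ := τ) (η := μ) (B₁ := 2 * L * c) (B₂ := (L + c) * μ) (K := K)
    (by positivity) hτ hμ.le (by positivity) (by positivity) (wnorm_nonneg _) hstep
    (fun k _ hk => by simp only [b]; rw [if_pos hk])
    (fun k _ hk => by simp only [b]; rw [if_neg (not_lt.2 hk)]) K le_rfl
  rw [hK] at hg
  have hz0 : wnorm (fun x => V 0 x - Y 0 x) ≤ 2 * μ := by
    have s2 := hinit h 0 hh.le (by linarith) (by simpa using hr₀.le)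
    simp only [add_zero] at s2
    rw [wnorm_sub_comm] at s2
    have := wnorm_sub_le hV₀ hU0 (hU0.avg hh.le)
    have e0 : (fun x => V 0 x - Y 0 x) = fun x => V₀ x - avg h (fun y => U y 0) x := rfl
    rw [e0]
    linarith
  have hgf : wnorm (fun x => V K x - Y K x) ≤ ε / 2 := by
    refine hg.trans (le_trans ?_ hμε)
    rw [mul_assoc (Real.exp (9 * L * T))]
    have : 2 * L * c * (μ + τ) ≤ 4 * L * c * μ := by
      have : τ ≤ μ := by linarith
      have := mul_le_mul_of_nonneg_left this (show 0 ≤ 2 * L * c by positivity)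
      linarith
    gcongr
    linarith
  have hY' := haux h τ K hh hhr₁ hτ hcfl hK.le K le_rfl (by rw [hK]; exact hμT')
  rw [hK] at hY'
  have := wnorm_sub_le (hVb K) (hYb K) (hU.bddMeas (t := T) ⟨hT.le, le_rfl⟩)
  linarith

end convergence

lemma exists_subseq_ae_tendsto {q : ℕ → ℝ → ℝ} (hq : ∀ n, BddMeas (q n))
    (h : Tendsto (fun n => wnorm (q n)) atTop (nhds 0)) :
    ∃ ns : ℕ → ℕ, StrictMono ns ∧
      ∀ᵐ x, Tendsto (fun i => q (ns i) x) atTop (nhds 0) := by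
  have hm : ∀ n, AEStronglyMeasurable (fun x => |q n x| * wt x) volume :=
    fun n => (hq n).integrable.aestronglyMeasurable
  have h1 : Tendsto (fun n => eLpNorm ((fun x => |q n x| * wt x) - fun _ => (0 : ℝ)) 1 volume)
      atTop (nhds 0) := by
    have e : ∀ n, eLpNorm ((fun x => |q n x| * wt x) - fun _ => (0 : ℝ)) 1 volume =
        ENNReal.ofReal (wnorm (q n)) := by
      intro n
      rw [show ((fun x => |q n x| * wt x) - fun _ => (0 : ℝ)) = fun x => |q n x| * wt x by
        funext x; simp, eLpNorm_one_eq_lintegral_enorm, wnorm,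
        ofReal_integral_eq_lintegral_ofReal (hq n).integrable
          (Eventually.of_forall fun x => mul_nonneg (abs_nonneg _) (wt_nonneg x))]
      refine lintegral_congr fun x => ?_
      rw [Real.enorm_eq_ofReal (mul_nonneg (abs_nonneg _) (wt_nonneg x))]
    simp_rw [e]
    have := (ENNReal.continuous_ofReal.tendsto 0).comp h
    rw [ENNReal.ofReal_zero] at this
    exact this
  obtain ⟨ns, hns, hae⟩ := (tendstoInMeasure_of_tendsto_eLpNorm one_ne_zero hm
    aestronglyMeasurable_const h1).exists_seq_tendsto_ae
  refine ⟨ns, hns, hae.mono fun x hx => ?_⟩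
  have h2 := (hx.mul_const (wt x)⁻¹)
  have hw := (wt_pos x).ne'
  simp only [mul_assoc, mul_inv_cancel₀ hw, mul_one, zero_mul] at h2
  exact (tendsto_zero_iff_abs_tendsto_zero _).2 h2

lemma exists_point_tendsto {V W : ℕ → ℝ → ℝ} {a b : ℝ → ℝ} (ha : BddMeas a) (hb : BddMeas b)
    (hV : ∀ n, BddMeas (V n)) (hW : ∀ n, BddMeas (W n))
    (hVa : ∀ n, wnorm (fun x => V n x - a x) ≤ 1 / ((n : ℝ) + 1))
    (hWb : ∀ n, wnorm (fun x => W n x - b x) ≤ 1 / ((n : ℝ) + 1))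
    (r : ℝ) {O : Set ℝ} (hO : IsOpen O) (hne : O.Nonempty) :
    ∃ x ∈ O, ∃ ns : ℕ → ℕ, StrictMono ns ∧
      Tendsto (fun i => V (ns i) x) atTop (nhds (a x)) ∧
      Tendsto (fun i => V (ns i) (x + r)) atTop (nhds (a (x + r))) ∧
      Tendsto (fun i => W (ns i) x) atTop (nhds (b x)) ∧
      Tendsto (fun i => W (ns i) (x + r)) atTop (nhds (b (x + r))) := by
  have hlim : ∀ {V : ℕ → ℝ → ℝ} {a : ℝ → ℝ},
      (∀ n, wnorm (fun x => V n x - a x) ≤ 1 / ((n : ℝ) + 1)) →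
      Tendsto (fun n => wnorm (fun x => V n x - a x)) atTop (nhds 0) := fun h =>
    squeeze_zero (fun n => wnorm_nonneg _) h tendsto_one_div_add_atTop_nhds_zero_nat
  obtain ⟨n₁, hn₁, h1⟩ := exists_subseq_ae_tendsto (fun n => (hV n).sub ha) (hlim hVa)
  obtain ⟨n₂, hn₂, h2⟩ := exists_subseq_ae_tendsto (fun n => (hW (n₁ n)).sub hb)
    ((hlim hWb).comp hn₁.tendsto_atTop)
  have h1' : ∀ᵐ x : ℝ, Tendsto (fun i => V (n₁ i) (x + r) - a (x + r)) atTop (nhds 0) :=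
    (measurePreserving_add_right volume r).quasiMeasurePreserving.ae h1
  have h2' : ∀ᵐ x : ℝ, Tendsto (fun i => W (n₁ (n₂ i)) (x + r) - b (x + r)) atTop (nhds 0) :=
    (measurePreserving_add_right volume r).quasiMeasurePreserving.ae h2
  have hd := Measure.dense_of_ae (((h1.and h1').and (h2.and h2')))
  obtain ⟨x, ⟨⟨p1, p2⟩, p3, p4⟩, hxO⟩ := hd.exists_mem_open hO hne
  have conv : ∀ {s : ℕ → ℝ} {c : ℝ}, Tendsto (fun i => s i - c) atTop (nhds 0) →
      Tendsto s atTop (nhds c) := fun {s c} h => by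
    simpa using h.add_const c
  exact ⟨x, hxO, fun i => n₁ (n₂ i), hn₁.comp hn₂,
    (conv p1).comp hn₂.tendsto_atTop, (conv p2).comp hn₂.tendsto_atTop, conv p3, conv p4⟩

lemma exists_grid {r T ρ c : ℝ} (hr : 0 < r) (hT : 0 < T) (hρ : 0 < ρ) (hc : 0 < c) :
    ∃ (h τ : ℝ) (j K : ℕ), 0 < h ∧ h ≤ ρ ∧ 0 < τ ∧ τ ≤ c * h ^ 5 ∧ j * h = r ∧ K * τ = T := by
  have key : ∀ {a s : ℝ}, 0 < a → 0 < s → ∃ (x : ℝ) (n : ℕ), 0 < x ∧ x ≤ s ∧ n * x = a := by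
    intro a s ha hs
    obtain ⟨n, hn⟩ := exists_nat_gt (a / s)
    have hn0 : (0 : ℝ) < n := (div_pos ha hs).trans hn
    refine ⟨a / n, n, div_pos ha hn0, ?_, mul_div_cancel₀ a hn0.ne'⟩
    rw [div_le_iff₀ hn0]
    rw [div_lt_iff₀ hs] at hn
    linarith
  obtain ⟨h, j, hh, hhρ, hj⟩ := key hr hρ
  obtain ⟨τ, K, hτ, hτh, hK⟩ := key hT (mul_pos hc (pow_pos hh 5))
  exact ⟨h, τ, j, K, hh, hhρ, hτ, hτh, hj, hK⟩

section

variable {Φ : ℝ → ℝ} {g : ℝ → ℝ → ℝ} {L : ℝ}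

lemma Coeffs.exists_reaction_slope (hC : Coeffs Φ g L) (x p q : ℝ) :
    ∃ c, |c| ≤ L ∧ g x p - g x q = c * (p - q) := by
  rcases eq_or_ne p q with rfl | hne
  · exact ⟨0, by simpa using hC.pos.le, by simp⟩
  · have h0 : p - q ≠ 0 := sub_ne_zero.2 hne
    refine ⟨(g x p - g x q) / (p - q), ?_, (div_mul_cancel₀ _ h0).symm⟩
    rw [abs_div, div_le_iff₀ (abs_pos.2 h0)]
    exact hC.glip x p q

lemma exists_scheme_diff_succ (hC : Coeffs Φ g L) {h τ : ℝ} (hh : 0 < h) (h1 : h ≤ 1 / 2)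
    (hτ : 0 ≤ τ) (hcfl : 4 * L * τ ≤ h ^ 2) (V₀ W₀ : ℝ → ℝ) (k : ℕ) (x : ℝ) :
    ∃ α β γ : ℝ, 1 / 4 ≤ α ∧ 0 ≤ β ∧ β ≤ 1 / 4 ∧ 0 ≤ γ ∧ γ ≤ 1 / 4 ∧
      scheme h τ Φ g V₀ (k + 1) x - scheme h τ Φ g W₀ (k + 1) x =
        α * (scheme h τ Φ g V₀ k x - scheme h τ Φ g W₀ k x) +
        β * (scheme h τ Φ g V₀ k (x + h) - scheme h τ Φ g W₀ k (x + h)) +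
        γ * (scheme h τ Φ g V₀ k (x - h) - scheme h τ Φ g W₀ k (x - h)) := by
  simp only [scheme, lap]
  set V := scheme h τ Φ g V₀ k
  set W := scheme h τ Φ g W₀ k
  obtain ⟨a, ha0, haL, ha⟩ := hC.exists_slope (V x) (W x)
  obtain ⟨a₁, ha0₁, haL₁, ha₁⟩ := hC.exists_slope (V (x + h)) (W (x + h))
  obtain ⟨a₂, ha0₂, haL₂, ha₂⟩ := hC.exists_slope (V (x - h)) (W (x - h))
  obtain ⟨c, hc, hcg⟩ := hC.exists_reaction_slope x (V x) (W x)
  have hh2 : 0 < h ^ 2 := by positivity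
  set lam := τ / h ^ 2 with hlam
  have hl0 : 0 ≤ lam := by positivity
  have hlL : lam * L ≤ 1 / 4 := by
    rw [hlam, div_mul_eq_mul_div, div_le_iff₀ hh2]; linarith
  have hle : ∀ {s : ℝ}, 0 ≤ s → s ≤ L → lam * s ≤ 1 / 4 := fun h0 hs =>
    (mul_le_mul_of_nonneg_left hs hl0).trans hlL
  have hτc : -(1 / 16) ≤ τ * c := by
    have : h ^ 2 ≤ 1 / 4 := by nlinarith
    have h3 := (abs_le.1 hc).1
    nlinarith
  refine ⟨1 - 2 * (lam * a) + τ * c, lam * a₁, lam * a₂, ?_, by positivity, hle ha0₁ haL₁,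
    by positivity, hle ha0₂ haL₂, ?_⟩
  · have := hle ha0 haL
    linarith
  · have e : ∀ A B C G : ℝ, τ * ((A - 2 * B + C) / h ^ 2 + G) =
        lam * A - 2 * (lam * B) + lam * C + τ * G := by
      intro A B C G; rw [hlam]; ring
    rw [e, e]
    linear_combination lam * ha₁ - 2 * lam * ha + lam * ha₂ + τ * hcg

lemma scheme_mono (hC : Coeffs Φ g L) {h τ : ℝ} (hh : 0 < h) (h1 : h ≤ 1 / 2)
    (hτ : 0 ≤ τ) (hcfl : 4 * L * τ ≤ h ^ 2) {V₀ W₀ : ℝ → ℝ} (h0 : ∀ x, V₀ x ≤ W₀ x) (k : ℕ) :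
    ∀ x, scheme h τ Φ g V₀ k x ≤ scheme h τ Φ g W₀ k x := by
  induction k with
  | zero => exact h0
  | succ k ih =>
    intro x
    obtain ⟨α, β, γ, hα, hβ, -, hγ, -, e⟩ := exists_scheme_diff_succ hC hh h1 hτ hcfl V₀ W₀ k x
    have i0 := sub_nonpos.2 (ih x)
    have i1 := mul_nonpos_of_nonneg_of_nonpos hβ (sub_nonpos.2 (ih (x + h)))
    have i2 := mul_nonpos_of_nonneg_of_nonpos hγ (sub_nonpos.2 (ih (x - h)))
    have i3 := mul_nonpos_of_nonneg_of_nonpos (by linarith : (0 : ℝ) ≤ α) i0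
    linarith

/-- The sign pattern of being nonpositive to the left of nonnegative for the difference of two
discrete solutions is preserved. -/
lemma scheme_pattern (hC : Coeffs Φ g L) {h τ : ℝ} (hh : 0 < h) (h1 : h ≤ 1 / 2)
    (hτ : 0 ≤ τ) (hcfl : 4 * L * τ ≤ h ^ 2) {V₀ W₀ : ℝ → ℝ}
    (h0 : ∀ x y, x < y → V₀ x ≤ W₀ x ∨ W₀ y ≤ V₀ y) (k : ℕ) :
    ∀ x, ∀ j : ℕ, 0 < scheme h τ Φ g V₀ k x - scheme h τ Φ g W₀ k x →
      0 ≤ scheme h τ Φ g V₀ k (x + j * h) - scheme h τ Φ g W₀ k (x + j * h) := by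
  induction k with
  | zero =>
    intro x j hj
    simp only [scheme] at hj ⊢
    rcases Nat.eq_zero_or_pos j with rfl | hj0
    · simpa using hj.le
    · have : 0 < j * h := by positivity
      rcases h0 x (x + j * h) (by linarith) with h2 | h2 <;> linarith
  | succ k ih =>
    intro x j hx
    by_contra! hneg
    rcases Nat.eq_zero_or_pos j with rfl | hj0
    · simp only [Nat.cast_zero, zero_mul, add_zero] at hneg
      linarith
    obtain ⟨i, rfl⟩ : ∃ i, j = i + 1 := ⟨j - 1, by omega⟩
    obtain ⟨α, β, γ, hα, hβ, hβ', hγ, hγ', e⟩ :=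
      exists_scheme_diff_succ hC hh h1 hτ hcfl V₀ W₀ k x
    obtain ⟨α', β', γ', hα', hb, hb', hg, hg', e'⟩ :=
      exists_scheme_diff_succ hC hh h1 hτ hcfl V₀ W₀ k (x + ((i + 1 : ℕ) : ℝ) * h)
    rw [e] at hx
    rw [e'] at hneg
    set z : ℝ → ℝ := fun y => scheme h τ Φ g V₀ k y - scheme h τ Φ g W₀ k y with hz
    have hz' : ∀ y, scheme h τ Φ g V₀ k y - scheme h τ Φ g W₀ k y = z y := fun y => rfl
    simp only [hz'] at hx hneg ih
    have hbad : ¬ (0 ≤ z (x + i * h) ∧ 0 ≤ z (x + (i + 1 : ℕ) * h) ∧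
        0 ≤ z (x + (i + 2 : ℕ) * h)) := by
      rintro ⟨q0, q1, q2⟩
      rw [show x + ((i + 1 : ℕ) : ℝ) * h + h = x + (i + 2 : ℕ) * h by push_cast; ring,
        show x + ((i + 1 : ℕ) : ℝ) * h - h = x + i * h by push_cast; ring] at hneg
      have := mul_nonneg (by linarith : (0 : ℝ) ≤ α') q1
      have := mul_nonneg hb q2
      have := mul_nonneg hg q0
      linarith
    have c1 : z (x - h) ≤ 0 := by
      by_contra! hc
      have A := fun l => ih (x - h) l hc
      refine hbad ⟨?_, ?_, ?_⟩
      · convert A (i + 1) using 2; push_cast; ring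
      · convert A (i + 2) using 2; push_cast; ring
      · convert A (i + 3) using 2; push_cast; ring
    have c0 : z x ≤ 0 := by
      by_contra! hc
      exact hbad ⟨ih x _ hc, ih x _ hc, ih x _ hc⟩
    have c2 : 0 < z (x + h) := by
      by_contra! hc
      have := mul_nonpos_of_nonneg_of_nonpos hβ hc
      have := mul_nonpos_of_nonneg_of_nonpos hγ c1
      have := mul_nonpos_of_nonneg_of_nonpos (by linarith : (0 : ℝ) ≤ α) c0
      linarith
    rcases Nat.eq_zero_or_pos i with rfl | hi
    · have e1 : x + ((0 + 1 : ℕ) : ℝ) * h = x + h := by push_cast; ring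
      rw [e1, add_sub_cancel_right] at hneg
      have c3 : 0 ≤ z (x + h + h) := by
        simpa using ih (x + h) 1 c2
      have := mul_nonneg hb c3
      have := mul_nonpos_of_nonneg_of_nonpos hγ c1
      nlinarith
    · obtain ⟨l, rfl⟩ : ∃ l, i = l + 1 := ⟨i - 1, by omega⟩
      have A := fun l => ih (x + h) l c2
      refine hbad ⟨?_, ?_, ?_⟩
      · convert A l using 2; push_cast; ring
      · convert A (l + 1) using 2; push_cast; ring
      · convert A (l + 2) using 2; push_cast; ring

lemma exists_scheme_pair (hC : Coeffs Φ g L) {T : ℝ} (hT : 0 < T) {U W : ℝ → ℝ → ℝ}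
    (hU : Sol Φ g T U) (hW : Sol Φ g T W) {r : ℝ} (hr : 0 < r) {ε : ℝ} (hε : 0 < ε) :
    ∃ (h τ : ℝ) (j K : ℕ), 0 < h ∧ h ≤ 1 / 2 ∧ 0 ≤ τ ∧ 4 * L * τ ≤ h ^ 2 ∧ j * h = r ∧
      wnorm (fun x => scheme h τ Φ g (fun y => U y 0) K x - U x T) ≤ ε ∧
      wnorm (fun x => scheme h τ Φ g (fun y => W y 0) K x - W x T) ≤ ε := by
  obtain ⟨ρ₁, hρ₁, H₁⟩ := exists_scheme_close hC hU hT hε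
  obtain ⟨ρ₂, hρ₂, H₂⟩ := exists_scheme_close hC hW hT hε
  have hL := hC.pos
  obtain ⟨h, τ, j, K, hh, hhρ, hτ, hτh, hj, hK⟩ := exists_grid hr hT
    (lt_min (lt_min hρ₁ hρ₂) (by norm_num : (0 : ℝ) < 1 / 2)) (by positivity : 0 < 1 / (4 * L))
  have hh1 : h ≤ ρ₁ := hhρ.trans ((min_le_left _ _).trans (min_le_left _ _))
  have hh2 : h ≤ ρ₂ := hhρ.trans ((min_le_left _ _).trans (min_le_right _ _))
  have hh3 : h ≤ 1 / 2 := hhρ.trans (min_le_right _ _)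
  have hcfl : 4 * L * τ ≤ h ^ 2 := by
    have h5 : h ^ 5 ≤ h ^ 2 := pow_le_pow_of_le_one hh.le (by linarith) (by norm_num)
    rw [one_div, inv_mul_eq_div, le_div_iff₀ (by positivity)] at hτh
    linarith
  have hcfl' : 2 * L * τ ≤ h ^ 2 := by nlinarith [mul_nonneg hL.le hτ.le]
  have h00 : (0 : ℝ) ∈ Icc 0 T := ⟨le_rfl, hT.le⟩
  refine ⟨h, τ, j, K, hh, hh3, hτ.le, hcfl, hj,
    H₁ h τ K _ hh hh1 hτ.le hcfl' hK (hU.bddMeas h00) ?_,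
    H₂ h τ K _ hh hh2 hτ.le hcfl' hK (hW.bddMeas h00) ?_⟩
  · simpa [wnorm] using hρ₁.le
  · simpa [wnorm] using hρ₂.le

lemma Sol.continuous_slice {T : ℝ} {U : ℝ → ℝ → ℝ} (hU : Sol Φ g T U) {t : ℝ} (ht : 0 < t) :
    Continuous fun x => U x t :=
  hU.cont.comp_continuous (by fun_prop : Continuous fun x : ℝ => (x, t))
    fun x => ⟨mem_univ _, ht⟩

/-- At most one sign change persists: intersection comparison for two solutions. -/
theorem Sol.pattern (hC : Coeffs Φ g L) {T : ℝ} (hT : 0 < T) {U W : ℝ → ℝ → ℝ}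
    (hU : Sol Φ g T U) (hW : Sol Φ g T W)
    (h0 : ∀ x y, x < y → U x 0 ≤ W x 0 ∨ W y 0 ≤ U y 0) {x y : ℝ} (hxy : x < y) :
    U x T ≤ W x T ∨ W y T ≤ U y T := by
  by_contra! hcon
  have hr : 0 < y - x := sub_pos.2 hxy
  choose h τ j K hh h1 hτ hcfl hj hUs hWs using fun n : ℕ =>
    exists_scheme_pair hC hT hU hW hr (ε := 1 / ((n : ℝ) + 1)) (by positivity)
  have h00 : (0 : ℝ) ∈ Icc 0 T := ⟨le_rfl, hT.le⟩
  have hTT : T ∈ Icc 0 T := ⟨hT.le, le_rfl⟩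
  have cU := hU.continuous_slice hT
  have cW := hW.continuous_slice hT
  have hO : IsOpen {z | W z T < U z T ∧ U (z + (y - x)) T < W (z + (y - x)) T} :=
    (isOpen_lt cW cU).inter (isOpen_lt (cU.comp (by fun_prop)) (cW.comp (by fun_prop)))
  obtain ⟨z, ⟨hz1, hz2⟩, ns, -, t1, t2, t3, t4⟩ := exists_point_tendsto
    (hU.bddMeas hTT) (hW.bddMeas hTT)
    (fun n => hC.bddMeas_scheme (h n) (τ n) (hU.bddMeas h00) (K n))
    (fun n => hC.bddMeas_scheme (h n) (τ n) (hW.bddMeas h00) (K n))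
    hUs hWs (y - x) hO ⟨x, by simpa using hcon⟩
  have e1 := (t1.sub t3).eventually (lt_mem_nhds (sub_pos.2 hz1))
  have e2 := (t2.sub t4).eventually (gt_mem_nhds (sub_neg.2 hz2))
  obtain ⟨i, hi1, hi2⟩ := (e1.and e2).exists
  have := scheme_pattern hC (hh _) (h1 _) (hτ _) (hcfl _) h0 (K (ns i)) z (j (ns i)) hi1
  rw [hj] at this
  linarith

/-- Comparison principle. -/
theorem Sol.le (hC : Coeffs Φ g L) {T : ℝ} (hT : 0 < T) {U W : ℝ → ℝ → ℝ}
    (hU : Sol Φ g T U) (hW : Sol Φ g T W) (h0 : ∀ x, U x 0 ≤ W x 0) (x : ℝ) :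
    U x T ≤ W x T := by
  by_contra! hcon
  choose h τ j K hh h1 hτ hcfl hj hUs hWs using fun n : ℕ =>
    exists_scheme_pair hC hT hU hW one_pos (ε := 1 / ((n : ℝ) + 1)) (by positivity)
  have h00 : (0 : ℝ) ∈ Icc 0 T := ⟨le_rfl, hT.le⟩
  have hTT : T ∈ Icc 0 T := ⟨hT.le, le_rfl⟩
  have hO : IsOpen {z | W z T < U z T} :=
    isOpen_lt (hW.continuous_slice hT) (hU.continuous_slice hT)
  obtain ⟨z, hz1, ns, -, t1, -, t3, -⟩ := exists_point_tendsto
    (hU.bddMeas hTT) (hW.bddMeas hTT)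
    (fun n => hC.bddMeas_scheme (h n) (τ n) (hU.bddMeas h00) (K n))
    (fun n => hC.bddMeas_scheme (h n) (τ n) (hW.bddMeas h00) (K n))
    hUs hWs 0 hO ⟨x, hcon⟩
  obtain ⟨i, hi1⟩ := ((t1.sub t3).eventually (lt_mem_nhds (sub_pos.2 hz1))).exists
  have := scheme_mono hC (hh (ns i)) (h1 (ns i)) (hτ (ns i)) (hcfl (ns i)) h0 (K (ns i)) z
  linarith


end

lemma abs_sub_le_of_hasDerivAt {G G₁ : ℝ → ℝ} {l u c : ℝ}
    (h0 : ∀ v ∈ Icc l u, HasDerivAt G (G₁ v) v) (hc : ∀ v ∈ Icc l u, |G₁ v| ≤ c)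
    {v w : ℝ} (hv : v ∈ Icc l u) (hw : w ∈ Icc l u) : |G w - G v| ≤ c * |w - v| :=
  (convex_Icc l u).norm_image_sub_le_of_norm_hasDerivWithin_le
    (fun z hz => (h0 z hz).hasDerivWithinAt) hc hv hw

lemma taylor_one {G G₁ G₂ : ℝ → ℝ} {l u N : ℝ}
    (h0 : ∀ v ∈ Icc l u, HasDerivAt G (G₁ v) v) (h1 : ∀ v ∈ Icc l u, HasDerivAt G₁ (G₂ v) v)
    (hN : ∀ v ∈ Icc l u, |G₂ v| ≤ N) {v w : ℝ} (hv : v ∈ Icc l u) (hw : w ∈ Icc l u) :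
    |G w - G v - G₁ v * (w - v)| ≤ N * (w - v) ^ 2 := by
  have hsub : uIcc v w ⊆ Icc l u := uIcc_subset_Icc hv hw
  have hN0 : 0 ≤ N := (abs_nonneg _).trans (hN v hv)
  have := (convex_uIcc v w).norm_image_sub_le_of_norm_hasDerivWithin_le
    (f := fun z => G z - G₁ v * (z - v)) (f' := fun z => G₁ z - G₁ v) (C := N * |w - v|)
    (fun z hz => (((h0 z (hsub hz)).sub
      (((hasDerivAt_id z).sub_const v).const_mul (G₁ v))).congr_deriv (by simp)).hasDerivWithinAt)
    (fun z hz => (abs_sub_le_of_hasDerivAt h1 hN hv (hsub hz)).trans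
      (mul_le_mul_of_nonneg_left (abs_sub_left_of_mem_uIcc hz) hN0))
    left_mem_uIcc right_mem_uIcc
  rw [Real.norm_eq_abs, Real.norm_eq_abs, mul_assoc, ← sq, sq_abs] at this
  convert this using 2
  ring

lemma taylor_two {G G₁ G₂ G₃ : ℝ → ℝ} {l u N : ℝ}
    (h0 : ∀ v ∈ Icc l u, HasDerivAt G (G₁ v) v) (h1 : ∀ v ∈ Icc l u, HasDerivAt G₁ (G₂ v) v)
    (h2 : ∀ v ∈ Icc l u, HasDerivAt G₂ (G₃ v) v) (hN : ∀ v ∈ Icc l u, |G₃ v| ≤ N)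
    {v w : ℝ} (hv : v ∈ Icc l u) (hw : w ∈ Icc l u) :
    |G w - G v - G₁ v * (w - v) - G₂ v * (w - v) ^ 2 / 2| ≤ N * |w - v| ^ 3 := by
  have hsub : uIcc v w ⊆ Icc l u := uIcc_subset_Icc hv hw
  have hN0 : 0 ≤ N := (abs_nonneg _).trans (hN v hv)
  have := (convex_uIcc v w).norm_image_sub_le_of_norm_hasDerivWithin_le
    (f := fun z => G z - G₁ v * (z - v) - G₂ v * (z - v) ^ 2 / 2)
    (f' := fun z => G₁ z - G₁ v - G₂ v * (z - v)) (C := N * |w - v| ^ 2)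
    (fun z hz => (((h0 z (hsub hz)).sub
      (((hasDerivAt_id z).sub_const v).const_mul (G₁ v))).sub
      (((((hasDerivAt_id z).sub_const v).pow 2).const_mul (G₂ v)).div_const 2)
      |>.congr_deriv (by simp; ring)).hasDerivWithinAt)
    (fun z hz => (taylor_one h1 h2 hN hv (hsub hz)).trans
      (mul_le_mul_of_nonneg_left (sq_le_sq.2 (by
        rw [abs_abs]; exact abs_sub_left_of_mem_uIcc hz)) hN0))
    left_mem_uIcc right_mem_uIcc
  rw [Real.norm_eq_abs, Real.norm_eq_abs] at this
  convert this using 1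
  · congr 1; ring
  · ring

/-- The pressure of a density. -/
def prs (m u : ℝ) : ℝ := m / (m - 1) * u ^ (m - 1)

/-- The power `u ^ m` as a function of the pressure. -/
def psi (m v : ℝ) : ℝ := ((m - 1) / m * v) ^ (m / (m - 1))

section

variable {m : ℝ}

lemma prs_pos (hm : 1 < m) {u : ℝ} (hu : 0 < u) : 0 < prs m u :=
  mul_pos (div_pos (by linarith) (by linarith)) (Real.rpow_pos_of_pos hu _)

lemma prs_nonneg (hm : 1 < m) {u : ℝ} (hu : 0 ≤ u) : 0 ≤ prs m u :=
  mul_nonneg (div_nonneg (by linarith) (by linarith)) (Real.rpow_nonneg hu _)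

lemma prs_zero (hm : 1 < m) : prs m 0 = 0 := by
  rw [prs, Real.zero_rpow (by linarith), mul_zero]

lemma prs_le (hm : 1 < m) {u w : ℝ} (hu : 0 ≤ u) (h : u ≤ w) : prs m u ≤ prs m w :=
  mul_le_mul_of_nonneg_left (Real.rpow_le_rpow hu h (by linarith))
    (div_nonneg (by linarith) (by linarith))

lemma prs_lt (hm : 1 < m) {u w : ℝ} (hu : 0 ≤ u) (h : u < w) : prs m u < prs m w :=
  mul_lt_mul_of_pos_left (Real.rpow_lt_rpow hu h (by linarith))
    (div_pos (by linarith) (by linarith))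

lemma continuous_prs (hm : 1 < m) : Continuous (prs m) :=
  continuous_const.mul (Real.continuous_rpow_const (by linarith))

lemma prs_scale (hm : 1 < m) {u : ℝ} : (m - 1) / m * prs m u = u ^ (m - 1) := by
  have : m - 1 ≠ 0 := by linarith
  have : m ≠ 0 := by linarith
  rw [prs]; field_simp

lemma psi_prs (hm : 1 < m) {u : ℝ} (hu : 0 ≤ u) : psi m (prs m u) = u ^ m := by
  have : m - 1 ≠ 0 := by linarith
  rw [psi, prs_scale hm, ← Real.rpow_mul hu]
  congr 1; field_simp

lemma psi_le (hm : 1 < m) {v w : ℝ} (hv : 0 ≤ v) (h : v ≤ w) : psi m v ≤ psi m w := by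
  have : 0 ≤ (m - 1) / m := div_nonneg (by linarith) (by linarith)
  exact Real.rpow_le_rpow (by positivity) (mul_le_mul_of_nonneg_left h this)
    (div_nonneg (by linarith) (by linarith))

lemma hasDerivAt_scaled_rpow (hm : 1 < m) (s : ℝ) {v : ℝ} (hv : 0 < v) :
    HasDerivAt (fun v => ((m - 1) / m * v) ^ s)
      (((m - 1) / m * s) * ((m - 1) / m * v) ^ (s - 1)) v := by
  have : 0 < (m - 1) / m := div_pos (by linarith) (by linarith)
  have h := ((hasDerivAt_id v).const_mul ((m - 1) / m)).rpow_const (p := s)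
    (Or.inl (mul_pos this hv).ne')
  simp only [id, mul_one] at h
  convert h using 1

lemma hasDerivAt_psi (hm : 1 < m) {v : ℝ} (hv : 0 < v) :
    HasDerivAt (psi m) (((m - 1) / m * v) ^ (1 / (m - 1))) v := by
  have h1 : m - 1 ≠ 0 := by linarith
  have h2 : m ≠ 0 := by linarith
  refine (hasDerivAt_scaled_rpow hm (m / (m - 1)) hv).congr_deriv ?_
  rw [show (m - 1) / m * (m / (m - 1)) = 1 by field_simp, one_mul]
  congr 1; field_simp; ring

lemma hasDerivAt_prs (hm : 1 < m) {u : ℝ} (hu : 0 < u) :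
    HasDerivAt (prs m) (m * u ^ (m - 2)) u := by
  have h1 : m - 1 ≠ 0 := by linarith
  refine ((Real.hasDerivAt_rpow_const (p := m - 1) (Or.inl hu.ne')).const_mul
    (m / (m - 1))).congr_deriv ?_
  rw [show m - 1 - 1 = m - 2 by ring]; field_simp

lemma exists_bound_rpow (c s : ℝ) {l u : ℝ} (hl : 0 < l) :
    ∃ N, 0 ≤ N ∧ ∀ v ∈ Icc l u, |c * v ^ s| ≤ N := by
  obtain ⟨N, hN⟩ := isCompact_Icc.exists_bound_of_continuousOn (s := Icc l u)
    (f := fun v : ℝ => c * v ^ s)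
    (fun v hv => (continuousAt_const.mul (Real.continuousAt_rpow_const v s
      (Or.inl (hl.trans_le hv.1).ne'))).continuousWithinAt)
  exact ⟨max N 0, le_max_right _ _, fun v hv => (hN v hv).trans (le_max_left _ _)⟩

/-- Second order expansion of one explicit Euler step in the pressure variable. -/
lemma exists_pressure_step (hm : 1 < m) {a M : ℝ} (ha : 0 < a) (haM : a ≤ M) :
    ∃ N ε, 0 ≤ N ∧ 0 < ε ∧ ∀ P ∈ Icc a M, ∀ e₁ e₂ E lam G : ℝ, |e₁| ≤ E → |e₂| ≤ E → E ≤ ε →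
      0 ≤ lam → ∀ D, D = lam * (psi m (prs m P + e₁) + psi m (prs m P + e₂) - 2 * P ^ m) + G →
      |D| ≤ N * lam * (|e₁ + e₂| + E ^ 2 + E ^ 3) + |G| ∧ (|D| ≤ ε → P + D ∈ Ioi 0 ∧
      |prs m (P + D) - prs m P - lam * ((m - 1) * prs m P * (e₁ + e₂) + (e₁ ^ 2 + e₂ ^ 2) / 2)
        - m * P ^ (m - 2) * G| ≤ N * (lam * E ^ 3 + D ^ 2)) := by
  have hM : 0 < M := ha.trans_le haM
  have hpa := prs_pos hm ha
  have hpM := prs_pos hm hM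
  have hm1 : m - 1 ≠ 0 := by linarith
  have hm0 : m ≠ 0 := by linarith
  have hmp : 0 < (m - 1) / m := div_pos (by linarith) (by linarith)
  set μ := (m - 1) / m with hμ
  set s := 1 / (m - 1) with hs
  obtain ⟨N₃, hN₃, b₃⟩ := exists_bound_rpow (μ * s * (μ * (s - 1)))
    (s - 1 - 1) (l := μ * (prs m a / 2)) (u := μ * (2 * prs m M)) (by positivity)
  obtain ⟨N₁, hN₁, b₁⟩ := exists_bound_rpow 1 1 (l := a) (u := M) ha
  obtain ⟨N₂, hN₂, b₂⟩ := exists_bound_rpow (1 / m) (2 - m) (l := a) (u := M) ha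
  obtain ⟨N₄, hN₄, b₄⟩ := exists_bound_rpow m (m - 2) (l := a) (u := M) ha
  obtain ⟨N₅, hN₅, b₅⟩ := exists_bound_rpow (m * (m - 2)) (m - 2 - 1) (l := a / 2) (u := 2 * M)
    (by positivity)
  have b₃' : ∀ v ∈ Icc (prs m a / 2) (2 * prs m M),
      |μ * s * (μ * (s - 1) * (μ * v) ^ (s - 1 - 1))| ≤ N₃ := fun v hv => by
    rw [← mul_assoc]
    exact b₃ _ ⟨mul_le_mul_of_nonneg_left hv.1 hmp.le, mul_le_mul_of_nonneg_left hv.2 hmp.le⟩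
  have hpos : ∀ v ∈ Icc (prs m a / 2) (2 * prs m M), 0 < v := fun v hv => by
    linarith [hv.1]
  refine ⟨N₁ + N₂ + 2 * N₃ + 2 * N₄ * N₃ + N₅, min (prs m a / 2) (a / 2), by positivity,
    by positivity, ?_⟩
  intro P hP e₁ e₂ E lam G he₁ he₂ hE hlam D hD
  have hP0 : 0 < P := ha.trans_le hP.1
  have hpP1 := prs_le hm ha.le hP.1
  have hpP2 := prs_le hm hP0.le hP.2
  have hE0 : 0 ≤ E := (abs_nonneg _).trans he₁
  have hEa : E ≤ prs m a / 2 := hE.trans (min_le_left _ _)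
  have hpa2 := prs_le hm ha.le haM
  have mem0 : prs m P ∈ Icc (prs m a / 2) (2 * prs m M) := ⟨by linarith, by linarith⟩
  have mem : ∀ {e}, |e| ≤ E → prs m P + e ∈ Icc (prs m a / 2) (2 * prs m M) := fun {e} he => by
    have := abs_le.1 (he.trans hEa)
    exact ⟨by linarith, by linarith⟩
  have v1 : (μ * prs m P) ^ s = P := by
    rw [hμ, prs_scale hm, ← Real.rpow_mul hP0.le, hs, mul_one_div_cancel hm1, Real.rpow_one]
  have v2 : μ * s * (μ * prs m P) ^ (s - 1) = 1 / m * P ^ (2 - m) := by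
    rw [hμ, prs_scale hm, ← Real.rpow_mul hP0.le, hs]
    congr 1
    · field_simp
    · congr 1; field_simp; ring
  have T : ∀ {e}, |e| ≤ E →
      |psi m (prs m P + e) - P ^ m - P * e - 1 / m * P ^ (2 - m) * e ^ 2 / 2| ≤ N₃ * E ^ 3 := by
    intro e he
    have := taylor_two (G := psi m) (G₁ := fun v => (μ * v) ^ s)
      (G₂ := fun v => μ * s * (μ * v) ^ (s - 1))
      (G₃ := fun v => μ * s * (μ * (s - 1) * (μ * v) ^ (s - 1 - 1)))
      (fun v hv => hasDerivAt_psi hm (hpos v hv))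
      (fun v hv => hasDerivAt_scaled_rpow hm s (hpos v hv))
      (fun v hv => (hasDerivAt_scaled_rpow hm (s - 1) (hpos v hv)).const_mul _) b₃' mem0 (mem he)
    simp only [v1, v2, psi_prs hm hP0.le, add_sub_cancel_left] at this
    exact this.trans (mul_le_mul_of_nonneg_left (pow_le_pow_left₀ (abs_nonneg _) he 3) hN₃)
  have T1 := T he₁
  have T2 := T he₂
  have hPN : P ≤ N₁ := by
    have := b₁ P hP
    rw [one_mul, Real.rpow_one, abs_of_pos hP0] at this
    exact this
  have hPN2 := b₂ P hP
  have hPN4 := b₄ P hP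
  set β := 1 / m * P ^ (2 - m) with hβ
  set γ := m * P ^ (m - 2) with hγ
  have hβγ : γ * β = 1 := by
    have : P ^ (m - 2) * P ^ (2 - m) = 1 := by
      rw [← Real.rpow_add hP0]; simp
    rw [hβ, hγ]
    calc m * P ^ (m - 2) * (1 / m * P ^ (2 - m)) = (m * (1 / m)) * (P ^ (m - 2) * P ^ (2 - m)) := by
          ring
      _ = 1 := by rw [this, mul_one_div_cancel hm0, one_mul]
  have hγP : γ * P = (m - 1) * prs m P := by
    have : P ^ (m - 2) * P = P ^ (m - 1) := by
      nth_rewrite 2 [← Real.rpow_one P]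
      rw [← Real.rpow_add hP0]; ring_nf
    rw [hγ, mul_assoc, this, prs]; field_simp
  have se : e₁ ^ 2 + e₂ ^ 2 ≤ 2 * E ^ 2 := by
    have h1 := sq_le_sq' (abs_le.1 he₁).1 (abs_le.1 he₁).2
    have h2 := sq_le_sq' (abs_le.1 he₂).1 (abs_le.1 he₂).2
    linarith
  set R := psi m (prs m P + e₁) + psi m (prs m P + e₂) - 2 * P ^ m - P * (e₁ + e₂)
    - β * (e₁ ^ 2 + e₂ ^ 2) / 2 with hR
  have hRb : |R| ≤ 2 * N₃ * E ^ 3 := by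
    have : R = (psi m (prs m P + e₁) - P ^ m - P * e₁ - β * e₁ ^ 2 / 2) +
      (psi m (prs m P + e₂) - P ^ m - P * e₂ - β * e₂ ^ 2 / 2) := by rw [hR]; ring
    rw [this]
    refine (abs_add_le _ _).trans ?_
    linarith
  have hDR : D = lam * (P * (e₁ + e₂) + β * (e₁ ^ 2 + e₂ ^ 2) / 2 + R) + G := by
    rw [hD, hR]; ring
  constructor
  · rw [hDR]
    refine (abs_add_le _ _).trans (add_le_add ?_ le_rfl)
    rw [abs_mul, abs_of_nonneg hlam]
    suffices key : |P * (e₁ + e₂) + β * (e₁ ^ 2 + e₂ ^ 2) / 2 + R| ≤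
        (N₁ + N₂ + 2 * N₃ + 2 * N₄ * N₃ + N₅) * (|e₁ + e₂| + E ^ 2 + E ^ 3) from
      (mul_le_mul_of_nonneg_left key hlam).trans_eq (by ring)
    have i1 : |P * (e₁ + e₂)| ≤ N₁ * |e₁ + e₂| := by
      rw [abs_mul, abs_of_pos hP0]
      exact mul_le_mul_of_nonneg_right hPN (abs_nonneg _)
    have i2 : |β * (e₁ ^ 2 + e₂ ^ 2) / 2| ≤ N₂ * E ^ 2 := by
      rw [abs_div, abs_mul, abs_of_nonneg (by positivity : 0 ≤ e₁ ^ 2 + e₂ ^ 2), abs_two]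
      have : |β| * (e₁ ^ 2 + e₂ ^ 2) ≤ N₂ * (2 * E ^ 2) :=
        mul_le_mul hPN2 se (by positivity) hN₂
      linarith
    have i3 := abs_add_three (P * (e₁ + e₂)) (β * (e₁ ^ 2 + e₂ ^ 2) / 2) R
    have j1 : 0 ≤ |e₁ + e₂| := abs_nonneg _
    have j2 : 0 ≤ E ^ 2 := by positivity
    have j3 : 0 ≤ E ^ 3 := by positivity
    have k : N₁ * |e₁ + e₂| + N₂ * E ^ 2 + 2 * N₃ * E ^ 3 ≤
        (N₁ + N₂ + 2 * N₃ + 2 * N₄ * N₃ + N₅) * (|e₁ + e₂| + E ^ 2 + E ^ 3) := by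
      have q : 0 ≤ 2 * N₄ * N₃ := by positivity
      have : 0 ≤ (N₂ + 2 * N₃ + 2 * N₄ * N₃ + N₅) * |e₁ + e₂| := by positivity
      have : 0 ≤ (N₁ + 2 * N₃ + 2 * N₄ * N₃ + N₅) * E ^ 2 := by positivity
      have : 0 ≤ (N₁ + N₂ + 2 * N₄ * N₃ + N₅) * E ^ 3 := by positivity
      linarith
    linarith
  · intro hDε
    have hDa := abs_le.1 (hDε.trans (min_le_right _ _))
    have m0 : P ∈ Icc (a / 2) (2 * M) := ⟨by linarith [hP.1], by linarith [hP.2]⟩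
    have m1 : P + D ∈ Icc (a / 2) (2 * M) := ⟨by linarith [hP.1], by linarith [hP.2]⟩
    refine ⟨lt_of_lt_of_le (by positivity : 0 < a / 2) m1.1, ?_⟩
    have hpos' : ∀ v ∈ Icc (a / 2) (2 * M), 0 < v := fun v hv => by linarith [hv.1]
    have T3 := taylor_one (G := prs m) (G₁ := fun v => m * v ^ (m - 2))
      (G₂ := fun v => m * (m - 2) * v ^ (m - 2 - 1))
      (fun v hv => hasDerivAt_prs hm (hpos' v hv))
      (fun v hv => ((Real.hasDerivAt_rpow_const (p := m - 2)
        (Or.inl (hpos' v hv).ne')).const_mul m).congr_deriv (by ring)) b₅ m0 m1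
    simp only [add_sub_cancel_left] at T3
    have e : γ * D = lam * ((m - 1) * prs m P * (e₁ + e₂) + (e₁ ^ 2 + e₂ ^ 2) / 2) + γ * G +
        lam * (γ * R) := by
      rw [hDR]
      linear_combination lam * (e₁ + e₂) * hγP + lam * ((e₁ ^ 2 + e₂ ^ 2) / 2) * hβγ
    have hγR : |lam * (γ * R)| ≤ lam * (N₄ * (2 * N₃ * E ^ 3)) := by
      rw [abs_mul, abs_mul, abs_of_nonneg hlam]
      exact mul_le_mul_of_nonneg_left (mul_le_mul hPN4 hRb (abs_nonneg _) hN₄) hlam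
    have e2 : prs m (P + D) - prs m P -
        lam * ((m - 1) * prs m P * (e₁ + e₂) + (e₁ ^ 2 + e₂ ^ 2) / 2) - γ * G =
        (prs m (P + D) - prs m P - γ * D) + lam * (γ * R) := by rw [e]; ring
    rw [e2]
    refine (abs_add_le _ _).trans ((add_le_add T3 hγR).trans ?_)
    have : 0 ≤ lam * E ^ 3 := by positivity
    have : 0 ≤ (N₁ + N₂ + 2 * N₃ + N₅) * (lam * E ^ 3) := by positivity
    have : 0 ≤ (N₁ + N₂ + 2 * N₃ + 2 * N₄ * N₃) * D ^ 2 := by positivity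
    linarith


end

/-- A bounded concave modulus. -/
def conc (C s : ℝ) : ℝ := C * (1 - Real.exp (-s))

lemma conc_nonneg {C s : ℝ} (hC : 0 ≤ C) (hs : 0 ≤ s) : 0 ≤ conc C s :=
  mul_nonneg hC (by rw [sub_nonneg]; exact Real.exp_le_one_iff.2 (by linarith))

lemma conc_le {C s : ℝ} (hC : 0 ≤ C) : conc C s ≤ C := by
  have := Real.exp_pos (-s)
  unfold conc; nlinarith

lemma conc_le_mul {C s : ℝ} (hC : 0 ≤ C) : conc C s ≤ C * s := by
  have := Real.add_one_le_exp (-s)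
  exact mul_le_mul_of_nonneg_left (by linarith) hC

lemma conc_mono {C s t : ℝ} (hC : 0 ≤ C) (h : s ≤ t) : conc C s ≤ conc C t := by
  have := Real.exp_le_exp.2 (neg_le_neg h)
  exact mul_le_mul_of_nonneg_left (by linarith) hC

lemma mul_conc_le {C s θ : ℝ} (hC : 0 ≤ C) (h0 : 0 ≤ θ) (h1 : θ ≤ 1) :
    θ * conc C s ≤ conc C (θ * s) := by
  have := convexOn_exp.2 (mem_univ 0) (mem_univ (-s)) (by linarith : 0 ≤ 1 - θ) h0 (by ring)
  simp only [smul_eq_mul, mul_zero, zero_add, Real.exp_zero, mul_one] at this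
  rw [show θ * -s = -(θ * s) by ring] at this
  unfold conc
  nlinarith

lemma half_mul_le_conc {C s : ℝ} (hC : 0 ≤ C) (h0 : 0 ≤ s) (hs : 1 / 2 ≤ Real.exp (-s)) :
    C / 2 * s ≤ conc C s := by
  have h1 := Real.add_one_le_exp s
  have h2 : Real.exp (-s) * Real.exp s = 1 := by rw [← Real.exp_add]; simp
  have h3 : s / 2 ≤ 1 - Real.exp (-s) := by nlinarith [Real.exp_pos (-s)]
  unfold conc; nlinarith

set_option maxHeartbeats 2000000 in
/-- One explicit Euler step preserves the modulus of continuity of the pressure, up to the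
admissible decrease of its slope. -/
lemma exists_modulus_step {m : ℝ} (hm : 1 < m) {a M lip Λ Amax η C c₁ : ℝ} (ha : 0 < a)
    (haM : a ≤ M) (hLr : 0 ≤ lip) (hΛ : 0 ≤ Λ) (hAmax : 0 < Amax) (hη : 0 < η)
    (hC : C = 4 * prs m M) (hc₁ : c₁ = (m - 1) * C / 2) :
    ∃ ρ > 0, ∀ h τ A A' r P Q P' Q' gx gy n₁ n₂ n₃ n₄ : ℝ,
      0 < h → h ≤ ρ → 0 ≤ τ → τ ≤ h ^ 5 → 0 < A → A ≤ Amax →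
      lip * (1 + 2 / (C * A)) + 1 ≤ c₁ / 2 * A ^ 2 → A' ≤ A →
      A * (1 - τ * (c₁ / 2) * A ^ 2) ≤ A' → h ≤ r →
      P ∈ Icc a M → Q ∈ Icc a M → P' ∈ Icc a M → Q' ∈ Icc a M →
      n₁ ∈ Icc 0 (prs m M) → n₂ ∈ Icc 0 (prs m M) → n₃ ∈ Icc 0 (prs m M) →
      n₄ ∈ Icc 0 (prs m M) →
      n₁ ≤ prs m Q + η + conc C (A * (r + h)) → n₂ ≤ prs m Q + η + conc C (A * (r - h)) →
      prs m P ≤ n₃ + η + conc C (A * (r + h)) → prs m P ≤ n₄ + η + conc C (A * (r - h)) →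
      prs m P ≤ prs m Q + η + conc C (A * r) →
      P' = P + τ * ((psi m n₁ - 2 * P ^ m + psi m n₂) / h ^ 2 + gx) →
      Q' = Q + τ * ((psi m n₃ - 2 * Q ^ m + psi m n₄) / h ^ 2 + gy) →
      |gx| ≤ Λ → |gy| ≤ Λ →
      (Q ≤ P → m * P ^ (m - 2) * gx - m * Q ^ (m - 2) * gy ≤
        lip * (prs m P - prs m Q + r)) →
      prs m P' ≤ prs m Q' + η + conc C (A' * r) := by
  have hM : 0 < M := ha.trans_le haM
  have hpa := prs_pos hm ha
  have hpM := prs_pos hm hM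
  have hC0 : 0 < C := by rw [hC]; positivity
  have hm1 : 0 < m - 1 := by linarith only [hm]
  have hc0 : 0 < c₁ := by rw [hc₁]; positivity
  obtain ⟨N, ε, hN, hε, step⟩ := exists_pressure_step hm ha haM
  obtain ⟨B, hB, hBb⟩ := exists_bound_rpow m (m - 2) (l := a) (u := M) ha
  have hMm : 0 ≤ M ^ m := Real.rpow_nonneg hM.le _
  obtain ⟨C₄, hC₄⟩ : ∃ x, x = B * (4 * M ^ m + Λ) := ⟨_, rfl⟩
  have hC₄0 : 0 ≤ C₄ := by rw [hC₄]; positivity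
  obtain ⟨C₃, hC₃⟩ : ∃ x, x = 2 * C₄ + c₁ / 2 * Amax ^ 2 * C := ⟨_, rfl⟩
  have hC₃0 : 0 ≤ C₃ := by rw [hC₃]; positivity
  obtain ⟨K, hK⟩ : ∃ x, x = C₃ + 2 * (C * Amax) := ⟨_, rfl⟩
  have hK0 : 0 ≤ K := by rw [hK]; positivity
  obtain ⟨C₆, hC₆⟩ : ∃ x, x = N * (2 * C₃ + 2 * (C * Amax ^ 2) + K ^ 2 + K ^ 3) + Λ := ⟨_, rfl⟩
  have hC₆0 : 0 ≤ C₆ := by rw [hC₆]; positivity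
  obtain ⟨C₇, hC₇⟩ : ∃ x, x = c₁ * Amax ^ 2 * C₃ + 2 * N * (K ^ 3 + C₆ ^ 2) := ⟨_, rfl⟩
  have hC₇0 : 0 ≤ C₇ := by rw [hC₇]; positivity
  obtain ⟨S, hS⟩ : ∃ x, x = 1 + Amax + K + c₁ * Amax ^ 2 + C₆ + 4 * (m - 1) * prs m M + C₇ :=
    ⟨_, rfl⟩
  have hS0 : 0 < S := by rw [hS]; positivity
  obtain ⟨ε', hε'⟩ : ∃ x, x = min (min 1 ε) (min (prs m a / 2) η) := ⟨_, rfl⟩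
  have hε'0 : 0 < ε' := by rw [hε']; positivity
  have hε1 : ε' ≤ 1 := hε' ▸ (min_le_left _ _).trans (min_le_left _ _)
  have hε2 : ε' ≤ ε := hε' ▸ (min_le_left _ _).trans (min_le_right _ _)
  have hε3 : ε' ≤ prs m a / 2 := hε' ▸ (min_le_right _ _).trans (min_le_left _ _)
  have hε4 : ε' ≤ η := hε' ▸ (min_le_right _ _).trans (min_le_right _ _)
  refine ⟨ε' / S, by positivity, ?_⟩
  intro h τ A A' r P Q P' Q' gx gy n₁ n₂ n₃ n₄ hh hhρ hτ hτh hA hAm hAbig hA'A hA' hr hP hQ hP' hQ'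
    hn₁ hn₂ hn₃ hn₄ k₁ k₂ k₃ k₄ k₀ eP eQ hgx hgy hreac
  rw [le_div_iff₀ hS0] at hhρ
  have hsm : ∀ {x : ℝ}, x ≤ S → x * h ≤ ε' := fun {x} hx => by
    linarith only [mul_le_mul_of_nonneg_right hx hh.le, hhρ]
  have p1 : 0 ≤ 4 * (m - 1) * prs m M := by positivity
  have p2 : 0 ≤ c₁ * Amax ^ 2 := by positivity
  have hh1 : h ≤ 1 := by
    have := hsm (x := 1) (by rw [hS]; linarith only [hAmax, hK0, p2, hC₆0, p1, hC₇0])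
    linarith only [this, hε1]
  have sA : Amax * h ≤ 1 := (hsm (by rw [hS]; linarith only [hAmax, hK0, p2, hC₆0, p1, hC₇0])).trans hε1
  have sK : K * h ≤ ε' := hsm (by rw [hS]; linarith only [hAmax, hK0, p2, hC₆0, p1, hC₇0])
  have sc : c₁ * Amax ^ 2 * h ≤ 1 := (hsm (by rw [hS]; linarith only [hAmax, hK0, p2, hC₆0, p1, hC₇0])).trans hε1
  have s6 : C₆ * h ≤ ε' := hsm (by rw [hS]; linarith only [hAmax, hK0, p2, hC₆0, p1, hC₇0])
  have sm : 4 * (m - 1) * prs m M * h ≤ 1 := (hsm (by rw [hS]; linarith only [hAmax, hK0, p2, hC₆0, p1, hC₇0])).trans hε1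
  have s7 : C₇ * h ≤ η := (hsm (by rw [hS]; linarith only [hAmax, hK0, p2, hC₆0, p1, hC₇0])).trans hε4
  have hr0 : 0 < r := hh.trans_le hr
  obtain ⟨lam, hlam⟩ : ∃ x, x = τ / h ^ 2 := ⟨_, rfl⟩
  have hh2 : 0 < h ^ 2 := by positivity
  have hτl : τ = lam * h ^ 2 := by rw [hlam, div_mul_cancel₀ _ hh2.ne']
  have hlam0 : 0 ≤ lam := by rw [hlam]; positivity
  have hlam3 : lam ≤ h ^ 3 := by
    rw [hlam, div_le_iff₀ hh2]; calc τ ≤ h ^ 5 := hτh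
      _ = h ^ 3 * h ^ 2 := by ring
  have hpow : ∀ n : ℕ, n ≠ 0 → h ^ n ≤ h := fun n hn => pow_le_of_le_one hh.le hh1 hn
  have hτh' : τ ≤ h := hτh.trans (hpow 5 (by norm_num))
  have hlamh : lam ≤ h := hlam3.trans (hpow 3 (by norm_num))
  have hτlam : τ ≤ lam := by
    rw [hτl]; exact mul_le_of_le_one_right hlam0 (pow_le_one₀ hh.le hh1)
  have hA2 : A ^ 2 ≤ Amax ^ 2 := pow_le_pow_left₀ hA.le hAm 2
  have hA20 : 0 < A ^ 2 := by positivity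
  have hdec : τ * (c₁ / 2) * A ^ 2 ≤ 1 / 2 := by
    have i1 : τ * (c₁ / 2) * A ^ 2 ≤ h * (c₁ / 2) * Amax ^ 2 := by gcongr
    linarith only [i1, sc]
  have hdec0 : 0 ≤ τ * (c₁ / 2) * A ^ 2 := by positivity
  have hA'2 : A / 2 ≤ A' := by
    linarith only [hA', mul_le_mul_of_nonneg_left hdec hA.le]
  have hQ'0 : 0 ≤ prs m Q' := prs_nonneg hm (ha.le.trans hQ'.1)
  have hP'M : prs m P' ≤ prs m M := prs_le hm (ha.le.trans hP'.1) hP'.2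
  by_cases hbig : prs m M ≤ η + conc C (A' * r)
  · linarith only [hP'M, hbig, hQ'0]
  push Not at hbig
  have hconcA : conc C (A * r) - τ * (c₁ / 2) * A ^ 2 * conc C (A * r) ≤ conc C (A' * r) := by
    have i1 := mul_conc_le (C := C) (s := A * r) (θ := 1 - τ * (c₁ / 2) * A ^ 2) hC0.le
      (by linarith only [hdec]) (by linarith only [hdec0])
    have i2 : conc C ((1 - τ * (c₁ / 2) * A ^ 2) * (A * r)) ≤ conc C (A' * r) := by
      refine conc_mono hC0.le ?_
      calc (1 - τ * (c₁ / 2) * A ^ 2) * (A * r) = (A * (1 - τ * (c₁ / 2) * A ^ 2)) * r := by ring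
        _ ≤ A' * r := mul_le_mul_of_nonneg_right hA' hr0.le
    linarith only [i1, i2]
  have hQc0 : 0 ≤ conc C (A * r) := conc_nonneg hC0.le (by positivity)
  have hQcC : conc C (A * r) ≤ C := conc_le hC0.le
  have hP0 := ha.trans_le hP.1
  have hQ0 := ha.trans_le hQ.1
  have hpP0 := prs_pos hm hP0
  have hpQ0 := prs_pos hm hQ0
  have hpPM := prs_le hm hP0.le hP.2
  have hpQM := prs_le hm hQ0.le hQ.2
  set ω := η + conc C (A * r) with hω
  set p := prs m P with hp
  set q := prs m Q with hq
  obtain ⟨d, hd⟩ : ∃ x, x = q + ω - p := ⟨_, rfl⟩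
  have hd0 : 0 ≤ d := by linarith only [hd, k₀, hω]
  rcases le_or_gt (C₃ * lam) d with hdl | hdl
  · have lipP : ∀ {X Y n n' g : ℝ}, X ∈ Icc a M → Y ∈ Icc a M → n ∈ Icc 0 (prs m M) →
        n' ∈ Icc 0 (prs m M) → |g| ≤ Λ →
        Y = X + τ * ((psi m n - 2 * X ^ m + psi m n') / h ^ 2 + g) →
        |prs m Y - prs m X| ≤ C₄ * lam := by
      intro X Y n n' g hX hY hn hn' hg e
      have i1 := abs_sub_le_of_hasDerivAt (G := prs m) (G₁ := fun v => m * v ^ (m - 2))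
        (fun v hv => hasDerivAt_prs hm (ha.trans_le hv.1)) hBb hX hY
      have hb : ∀ {n : ℝ}, n ∈ Icc 0 (prs m M) → 0 ≤ psi m n ∧ psi m n ≤ M ^ m := fun {n} hn =>
        ⟨Real.rpow_nonneg (mul_nonneg (div_nonneg hm1.le (by linarith only [hm])) hn.1) _, by
          rw [← psi_prs hm hM.le]; exact psi_le hm hn.1 hn.2⟩
      have i2 := hb hn
      have i3 := hb hn'
      have hX0 := ha.le.trans hX.1
      have i4 : X ^ m ≤ M ^ m := Real.rpow_le_rpow hX0 hX.2 (by linarith only [hm])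
      have i5 : 0 ≤ X ^ m := Real.rpow_nonneg hX0 _
      have i6 : Y - X = lam * (psi m n - 2 * X ^ m + psi m n') + τ * g := by
        rw [e, hlam]; ring
      have i7 : |Y - X| ≤ lam * (4 * M ^ m + Λ) := by
        rw [i6]
        refine (abs_add_le _ _).trans ?_
        rw [abs_mul, abs_mul, abs_of_nonneg hlam0, abs_of_nonneg hτ]
        have j1 : |psi m n - 2 * X ^ m + psi m n'| ≤ 4 * M ^ m := by
          rw [abs_le]
          constructor <;> linarith only [i2.1, i2.2, i3.1, i3.2, i4, i5, hMm]
        have j2 := mul_le_mul_of_nonneg_left j1 hlam0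
        have j3 : τ * |g| ≤ lam * Λ := mul_le_mul hτlam hg (abs_nonneg _) hlam0
        linarith only [j2, j3]
      refine i1.trans ((mul_le_mul_of_nonneg_left i7 hB).trans_eq ?_)
      rw [hC₄]; ring
    have l1 := (abs_le.1 (lipP hP hP' hn₁ hn₂ hgx eP)).2
    have l2 := (abs_le.1 (lipP hQ hQ' hn₃ hn₄ hgy eQ)).1
    have l3 : τ * (c₁ / 2) * A ^ 2 * conc C (A * r) ≤ lam * (c₁ / 2) * Amax ^ 2 * C := by gcongr
    have l4 : C₃ * lam = 2 * (C₄ * lam) + lam * (c₁ / 2) * Amax ^ 2 * C := by rw [hC₃]; ring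
    linarith only [l1, l2, l3, l4, hconcA, hdl, hd, hω, hp, hq]
  -- the gap is small: expand to second order
  have hexp : 1 / 2 ≤ Real.exp (-(A * r)) := by
    have i1 : conc C (A' * r) < C / 4 := by linarith only [hbig, hC, hη]
    have i2 : 3 / 4 < Real.exp (-(A' * r)) := by
      unfold conc at i1; by_contra! hcon
      linarith only [i1, mul_le_mul_of_nonneg_left hcon hC0.le]
    have i3 : Real.exp (-(A' * r)) ^ 2 ≤ Real.exp (-(A * r)) := by
      rw [← Real.exp_nat_mul]
      refine Real.exp_le_exp.2 ?_
      push_cast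
      linarith only [mul_le_mul_of_nonneg_right hA'2 hr0.le]
    nlinarith only [i2, i3]
  set F := Real.exp (-(A * r)) with hF
  have hF1 : F ≤ 1 := Real.exp_le_one_iff.2 (neg_nonpos.2 (by positivity))
  have hAh : A * h ≤ 1 := (mul_le_mul_of_nonneg_right hAm hh.le).trans sA
  have hAh0 : 0 < A * h := by positivity
  obtain ⟨yp, hyp⟩ : ∃ x, x = C * F * (1 - Real.exp (-(A * h))) := ⟨_, rfl⟩
  obtain ⟨ym, hym⟩ : ∃ x, x = C * F * (Real.exp (A * h) - 1) := ⟨_, rfl⟩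
  have ep : conc C (A * (r + h)) = conc C (A * r) + yp := by
    rw [conc, conc, hyp, show -(A * (r + h)) = -(A * r) + -(A * h) by ring, Real.exp_add]; ring
  have em : conc C (A * (r - h)) = conc C (A * r) - ym := by
    rw [conc, conc, hym, show -(A * (r - h)) = -(A * r) + A * h by ring, Real.exp_add]; ring
  have hCF : C * F ≤ C := mul_le_of_le_one_right hC0.le hF1
  have hCF0 : C / 2 ≤ C * F := by
    linarith only [mul_le_mul_of_nonneg_left hexp hC0.le]
  have hCFp : 0 < C * F := by linarith only [hCF0, hC0]
  have hyp0 : 0 ≤ yp := by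
    rw [hyp]; exact mul_nonneg hCFp.le (sub_nonneg.2 (Real.exp_le_one_iff.2 (by linarith only [hAh0])))
  have hyp1 : yp ≤ 2 * (C * Amax) * h := by
    have : 1 - Real.exp (-(A * h)) ≤ Amax * h := by
      have := Real.add_one_le_exp (-(A * h))
      linarith only [this, mul_le_mul_of_nonneg_right hAm hh.le]
    rw [hyp]
    calc C * F * (1 - Real.exp (-(A * h))) ≤ C * (Amax * h) := by
          refine mul_le_mul hCF this ?_ hC0.le
          exact sub_nonneg.2 (Real.exp_le_one_iff.2 (by linarith only [hAh0]))
      _ ≤ _ := by have : 0 ≤ C * (Amax * h) := by positivity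
                  linarith only [this]
  have hym0 : 0 ≤ ym := by
    rw [hym]; exact mul_nonneg hCFp.le (sub_nonneg.2 (Real.one_le_exp hAh0.le))
  have hym1 : ym ≤ 2 * (C * Amax) * h := by
    have i1 : Real.exp (A * h) - 1 ≤ 2 * (Amax * h) := by
      have := (le_abs_self _).trans (Real.abs_exp_sub_one_le (x := A * h)
        (by rw [abs_of_pos hAh0]; exact hAh))
      rw [abs_of_pos hAh0] at this
      linarith only [this, mul_le_mul_of_nonneg_right hAm hh.le]
    rw [hym]
    calc C * F * (Real.exp (A * h) - 1) ≤ C * (2 * (Amax * h)) :=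
          mul_le_mul hCF i1 (sub_nonneg.2 (Real.one_le_exp hAh0.le)) hC0.le
      _ = _ := by ring
  have hY : ym - yp = C * F * (2 * (Real.cosh (A * h) - 1)) := by
    rw [hym, hyp, Real.cosh_eq]; ring
  have hYlo : C / 2 * A ^ 2 * h ^ 2 ≤ ym - yp := by
    have i1 := one_add_sq_div_two_le_cosh (A * h)
    rw [hY]
    calc C / 2 * A ^ 2 * h ^ 2 = C / 2 * (2 * ((A * h) ^ 2 / 2)) := by ring
      _ ≤ C * F * (2 * (Real.cosh (A * h) - 1)) := by
        refine mul_le_mul hCF0 (by linarith only [i1]) (by positivity) hCFp.le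
  have hYhi : ym - yp ≤ 2 * (C * Amax ^ 2) * h ^ 2 := by
    have i1 := cosh_sub_one_le (A * h) (by rw [abs_of_pos hAh0]; exact hAh)
    rw [hY]
    calc C * F * (2 * (Real.cosh (A * h) - 1)) ≤ C * (2 * (A * h) ^ 2) := by
          refine mul_le_mul hCF (by linarith only [i1]) ?_ hC0.le
          have := Real.one_le_cosh (A * h)
          linarith only [this]
      _ = 2 * (C * A ^ 2) * h ^ 2 := by ring
      _ ≤ _ := by gcongr
  have hd3 : d ≤ C₃ * h ^ 3 := hdl.le.trans (mul_le_mul_of_nonneg_left hlam3 hC₃0)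
  have hdh : d ≤ C₃ * h := hd3.trans (mul_le_mul_of_nonneg_left (hpow 3 (by norm_num)) hC₃0)
  have hE1 : |d + yp| ≤ K * h := by
    rw [abs_of_nonneg (by linarith only [hd0, hyp0]), hK]
    linarith only [hdh, hyp1]
  have hE2 : |d - ym| ≤ K * h := by
    have t1 : 0 ≤ C₃ * h := by positivity
    have t2 : 0 ≤ 2 * (C * Amax) * h := by positivity
    rw [abs_le, hK]
    constructor <;> linarith only [t1, t2, hd0, hdh, hym0, hym1]
  have hE1' : |-(d + yp)| ≤ K * h := by rwa [abs_neg]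
  have hE2' : |-(d - ym)| ≤ K * h := by rwa [abs_neg]
  have hsum : |d + yp + (d - ym)| ≤ (2 * C₃ + 2 * (C * Amax ^ 2)) * h ^ 2 := by
    have t1 : C₃ * h ^ 3 ≤ C₃ * h ^ 2 :=
      mul_le_mul_of_nonneg_left (pow_le_pow_of_le_one hh.le hh1 (by norm_num)) hC₃0
    have t2 : 0 ≤ C / 2 * A ^ 2 * h ^ 2 := by positivity
    have t3 : 0 ≤ C₃ * h ^ 2 := by positivity
    rw [abs_le]
    constructor <;> linarith only [t1, t2, t3, hd0, hd3, hYlo, hYhi]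
  have hEh2 : (K * h) ^ 2 = K ^ 2 * h ^ 2 := by ring
  have hEh3 : (K * h) ^ 3 ≤ K ^ 3 * h ^ 2 := by
    rw [mul_pow]
    exact mul_le_mul_of_nonneg_left (pow_le_pow_of_le_one hh.le hh1 (by norm_num)) (by positivity)
  have hDb : ∀ {e₁ e₂ G D : ℝ}, |e₁ + e₂| ≤ (2 * C₃ + 2 * (C * Amax ^ 2)) * h ^ 2 →
      |G| ≤ τ * Λ →
      |D| ≤ N * lam * (|e₁ + e₂| + (K * h) ^ 2 + (K * h) ^ 3) + |G| → |D| ≤ C₆ * τ := by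
    intro e₁ e₂ G D he hG hD
    have i1 : |e₁ + e₂| + (K * h) ^ 2 + (K * h) ^ 3 ≤
        (2 * C₃ + 2 * (C * Amax ^ 2) + K ^ 2 + K ^ 3) * h ^ 2 := by
      linarith only [he, hEh2, hEh3]
    have i2 := mul_le_mul_of_nonneg_left i1 (mul_nonneg hN hlam0)
    calc |D| ≤ _ := hD
      _ ≤ N * lam * ((2 * C₃ + 2 * (C * Amax ^ 2) + K ^ 2 + K ^ 3) * h ^ 2) + τ * Λ :=
        add_le_add i2 hG
      _ = C₆ * τ := by rw [hC₆, hτl]; ring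
  have hG : ∀ {g : ℝ}, |g| ≤ Λ → |τ * g| ≤ τ * Λ := fun {g} hg => by
    rw [abs_mul, abs_of_nonneg hτ]; exact mul_le_mul_of_nonneg_left hg hτ
  obtain ⟨b₁, r₁⟩ := step P hP (d + yp) (d - ym) (K * h) lam (τ * gx) hE1 hE2 (sK.trans hε2) hlam0
    _ rfl
  obtain ⟨b₂, r₂⟩ := step Q hQ (-(d + yp)) (-(d - ym)) (K * h) lam (τ * gy) hE1' hE2'
    (sK.trans hε2) hlam0 _ rfl
  set D₁ := lam * (psi m (prs m P + (d + yp)) + psi m (prs m P + (d - ym)) - 2 * P ^ m) + τ * gx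
    with hD₁
  set D₂ := lam * (psi m (prs m Q + -(d + yp)) + psi m (prs m Q + -(d - ym)) - 2 * Q ^ m) + τ * gy
    with hD₂
  have c₁' := hDb hsum (hG hgx) b₁
  have hsum' : |-(d + yp) + -(d - ym)| ≤ (2 * C₃ + 2 * (C * Amax ^ 2)) * h ^ 2 := by
    rw [show -(d + yp) + -(d - ym) = -(d + yp + (d - ym)) by ring, abs_neg]; exact hsum
  have c₂' := hDb hsum' (hG hgy) b₂
  have hC6τ : C₆ * τ ≤ ε := ((mul_le_mul_of_nonneg_left hτh' hC₆0).trans s6).trans hε2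
  obtain ⟨-, r₁⟩ := r₁ (c₁'.trans hC6τ)
  obtain ⟨hpos₂, r₂⟩ := r₂ (c₂'.trans hC6τ)
  have hPD : P' ≤ P + D₁ := by
    have i1 : psi m n₁ ≤ psi m (prs m P + (d + yp)) := psi_le hm hn₁.1 (by
      rw [ep] at k₁; linarith only [k₁, hd, hω, hp, hq])
    have i2 : psi m n₂ ≤ psi m (prs m P + (d - ym)) := psi_le hm hn₂.1 (by
      rw [em] at k₂; linarith only [k₂, hd, hω, hp, hq])
    have i3 : P' = P + (lam * (psi m n₁ + psi m n₂ - 2 * P ^ m) + τ * gx) := by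
      rw [eP, hlam]; ring
    rw [i3, hD₁]
    have := mul_le_mul_of_nonneg_left (add_le_add i1 i2) hlam0
    linarith only [this]
  have hQD : Q + D₂ ≤ Q' := by
    have hqa : prs m a ≤ q := prs_le hm ha.le hQ.1
    have z1 := abs_le.1 (hE1.trans (sK.trans hε3))
    have z2 := abs_le.1 (hE2.trans (sK.trans hε3))
    have i1 : psi m (prs m Q + -(d + yp)) ≤ psi m n₃ := psi_le hm
      (by linarith only [hqa, z1.2, hpa, hq]) (by
      rw [ep] at k₃; linarith only [k₃, hd, hω, hp, hq])
    have i2 : psi m (prs m Q + -(d - ym)) ≤ psi m n₄ := psi_le hm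
      (by linarith only [hqa, z2.2, hpa, hq]) (by
      rw [em] at k₄; linarith only [k₄, hd, hω, hp, hq])
    have i3 : Q' = Q + (lam * (psi m n₃ + psi m n₄ - 2 * Q ^ m) + τ * gy) := by
      rw [eQ, hlam]; ring
    rw [i3, hD₂]
    have := mul_le_mul_of_nonneg_left (add_le_add i1 i2) hlam0
    linarith only [this]
  have f1 : prs m P' ≤ prs m (P + D₁) := prs_le hm (ha.le.trans hP'.1) hPD
  have f2 : prs m (Q + D₂) ≤ prs m Q' := prs_le hm (le_of_lt hpos₂) hQD
  have g1 := (abs_le.1 r₁).2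
  have g2 := (abs_le.1 r₂).1
  have hD2 : ∀ {D : ℝ}, |D| ≤ C₆ * τ → D ^ 2 ≤ τ * (C₆ ^ 2 * h) := fun {D} hD => by
    have t1 := sq_le_sq' (abs_le.1 hD).1 (abs_le.1 hD).2
    have t2 : (C₆ * τ) ^ 2 ≤ τ * (C₆ ^ 2 * h) := by
      calc (C₆ * τ) ^ 2 = τ * (C₆ ^ 2 * τ) := by ring
        _ ≤ _ := by gcongr
    linarith only [t1, t2]
  have hErr : ∀ {D : ℝ}, |D| ≤ C₆ * τ →
      N * (lam * (K * h) ^ 3 + D ^ 2) ≤ τ * (N * (K ^ 3 + C₆ ^ 2) * h) := fun {D} hD => by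
    have i1 : lam * (K * h) ^ 3 = τ * (K ^ 3 * h) := by rw [hτl]; ring
    rw [i1]
    calc N * (τ * (K ^ 3 * h) + D ^ 2) ≤ N * (τ * (K ^ 3 * h) + τ * (C₆ ^ 2 * h)) := by
          gcongr; exact hD2 hD
      _ = _ := by ring
  have E₁ := hErr c₁'
  have E₂ := hErr c₂'
  have hre : τ * (m * P ^ (m - 2) * gx - m * Q ^ (m - 2) * gy) ≤ τ * (lip * (ω + r)) := by
    refine mul_le_mul_of_nonneg_left ?_ hτ
    have hQP : Q ≤ P := by
      by_contra! hcon
      have t1 := prs_lt hm hP0.le hcon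
      have t2 : C₃ * h ≤ K * h := by
        refine mul_le_mul_of_nonneg_right ?_ hh.le
        rw [hK]
        exact le_add_of_nonneg_right (by positivity)
      linarith only [t1, t2, hd, hω, hdh, sK, hε4, hQc0, hp, hq]
    refine (hreac hQP).trans (mul_le_mul_of_nonneg_left ?_ hLr)
    linarith only [k₀, hω, hp, hq]
  have hpq : 2 * (lam * (m - 1) * (p + q)) * d ≤ d := by
    have i1 : 2 * (lam * (m - 1) * (p + q)) ≤ 1 := by
      calc 2 * (lam * (m - 1) * (p + q)) ≤ 2 * (h * (m - 1) * (prs m M + prs m M)) := by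
            gcongr
        _ = 4 * (m - 1) * prs m M * h := by ring
        _ ≤ 1 := sm
    exact mul_le_of_le_one_left hd0 i1
  have hmain : τ * (c₁ * A ^ 2 * (ω - d)) ≤ lam * (m - 1) * (p + q) * (ym - yp) := by
    have i1 : ω - d ≤ p + q := by linarith only [hd, hpQ0, hq]
    calc τ * (c₁ * A ^ 2 * (ω - d)) = (lam * (m - 1) * (C / 2 * A ^ 2 * h ^ 2)) * (ω - d) := by
          rw [hτl, hc₁]; ring
      _ ≤ (lam * (m - 1) * (C / 2 * A ^ 2 * h ^ 2)) * (p + q) :=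
        mul_le_mul_of_nonneg_left i1 (by positivity)
      _ = (lam * (m - 1) * (p + q)) * (C / 2 * A ^ 2 * h ^ 2) := by ring
      _ ≤ _ := mul_le_mul_of_nonneg_left hYlo (by positivity)
  have hdA : τ * (c₁ * A ^ 2 * d) ≤ τ * (c₁ * Amax ^ 2 * C₃ * h) := by
    refine mul_le_mul_of_nonneg_left ?_ hτ
    calc c₁ * A ^ 2 * d ≤ c₁ * Amax ^ 2 * (C₃ * h) := by gcongr
      _ = _ := by ring
  have hrbound : r ≤ 2 / (C * A) * conc C (A * r) := by
    have := half_mul_le_conc hC0.le (by positivity : 0 ≤ A * r) hexp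
    rw [div_mul_eq_mul_div, le_div_iff₀ (by positivity)]
    linarith only [this]
  have hfin : lip * (ω + r) + C₇ * h ≤ c₁ / 2 * A ^ 2 * ω := by
    have i0 : 0 < 2 / (C * A) := by positivity
    have i1 : r ≤ 2 / (C * A) * ω := hrbound.trans
      (mul_le_mul_of_nonneg_left (by linarith only [hω, hη]) i0.le)
    have i2 : lip * (ω + r) ≤ lip * (1 + 2 / (C * A)) * ω := by
      rw [mul_assoc]
      exact mul_le_mul_of_nonneg_left (by linarith only [i1]) hLr
    have i3 := mul_le_mul_of_nonneg_right hAbig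
      (by linarith only [hω, hη, hQc0] : 0 ≤ ω)
    linarith only [i2, i3, s7, hω, hη, hQc0]
  have hfin' := mul_le_mul_of_nonneg_left hfin hτ
  have e7 : τ * (C₇ * h) = τ * (c₁ * Amax ^ 2 * C₃ * h) + 2 * (τ * (N * (K ^ 3 + C₆ ^ 2) * h)) := by
    rw [hC₇]; ring
  have e8 : τ * (c₁ / 2 * A ^ 2 * ω) = τ * (c₁ / 2) * A ^ 2 * conc C (A * r) +
      τ * (c₁ / 2 * A ^ 2) * η := by rw [hω]; ring
  have e9 : 0 ≤ τ * (c₁ / 2 * A ^ 2) * η := by positivity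
  have e10 : τ * (c₁ * A ^ 2 * (ω - d)) = 2 * (τ * (c₁ / 2 * A ^ 2 * ω)) - τ * (c₁ * A ^ 2 * d) := by
    ring
  have e11 : lam * ((m - 1) * p * (d + yp + (d - ym)) + ((d + yp) ^ 2 + (d - ym) ^ 2) / 2) -
      lam * ((m - 1) * q * (-(d + yp) + -(d - ym)) + ((-(d + yp)) ^ 2 + (-(d - ym)) ^ 2) / 2) =
      2 * (lam * (m - 1) * (p + q)) * d - lam * (m - 1) * (p + q) * (ym - yp) := by ring
  have e12 : m * P ^ (m - 2) * (τ * gx) - m * Q ^ (m - 2) * (τ * gy) =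
      τ * (m * P ^ (m - 2) * gx - m * Q ^ (m - 2) * gy) := by ring
  linarith only [f1, f2, g1, g2, E₁, E₂, hre, hpq, hmain, hdA, hfin', hconcA, hd, hω, hp, hq, e7,
    e8, e9, e10, e11, e12]

/-- Coefficients of porous-medium type on the range `[0, M]`. -/
structure PowCoeffs (m M : ℝ) (Φ : ℝ → ℝ) (g : ℝ → ℝ → ℝ) (L : ℝ) : Prop
    extends Coeffs Φ g L where
  pow : ∀ u ∈ Icc 0 M, Φ u = u ^ m
  zero : ∀ x, g x 0 = 0
  top : ∀ x, g x M ≤ 0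
  xlip : ∀ x y, ∀ u ∈ Icc 0 M, |g x u - g y u| ≤ L * u * |x - y|

lemma rpow_sub_two_mul_sub_le {m : ℝ} (hm : 1 < m) {P Q : ℝ} (hQ : 0 < Q) (hQP : Q ≤ P) :
    P ^ (m - 2) * (P - Q) ≤ prs m P - prs m Q := by
  have hP := hQ.trans_le hQP
  have hm1 : 0 < m - 1 := by linarith
  have eP : P ^ (m - 2) * P = P ^ (m - 1) := by
    rw [← Real.rpow_add_one hP.ne']; congr 1; ring
  have hPm := Real.rpow_pos_of_pos hP (m - 1)
  obtain ⟨t, ht⟩ : ∃ x, x = Q / P := ⟨_, rfl⟩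
  have ht0 : 0 < t := by rw [ht]; positivity
  have ht1 : t ≤ 1 := by rw [ht, div_le_one hP]; exact hQP
  have hQt : Q = t * P := by rw [ht]; field_simp
  have key : 1 - t ≤ m / (m - 1) * (1 - t ^ (m - 1)) := by
    rcases le_or_gt 2 m with h2 | h2
    · have h3 : t ^ (m - 1) ≤ t := by
        conv_rhs => rw [← Real.rpow_one t]
        exact Real.rpow_le_rpow_of_exponent_ge ht0 ht1 (by linarith)
      have h4 : 1 ≤ m / (m - 1) := by rw [le_div_iff₀ hm1]; linarith
      nlinarith
    · have h3 := rpow_one_add_le_one_add_mul_self (s := t - 1) (p := m - 1) (by linarith)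
        hm1.le (by linarith)
      rw [show 1 + (t - 1) = t by ring] at h3
      rw [div_mul_eq_mul_div, le_div_iff₀ hm1]
      nlinarith [Real.rpow_le_one ht0.le ht1 hm1.le]
  have e1 : prs m P - prs m Q = P ^ (m - 1) * (m / (m - 1) * (1 - t ^ (m - 1))) := by
    rw [prs, prs, hQt, Real.mul_rpow ht0.le hP.le]; ring
  have e2 : P ^ (m - 2) * (P - Q) = P ^ (m - 1) * (1 - t) := by
    rw [hQt, ← eP]; ring
  rw [e1, e2]
  exact mul_le_mul_of_nonneg_left key hPm.le

section

variable {m M : ℝ} {Φ : ℝ → ℝ} {g : ℝ → ℝ → ℝ} {L : ℝ}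

lemma PowCoeffs.abs_le (hC : PowCoeffs m M Φ g L) (x : ℝ) {u : ℝ} (hu : 0 ≤ u) :
    |g x u| ≤ L * u := by
  have := hC.glip x u 0
  rwa [hC.zero, sub_zero, sub_zero, abs_of_nonneg hu] at this

lemma PowCoeffs.reaction_le (hm : 1 < m) (hC : PowCoeffs m M Φ g L) {x y P Q : ℝ} (hQ : 0 < Q)
    (hQP : Q ≤ P) (hP : P ≤ M) :
    m * P ^ (m - 2) * g x P - m * Q ^ (m - 2) * g y Q ≤
      (3 * m * L + (m - 1) * prs m M * L) * (prs m P - prs m Q + |x - y|) := by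
  have hP0 := hQ.trans_le hQP
  have hL := hC.pos
  have hm0 : 0 < m := by linarith
  have hm1 : 0 < m - 1 := by linarith
  have h1 := rpow_sub_two_mul_sub_le hm hQ hQP
  have hd : 0 ≤ prs m P - prs m Q := sub_nonneg.2 (prs_le hm hQ.le hQP)
  have eP : P ^ (m - 2) * P = P ^ (m - 1) := by
    rw [← Real.rpow_add_one hP0.ne']; congr 1; ring
  have eQ : Q ^ (m - 2) * Q = Q ^ (m - 1) := by
    rw [← Real.rpow_add_one hQ.ne']; congr 1; ring
  have hP2 := Real.rpow_pos_of_pos hP0 (m - 2)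
  have hQ2 := Real.rpow_pos_of_pos hQ (m - 2)
  have hX : P ^ (m - 1) - Q ^ (m - 1) = (m - 1) / m * (prs m P - prs m Q) := by
    rw [mul_sub, prs_scale hm, prs_scale hm]
  have hX1 : (m - 1) / m * (prs m P - prs m Q) ≤ prs m P - prs m Q :=
    mul_le_of_le_one_left hd (by rw [div_le_one hm0]; linarith)
  have hX0 : 0 ≤ (m - 1) / m * (prs m P - prs m Q) := by positivity
  have t1 : P ^ (m - 2) * (g x P - g x Q) ≤ L * (prs m P - prs m Q) := by
    have i1 := (le_abs_self _).trans (hC.glip x P Q)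
    rw [abs_of_nonneg (sub_nonneg.2 hQP)] at i1
    calc P ^ (m - 2) * (g x P - g x Q) ≤ P ^ (m - 2) * (L * (P - Q)) :=
          mul_le_mul_of_nonneg_left i1 hP2.le
      _ = L * (P ^ (m - 2) * (P - Q)) := by ring
      _ ≤ _ := mul_le_mul_of_nonneg_left h1 hL.le
  have t2 : (P ^ (m - 2) - Q ^ (m - 2)) * g x Q ≤ 2 * L * (prs m P - prs m Q) := by
    have i1 := hC.abs_le x hQ.le
    have i2 : |P ^ (m - 2) - Q ^ (m - 2)| * Q ≤ 2 * (prs m P - prs m Q) := by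
      rw [← abs_of_pos hQ, ← abs_mul, abs_of_pos hQ]
      have e : (P ^ (m - 2) - Q ^ (m - 2)) * Q =
          (P ^ (m - 1) - Q ^ (m - 1)) - P ^ (m - 2) * (P - Q) := by
        rw [← eP, ← eQ]; ring
      have i3 : 0 ≤ P ^ (m - 2) * (P - Q) := mul_nonneg hP2.le (sub_nonneg.2 hQP)
      rw [e, hX, _root_.abs_le]
      constructor <;> linarith
    calc (P ^ (m - 2) - Q ^ (m - 2)) * g x Q ≤ |P ^ (m - 2) - Q ^ (m - 2)| * |g x Q| := by
          rw [← abs_mul]; exact le_abs_self _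
      _ ≤ |P ^ (m - 2) - Q ^ (m - 2)| * (L * Q) := mul_le_mul_of_nonneg_left i1 (abs_nonneg _)
      _ = L * (|P ^ (m - 2) - Q ^ (m - 2)| * Q) := by ring
      _ ≤ L * (2 * (prs m P - prs m Q)) := mul_le_mul_of_nonneg_left i2 hL.le
      _ = _ := by ring
  have t3 : m * (Q ^ (m - 2) * (g x Q - g y Q)) ≤ (m - 1) * prs m M * L * |x - y| := by
    have i1 := (le_abs_self _).trans (hC.xlip x y Q ⟨hQ.le, hQP.trans hP⟩)
    have i2 : m * Q ^ (m - 1) ≤ (m - 1) * prs m M := by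
      have := prs_le hm hQ.le (hQP.trans hP)
      calc m * Q ^ (m - 1) = (m - 1) * prs m Q := by rw [prs]; field_simp
        _ ≤ _ := mul_le_mul_of_nonneg_left this hm1.le
    calc m * (Q ^ (m - 2) * (g x Q - g y Q)) ≤ m * (Q ^ (m - 2) * (L * Q * |x - y|)) := by
          gcongr
      _ = m * Q ^ (m - 1) * (L * |x - y|) := by rw [← eQ]; ring
      _ ≤ (m - 1) * prs m M * (L * |x - y|) :=
        mul_le_mul_of_nonneg_right i2 (by positivity)
      _ = _ := by ring
  have hpM : 0 ≤ (m - 1) * prs m M * L :=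
    mul_nonneg (mul_nonneg hm1.le (prs_nonneg hm (hP0.le.trans hP))) hL.le
  have hxy := abs_nonneg (x - y)
  have t4 : 0 ≤ 3 * m * L * |x - y| := by positivity
  have t5 := mul_nonneg hpM hd
  have t1' := mul_le_mul_of_nonneg_left t1 hm0.le
  have t2' := mul_le_mul_of_nonneg_left t2 hm0.le
  linarith

lemma scheme_bounds (hC : PowCoeffs m M Φ g L) {h τ : ℝ} (hh : 0 < h)
    (h1 : h ≤ 1 / 2) (hτ : 0 ≤ τ) (hcfl : 4 * L * τ ≤ h ^ 2) {V₀ : ℝ → ℝ} {ε : ℝ} (hε : 0 ≤ ε)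
    (h0 : ∀ x, V₀ x ∈ Icc ε M) (k : ℕ) (hk : k * (L * τ) ≤ 1) :
    ∀ x, scheme h τ Φ g V₀ k x ∈ Icc (ε * (1 - k * (L * τ))) M := by
  have hL := hC.pos
  induction k with
  | zero => simpa [scheme] using h0
  | succ k ih =>
    push_cast at hk ⊢
    have hLτ : 0 ≤ L * τ := by positivity
    have ih := ih (by linarith)
    have hk0 : 0 ≤ (k : ℝ) * (L * τ) := by positivity
    intro x
    have e1 : ∀ c, lap h (fun _ => Φ c) x = 0 := fun c => by
      unfold lap; ring
    set c := ε * (1 - k * (L * τ)) with hc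
    have hc0 : 0 ≤ c := mul_nonneg hε (by linarith)
    have hcM : c ≤ M := (ih x).1.trans (ih x).2
    have lo := scheme_mono hC.toCoeffs hh h1 hτ hcfl (V₀ := fun _ => c)
      (W₀ := scheme h τ Φ g V₀ k) (fun x => (ih x).1) 1 x
    have hi := scheme_mono hC.toCoeffs hh h1 hτ hcfl (W₀ := fun _ => M)
      (V₀ := scheme h τ Φ g V₀ k) (fun x => (ih x).2) 1 x
    simp only [scheme, e1] at lo hi
    simp only [scheme]
    have i1 := (abs_le.1 (hC.abs_le x hc0)).1
    have i2 := mul_le_mul_of_nonneg_left i1 hτ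
    have i3 := mul_le_mul_of_nonneg_left (hC.top x) hτ
    constructor
    · refine le_trans ?_ lo
      have : c ≤ ε := mul_le_of_le_one_right hε (by linarith)
      have := mul_le_mul_of_nonneg_right this hLτ
      rw [hc] at *
      linarith
    · linarith

set_option maxHeartbeats 1600000 in
/-- The discrete pressure keeps a one-sided modulus of continuity whose slope depends only on
the elapsed time. -/
lemma exists_scheme_modulus (hm : 1 < m) (hC : PowCoeffs m M Φ g L) (hM : 0 < M) :
    ∃ T₀ > 0, ∃ c₁ > 0, ∀ T ∈ Ioc 0 T₀, ∀ ε ∈ Ioc 0 M, ∀ Λ η : ℝ, 0 ≤ Λ → 0 < η → ∃ ρ > 0,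
      ∀ (h τ : ℝ) (K : ℕ) (V₀ : ℝ → ℝ), 0 < h → h ≤ ρ → 0 ≤ τ → τ ≤ h ^ 5 → K * τ = T →
      (∀ x, V₀ x ∈ Icc ε M) → (∀ x y, x ≤ y → prs m (V₀ x) - prs m (V₀ y) ≤ Λ * (y - x)) →
      ∀ (x : ℝ) (j : ℕ), prs m (scheme h τ Φ g V₀ K x) ≤
        prs m (scheme h τ Φ g V₀ K (x + j * h)) + η +
          4 * prs m M * (1 / √(c₁ * T)) * (j * h) := by
  have hL := hC.pos
  have hm1 : 0 < m - 1 := by linarith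
  have hpM := prs_pos hm hM
  obtain ⟨C, hCe⟩ : ∃ C, C = 4 * prs m M := ⟨_, rfl⟩
  have hC0 : 0 < C := by rw [hCe]; positivity
  obtain ⟨c₁, hc₁⟩ : ∃ c, c = (m - 1) * C / 2 := ⟨_, rfl⟩
  have hc0 : 0 < c₁ := by rw [hc₁]; positivity
  obtain ⟨lip, hlip⟩ : ∃ l, l = 3 * m * L + (m - 1) * prs m M * L := ⟨_, rfl⟩
  have hlip0 : 0 ≤ lip := by rw [hlip]; positivity
  obtain ⟨ω, hω⟩ : ∃ w, w = min 1 (c₁ / 2 / (lip * (1 + 2 / C) + 1)) := ⟨_, rfl⟩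
  have hω0 : 0 < ω := by rw [hω]; positivity
  refine ⟨min (1 / (2 * L)) (ω / (1 + c₁)), by positivity, c₁, hc0, ?_⟩
  rintro T ⟨hT0, hT⟩ ε ⟨hε, hεM⟩ Λ η hΛ hη
  have hT1 := hT.trans (min_le_left _ _)
  have hT2 := hT.trans (min_le_right _ _)
  rw [le_div_iff₀ (by positivity)] at hT1 hT2
  obtain ⟨s₀, hs₀⟩ : ∃ s, s = min (√T) (C / (2 * (Λ + 1))) := ⟨_, rfl⟩
  have hs0 : 0 < s₀ := by rw [hs₀]; have := Real.sqrt_pos.2 hT0; positivity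
  have hs1 : s₀ ^ 2 ≤ T := by
    have : s₀ ≤ √T := hs₀ ▸ min_le_left _ _
    calc s₀ ^ 2 ≤ √T ^ 2 := pow_le_pow_left₀ hs0.le this 2
      _ = T := Real.sq_sqrt hT0.le
  have hs2 : Λ ≤ C / 2 * (1 / s₀) := by
    have : s₀ ≤ C / (2 * (Λ + 1)) := hs₀ ▸ min_le_right _ _
    rw [le_div_iff₀ (by positivity)] at this
    rw [mul_one_div, le_div_iff₀ hs0]
    nlinarith
  obtain ⟨ρ, hρ, step⟩ := exists_modulus_step hm (half_pos hε) ((half_le_self hε.le).trans hεM)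
    hlip0 hL.le (one_div_pos.2 hs0) hη hCe hc₁
  refine ⟨min ρ (min (1 / 2) (1 / (4 * L))), by positivity, ?_⟩
  intro h τ K V₀ hh hhρ' hτ hτh hK hV hVl
  have hhρ := hhρ'.trans (min_le_left _ _)
  have hh1 := hhρ'.trans ((min_le_right _ _).trans (min_le_left _ _))
  have hhL := hhρ'.trans ((min_le_right _ _).trans (min_le_right _ _))
  have hcfl : 4 * L * τ ≤ h ^ 2 := by
    rw [le_div_iff₀ (by positivity)] at hhL
    have h3 : h ^ 5 ≤ h * h ^ 2 := by
      calc h ^ 5 ≤ h ^ 3 := pow_le_pow_of_le_one hh.le (by linarith) (by norm_num)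
        _ = h * h ^ 2 := by ring
    calc 4 * L * τ ≤ 4 * L * (h * h ^ 2) := by gcongr; exact hτh.trans h3
      _ = h * (4 * L) * h ^ 2 := by ring
      _ ≤ 1 * h ^ 2 := by gcongr
      _ = h ^ 2 := one_mul _
  have hkT : ∀ k ≤ K, k * τ ≤ T := fun k hk => by
    rw [← hK]; exact mul_le_mul_of_nonneg_right (by exact_mod_cast hk) hτ
  have bds : ∀ k ≤ K, ∀ x, scheme h τ Φ g V₀ k x ∈ Icc (ε / 2) M := by
    intro k hk x
    have i1 : k * (L * τ) ≤ 1 / 2 := by nlinarith [hkT k hk]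
    have := scheme_bounds hC hh hh1 hτ hcfl hε.le hV k (by linarith) x
    exact ⟨le_trans (by nlinarith) this.1, this.2⟩
  obtain ⟨S, hS⟩ : ∃ S : ℕ → ℝ, S = fun k : ℕ => √(s₀ ^ 2 + c₁ * (k * τ)) := ⟨_, rfl⟩
  have hS2 : ∀ k, S k ^ 2 = s₀ ^ 2 + c₁ * (k * τ) := fun k => by
    rw [hS]; exact Real.sq_sqrt (by positivity)
  have hSp : ∀ k, 0 < S k := fun k => by rw [hS]; exact Real.sqrt_pos.2 (by positivity)
  have hSs : ∀ k, s₀ ≤ S k := fun k => by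
    refine (pow_le_pow_iff_left₀ hs0.le (hSp k).le two_ne_zero).1 ?_
    rw [hS2]; have : 0 ≤ c₁ * (k * τ) := by positivity
    linarith
  have inv : ∀ k ≤ K, ∀ (x : ℝ) (j : ℕ), prs m (scheme h τ Φ g V₀ k x) ≤
      prs m (scheme h τ Φ g V₀ k (x + j * h)) + η + conc C (1 / S k * (j * h)) := by
    intro k
    induction k with
    | zero =>
      intro _ x j
      have eS : S 0 = s₀ := by
        rw [hS]; simp [Real.sqrt_sq hs0.le]
      rw [eS]
      simp only [scheme]
      have hr : 0 ≤ (j : ℝ) * h := by positivity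
      have hVj : 0 ≤ prs m (V₀ (x + j * h)) := prs_nonneg hm (hε.le.trans (hV _).1)
      have key : ∀ s : ℝ, 0 ≤ s → s ≤ 1 / 2 → C / 2 * s ≤ conc C s := fun s hs0 hs =>
        half_mul_le_conc hC0.le hs0 (by linarith [Real.add_one_le_exp (-s)])
      rcases le_or_gt (1 / s₀ * (j * h)) (1 / 2) with hs | hs
      · have i1 := hVl x (x + j * h) (by linarith)
        have i2 := key _ (by positivity) hs
        have i3 := mul_le_mul_of_nonneg_right hs2 hr
        have : C / 2 * (1 / s₀) * (j * h) = C / 2 * (1 / s₀ * (j * h)) := by ring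
        have : Λ * (x + j * h - x) = Λ * (j * h) := by ring
        linarith
      · have i1 := key (1 / 2) (by norm_num) le_rfl
        have i2 := conc_mono hC0.le hs.le
        have i3 := prs_le hm (hε.le.trans (hV x).1) (hV x).2
        linarith
    | succ k ih =>
      intro hk x j
      have ih := ih (by omega)
      have bk := bds k (by omega)
      have bk' := bds (k + 1) hk
      rcases j with _ | j
      · simp only [Nat.cast_zero, zero_mul, add_zero, mul_zero]
        have : 0 ≤ conc C 0 := conc_nonneg hC0.le le_rfl
        linarith
      set V := scheme h τ Φ g V₀ k with hV
      obtain ⟨r, hr⟩ : ∃ r, r = ((j + 1 : ℕ) : ℝ) * h := ⟨_, rfl⟩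
      have hhr : h ≤ r := by
        rw [hr]; push_cast
        have : 0 ≤ (j : ℝ) * h := by positivity
        linarith
      rw [← hr]
      have vb : ∀ z, prs m (V z) ∈ Icc 0 (prs m M) := fun z =>
        have i1 := (half_pos hε).le.trans (bk z).1
        ⟨prs_nonneg hm i1, prs_le hm i1 (bk z).2⟩
      have hΦ : ∀ z, Φ (V z) = psi m (prs m (V z)) := fun z => by
        have i1 := (half_pos hε).le.trans (bk z).1
        rw [psi_prs hm i1, hC.pow _ ⟨i1, (bk z).2⟩]
      have hΦ' : ∀ z, Φ (V z) = V z ^ m := fun z =>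
        hC.pow _ ⟨(half_pos hε).le.trans (bk z).1, (bk z).2⟩
      have hSk := hSp k
      have hSk' := hSp (k + 1)
      have hSS : S (k + 1) ^ 2 = S k ^ 2 + c₁ * τ := by
        rw [hS2, hS2]; push_cast; ring
      have hSle : S k ≤ S (k + 1) := by
        refine (pow_le_pow_iff_left₀ hSk.le hSk'.le two_ne_zero).1 ?_
        rw [hSS]; have : 0 ≤ c₁ * τ := by positivity
        linarith
      have hSω : S k ^ 2 ≤ ω := by
        rw [hS2]
        have := mul_le_mul_of_nonneg_left (hkT k (by omega)) hc0.le
        linarith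
      refine step h τ (1 / S k) (1 / S (k + 1)) r (V x) (V (x + r)) _ _ (g x (V x))
        (g (x + r) (V (x + r))) (prs m (V (x - h))) (prs m (V (x + h))) (prs m (V (x + r + h)))
        (prs m (V (x + r - h))) hh hhρ hτ hτh (one_div_pos.2 hSk)
        (one_div_le_one_div_of_le hs0 (hSs k)) ?_ (one_div_le_one_div_of_le hSk hSle) ?_ hhr
        (bk _) (bk _) (bk' _) (bk' _) (vb _) (vb _) (vb _) (vb _) ?_ ?_ ?_ ?_ ?_ ?_ ?_
        (hC.gbdd _ _) (hC.gbdd _ _) ?_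
      · have i1 : S k ^ 2 ≤ 1 := hSω.trans (hω ▸ min_le_left _ _)
        have i2 : S k ^ 2 ≤ c₁ / 2 / (lip * (1 + 2 / C) + 1) := hSω.trans (hω ▸ min_le_right _ _)
        have i3 : S k ≤ 1 := (sq_le_one_iff₀ hSk.le).1 i1
        rw [le_div_iff₀ (by positivity)] at i2
        have i4 : 2 / (C * (1 / S k)) ≤ 2 / C := by
          rw [mul_one_div, div_div_eq_mul_div]
          gcongr; linarith
        have i5 : lip * (1 + 2 / (C * (1 / S k))) + 1 ≤ lip * (1 + 2 / C) + 1 := by gcongr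
        refine i5.trans ?_
        rw [one_div, inv_pow, ← div_eq_mul_inv, le_div_iff₀ (by positivity)]
        linarith
      · rw [one_div, one_div, inv_pow, ← div_eq_mul_inv, inv_mul_eq_div, ← one_div,
          div_le_div_iff₀ hSk hSk', one_mul]
        have e1 : 1 - τ * (c₁ / 2) / S k ^ 2 = (3 * S k ^ 2 - S (k + 1) ^ 2) / (2 * S k ^ 2) := by
          rw [hSS]; field_simp; ring
        rw [e1, div_mul_eq_mul_div, div_le_iff₀ (by positivity)]
        nlinarith only [mul_nonneg (sq_nonneg (S (k + 1) - S k))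
          (by linarith : 0 ≤ S (k + 1) + 2 * S k)]
      · have := ih (x - h) (j + 2)
        rw [show x - h + ((j + 2 : ℕ) : ℝ) * h = x + r by rw [hr]; push_cast; ring,
          show ((j + 2 : ℕ) : ℝ) * h = r + h by rw [hr]; push_cast; ring] at this
        exact this
      · have := ih (x + h) j
        rw [show x + h + (j : ℝ) * h = x + r by rw [hr]; push_cast; ring,
          show (j : ℝ) * h = r - h by rw [hr]; push_cast; ring] at this
        exact this
      · have := ih x (j + 2)
        rw [show x + ((j + 2 : ℕ) : ℝ) * h = x + r + h by rw [hr]; push_cast; ring,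
          show ((j + 2 : ℕ) : ℝ) * h = r + h by rw [hr]; push_cast; ring] at this
        exact this
      · have := ih x j
        rw [show x + (j : ℝ) * h = x + r - h by rw [hr]; push_cast; ring,
          show (j : ℝ) * h = r - h by rw [hr]; push_cast; ring] at this
        exact this
      · have := ih x (j + 1)
        rw [← hr] at this
        exact this
      · simp only [scheme, lap, ← hV]
        rw [hΦ (x + h), hΦ (x - h), hΦ' x]; ring
      · simp only [scheme, lap, ← hV]
        rw [hΦ (x + r + h), hΦ (x + r - h), hΦ' (x + r)]
      · intro hQP
        have := hC.reaction_le hm (x := x) (y := x + r)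
          ((half_pos hε).trans_le (bk (x + r)).1) hQP (bk x).2
        rw [show x - (x + r) = -r by ring, abs_neg, abs_of_pos (hh.trans_le hhr), ← hlip] at this
        exact this
  intro x j
  refine (inv K le_rfl x j).trans ?_
  have i1 : conc C (1 / S K * (j * h)) ≤ C * (1 / S K * (j * h)) := conc_le_mul hC0.le
  have i2 : √(c₁ * T) ≤ S K := by
    refine (pow_le_pow_iff_left₀ (Real.sqrt_nonneg _) (hSp K).le two_ne_zero).1 ?_
    rw [Real.sq_sqrt (by positivity), hS2, hK]
    nlinarith
  have i3 : 1 / S K ≤ 1 / √(c₁ * T) :=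
    one_div_le_one_div_of_le (Real.sqrt_pos.2 (by positivity)) i2
  have i4 : C * (1 / S K * (j * h)) ≤ C * (1 / √(c₁ * T)) * (j * h) := by
    rw [← mul_assoc]; gcongr
  rw [← hCe]
  linarith

end

lemma avg_eq_lap {F F₁ q : ℝ → ℝ} (h0 : ∀ x, HasDerivAt F (F₁ x) x)
    (h1 : ∀ x, HasDerivAt F₁ (q x) x) (hq : Continuous q) {h : ℝ} (hh : 0 < h) (x : ℝ) :
    avg h q x = lap h F x := by
  have d : ∀ ξ : ℝ, HasDerivAt (fun ξ => (1 - ξ) * ((F₁ (x + h * ξ) - F₁ (x - h * ξ)) / h) +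
      (F (x + h * ξ) + F (x - h * ξ)) / h ^ 2)
      ((1 - ξ) * (q (x + h * ξ) + q (x - h * ξ))) ξ := by
    intro ξ
    have l1 : HasDerivAt (fun ξ => x + h * ξ) h ξ := by
      simpa using ((hasDerivAt_id ξ).const_mul h).const_add x
    have l2 : HasDerivAt (fun ξ => x - h * ξ) (-h) ξ := by
      simpa using ((hasDerivAt_id ξ).const_mul h).const_sub x
    have a1 := (h1 (x + h * ξ)).comp ξ l1
    have a2 := (h1 (x - h * ξ)).comp ξ l2
    have b1 := (h0 (x + h * ξ)).comp ξ l1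
    have b2 := (h0 (x - h * ξ)).comp ξ l2
    have c1 : HasDerivAt (fun ξ : ℝ => 1 - ξ) (-1) ξ := by
      simpa using (hasDerivAt_id ξ).const_sub 1
    refine ((c1.mul ((a1.sub a2).div_const h)).add
      ((b1.add b2).div_const (h ^ 2))).congr_deriv ?_
    simp only [Function.comp_apply, Pi.sub_apply]
    field_simp
    ring
  rw [avg, intervalIntegral.integral_eq_sub_of_hasDerivAt (fun ξ _ => d ξ)
    (Continuous.intervalIntegrable (by fun_prop) _ _)]
  simp only [lap, mul_one, mul_zero, add_zero, sub_zero]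
  ring

lemma exists_primitive {q : ℝ → ℝ} (hq : Continuous q) :
    ∃ F : ℝ → ℝ, ∀ x, HasDerivAt F (q x) x :=
  ⟨fun x => ∫ y in (0 : ℝ)..x, q y, fun x => hq.integral_hasStrictDerivAt 0 x |>.hasDerivAt⟩

/-- Averages of a bounded continuous function are Lipschitz. -/
lemma abs_avg_sub_avg_le {q : ℝ → ℝ} (hq : Continuous q) {B : ℝ} (hB : ∀ x, |q x| ≤ B) {h : ℝ}
    (hh : 0 < h) (x y : ℝ) : |avg h q y - avg h q x| ≤ 2 * B / h * |y - x| := by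
  obtain ⟨F₁, h1⟩ := exists_primitive hq
  have c1 : Continuous F₁ := continuous_iff_continuousAt.2 fun x => (h1 x).continuousAt
  obtain ⟨F, h0⟩ := exists_primitive c1
  have lipF : ∀ a b, |F₁ b - F₁ a| ≤ B * |b - a| := fun a b =>
    convex_univ.norm_image_sub_le_of_norm_hasDerivWithin_le (f := F₁)
      (fun z _ => (h1 z).hasDerivWithinAt) (fun z _ => hB z) (mem_univ a) (mem_univ b)
  have d : ∀ z, HasDerivAt (avg h q) ((F₁ (z + h) - 2 * F₁ z + F₁ (z - h)) / h ^ 2) z := by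
    intro z
    have e : avg h q = fun z => (F (z + h) - 2 * F z + F (z - h)) / h ^ 2 :=
      funext fun z => avg_eq_lap h0 h1 hq hh z
    rw [e]
    exact (((h0 (z + h)).comp_add_const z h).sub ((h0 z).const_mul 2)).add
      ((h0 (z - h)).comp_sub_const z h) |>.div_const _
  refine convex_univ.norm_image_sub_le_of_norm_hasDerivWithin_le (f := avg h q)
    (fun z _ => (d z).hasDerivWithinAt) (fun z _ => ?_) (mem_univ x) (mem_univ y)
  rw [Real.norm_eq_abs, abs_div, abs_of_pos (by positivity : 0 < h ^ 2),
    div_le_div_iff₀ (by positivity) hh]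
  have i1 := lipF z (z + h)
  have i2 := lipF (z - h) z
  rw [show z + h - z = h by ring, abs_of_pos hh] at i1
  rw [show z - (z - h) = h by ring, abs_of_pos hh] at i2
  have i3 : |F₁ (z + h) - 2 * F₁ z + F₁ (z - h)| ≤ 2 * B * h := by
    rw [abs_le] at i1 i2 ⊢
    constructor <;> linarith [i1.1, i1.2, i2.1, i2.2]
  calc _ ≤ 2 * B * h * h := mul_le_mul_of_nonneg_right i3 hh.le
    _ = _ := by ring

section

variable {m M : ℝ} {Φ : ℝ → ℝ} {g : ℝ → ℝ → ℝ} {L : ℝ}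

/-- Instantaneous one-sided Lipschitz bound for the pressure. -/
lemma exists_pressure_lipschitz (hm : 1 < m) (hC : PowCoeffs m M Φ g L) (hM : 1 ≤ M) :
    ∃ T₀ > 0, ∀ T ∈ Ioc 0 T₀, ∃ D, 0 ≤ D ∧ ∀ U : ℝ → ℝ → ℝ, Sol Φ g T U →
      (Continuous fun x => U x 0) → (∀ x, U x 0 ∈ Icc 0 (M - 1)) →
      ∀ x y, x ≤ y → prs m (U x T) - prs m (U y T) ≤ D * (y - x) := by
  have hM0 : 0 < M := by linarith
  have hL := hC.pos
  obtain ⟨T₀, hT₀, c₁, hc₁, main⟩ := exists_scheme_modulus hm hC hM0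
  refine ⟨T₀, hT₀, fun T hT => ?_⟩
  have main := main T hT
  have hpM := prs_pos hm hM0
  obtain ⟨D, hD⟩ : ∃ D, D = 4 * prs m M * (1 / √(c₁ * T)) := ⟨_, rfl⟩
  rw [← hD] at main
  have hD0 : 0 ≤ D := by rw [hD]; positivity
  refine ⟨D, hD0, fun U hU hU0c hU0 x y hxy => ?_⟩
  rcases hxy.eq_or_lt with rfl | hxy
  · simp
  by_contra! hcon
  obtain ⟨r, hr⟩ : ∃ r, r = y - x := ⟨_, rfl⟩
  have hr0 : 0 < r := by rw [hr]; linarith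
  obtain ⟨η, hη⟩ : ∃ η, η = (prs m (U x T) - prs m (U y T) - D * (y - x)) / 2 := ⟨_, rfl⟩
  have hη0 : 0 < η := by rw [hη]; linarith
  have h00 : (0 : ℝ) ∈ Icc 0 T := ⟨le_rfl, hT.1.le⟩
  have hTT : T ∈ Icc 0 T := ⟨hT.1.le, le_rfl⟩
  have hUb := hU.bddMeas h00
  have approx : ∀ δ > 0, ∃ V₀ : ℝ → ℝ, ∃ ε ∈ Ioc 0 M, ∃ Λ, 0 ≤ Λ ∧ BddMeas V₀ ∧
      (∀ x, V₀ x ∈ Icc ε M) ∧ (∀ x y, x ≤ y → prs m (V₀ x) - prs m (V₀ y) ≤ Λ * (y - x)) ∧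
      wnorm (fun x => V₀ x - U x 0) ≤ δ := by
    intro δ hδ
    obtain ⟨ρ, hρ, H⟩ := exists_wnorm_avg_sub_le hUb hU.init (half_pos hδ)
    have H := H ρ 0 hρ.le le_rfl (by simpa using hρ.le)
    obtain ⟨w, hw⟩ : ∃ w, w = wnorm (fun _ => (1 : ℝ)) := ⟨_, rfl⟩
    have hw0 : 0 ≤ w := hw ▸ wnorm_nonneg _
    obtain ⟨ε, hε⟩ : ∃ ε, ε = min 1 (δ / 2 / (w + 1)) := ⟨_, rfl⟩
    have hε0 : 0 < ε := by rw [hε]; positivity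
    have hε1 : ε ≤ 1 := hε ▸ min_le_left _ _
    have hε2 : ε ≤ δ / 2 / (w + 1) := hε ▸ min_le_right _ _
    rw [le_div_iff₀ (by positivity)] at hε2
    have hab : ∀ x, |U x 0| ≤ M - 1 := fun x => by
      rw [abs_of_nonneg (hU0 x).1]; exact (hU0 x).2
    have hav : ∀ x, avg ρ (fun y => U y 0) x ∈ Icc 0 (M - 1) := fun x => by
      have i1 := avg_mono hρ.le (bddMeas_const 0) hUb x fun w _ => (hU0 _).1
      have i2 := avg_mono hρ.le hUb (bddMeas_const (M - 1)) x fun w _ => (hU0 _).2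
      rw [avg_const] at i1 i2
      exact ⟨i1, i2⟩
    have hV : ∀ x, ε + avg ρ (fun y => U y 0) x ∈ Icc ε M := fun x =>
      ⟨by linarith [(hav x).1], by linarith [(hav x).2]⟩
    obtain ⟨N, hN, hNb⟩ := exists_bound_rpow m (m - 2) (l := ε) (u := M) hε0
    have hM1 : 0 ≤ M - 1 := by linarith
    refine ⟨fun x => ε + avg ρ (fun y => U y 0) x, ε, ⟨hε0, hε1.trans hM⟩,
      N * (2 * (M - 1) / ρ), by positivity, (bddMeas_const ε).add (hUb.avg hρ.le), hV, ?_, ?_⟩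
    · intro x y hxy
      have i1 := abs_sub_le_of_hasDerivAt (G := prs m) (G₁ := fun v => m * v ^ (m - 2))
        (fun v hv => hasDerivAt_prs hm (hε0.trans_le hv.1)) hNb (hV y) (hV x)
      have i2 := abs_avg_sub_avg_le hU0c hab hρ x y
      rw [abs_of_nonneg (sub_nonneg.2 hxy), abs_sub_comm] at i2
      refine (le_abs_self _).trans (i1.trans ?_)
      rw [mul_assoc, show ∀ a b : ℝ, ε + a - (ε + b) = a - b from fun a b => by ring]
      exact mul_le_mul_of_nonneg_left i2 hN
    · have e : (fun x => ε + avg ρ (fun y => U y 0) x - U x 0) =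
          fun x => ε * 1 + (avg ρ (fun y => U y 0) (x + 0) - U x 0) := by
        funext x; rw [add_zero]; ring
      rw [e]
      refine (wnorm_add_le ((bddMeas_const 1).const_mul ε) ?_).trans ?_
      · simpa using (hUb.avg hρ.le).sub hUb
      rw [wnorm_const_mul, ← hw, abs_of_pos hε0]
      linarith
  have disc : ∀ n : ℕ, ∃ V : ℝ → ℝ, BddMeas V ∧
      wnorm (fun x => V x - U x T) ≤ 1 / ((n : ℝ) + 1) ∧
      ∀ x, prs m (V x) ≤ prs m (V (x + r)) + η + D * r := by
    intro n
    obtain ⟨ρ₁, hρ₁, H₁⟩ := exists_scheme_close hC.toCoeffs hU hT.1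
      (ε := 1 / ((n : ℝ) + 1)) (by positivity)
    obtain ⟨V₀, ε, hε, Λ, hΛ, hVb, hV, hVl, hVw⟩ := approx ρ₁ hρ₁
    obtain ⟨ρ₂, hρ₂, H₂⟩ := main ε hε Λ η hΛ hη0
    obtain ⟨h, τ, j, K, hh, hhρ, hτ, hτh, hj, hK⟩ := exists_grid hr0 hT.1
      (lt_min (lt_min hρ₁ hρ₂) (by norm_num : (0 : ℝ) < 1 / 2))
      (by positivity : 0 < min 1 (1 / (4 * L)))
    have hh1 : h ≤ ρ₁ := hhρ.trans ((min_le_left _ _).trans (min_le_left _ _))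
    have hh2 : h ≤ ρ₂ := hhρ.trans ((min_le_left _ _).trans (min_le_right _ _))
    have hh3 : h ≤ 1 / 2 := hhρ.trans (min_le_right _ _)
    have h5 : 0 < h ^ 5 := by positivity
    have hτ5 : τ ≤ h ^ 5 := hτh.trans (mul_le_of_le_one_left h5.le (min_le_left _ _))
    have hτL : τ ≤ 1 / (4 * L) * h ^ 5 :=
      hτh.trans (mul_le_mul_of_nonneg_right (min_le_right _ _) h5.le)
    have hcfl : 2 * L * τ ≤ h ^ 2 := by
      have h5 : h ^ 5 ≤ h ^ 2 := pow_le_pow_of_le_one hh.le (by linarith) (by norm_num)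
      rw [one_div, inv_mul_eq_div, le_div_iff₀ (by positivity)] at hτL
      nlinarith [mul_nonneg hL.le hτ.le]
    refine ⟨scheme h τ Φ g V₀ K, hC.bddMeas_scheme h τ hVb K,
      H₁ h τ K V₀ hh hh1 hτ.le hcfl hK hVb hVw, fun x => ?_⟩
    have := H₂ h τ K V₀ hh hh2 hτ.le hτ5 hK hV hVl x j
    rwa [hj] at this
  choose V hVb hVw hVm using disc
  have cU := hU.continuous_slice hT.1
  have cp := (continuous_prs hm).comp cU
  have hO : IsOpen {z | prs m (U (z + r) T) + η + D * r < prs m (U z T)} :=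
    isOpen_lt (((cp.comp (continuous_add_const r)).add_const η).add_const _) cp
  obtain ⟨z, hz, ns, -, t1, t2, -, -⟩ := exists_point_tendsto (hU.bddMeas hTT) (hU.bddMeas hTT)
    hVb hVb hVw hVw r hO ⟨x, by
      rw [mem_ofPred_eq, hr, show x + (y - x) = y by ring]; linarith⟩
  have e1 := ((continuous_prs hm).tendsto _).comp t1
  have e2 := ((continuous_prs hm).tendsto _).comp t2
  have := le_of_tendsto_of_tendsto' e1 ((e2.add_const η).add_const (D * r))
    fun i => hVm (ns i) z
  exact absurd hz (not_lt.2 this)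

end

/-- Truncation of a real number to `[0, M]`. -/
def clamp (M u : ℝ) : ℝ := max 0 (min M u)

/-- The truncated diffusion `u ↦ u ^ m`. -/
def powTrunc (m M u : ℝ) : ℝ := clamp M u ^ m

/-- The truncated reaction `f(x,u)(κ(x) - u)`. -/
def reactTrunc (f : ℝ → ℝ → ℝ) (κ : ℝ → ℝ) (M x u : ℝ) : ℝ :=
  f x (clamp M u) * (κ x - clamp M u)

lemma clamp_mem {M : ℝ} (hM : 0 ≤ M) (u : ℝ) : clamp M u ∈ Icc 0 M :=
  ⟨le_max_left _ _, max_le hM (min_le_left _ _)⟩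

lemma clamp_of_mem {M u : ℝ} (hu : u ∈ Icc 0 M) : clamp M u = u := by
  rw [clamp, min_eq_right hu.2, max_eq_right hu.1]

lemma continuous_clamp (M : ℝ) : Continuous (clamp M) := by unfold clamp; fun_prop

lemma abs_clamp_sub_le (M a b : ℝ) : |clamp M a - clamp M b| ≤ |a - b| := by
  unfold clamp
  have h1 := abs_max_sub_max_le_max 0 (min M a) 0 (min M b)
  have h2 := abs_min_sub_min_le_max M a M b
  simp only [sub_self, abs_zero, abs_nonneg, max_eq_right] at h1 h2
  exact h1.trans h2

lemma monotone_clamp (M : ℝ) : Monotone (clamp M) := fun a b h => by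
  unfold clamp; gcongr

/-- A periodic `C¹` function is Lipschitz in the second variable on compact intervals,
uniformly in the first. -/
lemma exists_lipschitz_of_periodic {H : ℝ × ℝ → ℝ} (hH : ContDiff ℝ 1 H)
    (hper : ∀ x u, H (x + 1, u) = H (x, u)) (M : ℝ) :
    ∃ C, 0 ≤ C ∧ ∀ x, ∀ a ∈ Icc 0 M, ∀ b ∈ Icc 0 M, |H (x, a) - H (x, b)| ≤ C * |a - b| := by
  obtain ⟨C, hC⟩ := (isCompact_Icc (a := (0 : ℝ)) (b := 1)).prod
    (isCompact_Icc (a := (0 : ℝ)) (b := M)) |>.exists_bound_of_continuousOn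
    (hH.continuous_fderiv one_ne_zero).continuousOn
  refine ⟨max C 0, le_max_right _ _, fun x a ha b hb => ?_⟩
  have hfr : ∀ u, H (x, u) = H (Int.fract x, u) := by
    intro u
    have : Function.Periodic (fun y => H (y, u)) 1 := fun y => hper y u
    have h2 := this.sub_int_mul_eq ⌊x⌋ (x := x)
    simp only [mul_one] at h2
    rw [← h2]; rfl
  rw [hfr, hfr]
  have hcv : Convex ℝ (Icc (0 : ℝ) 1 ×ˢ Icc (0 : ℝ) M) := (convex_Icc _ _).prod (convex_Icc _ _)
  have hx : Int.fract x ∈ Icc (0 : ℝ) 1 := ⟨Int.fract_nonneg x, (Int.fract_lt_one x).le⟩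
  have := hcv.norm_image_sub_le_of_norm_fderiv_le (𝕜 := ℝ) (f := H)
    (fun z _ => (hH.differentiable one_ne_zero) z) (fun z hz => (hC z hz).trans (le_max_left C 0))
    (x := (Int.fract x, b)) (y := (Int.fract x, a)) ⟨hx, hb⟩ ⟨hx, ha⟩
  rw [Real.norm_eq_abs] at this
  refine this.trans_eq ?_
  simp [Prod.norm_def]

lemma exists_xlip_of_periodic {H : ℝ × ℝ → ℝ} (hH : ContDiff ℝ 2 H)
    (hper : ∀ x u, H (x + 1, u) = H (x, u)) (h0 : ∀ x, H (x, 0) = 0) (M : ℝ) :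
    ∃ C, 0 ≤ C ∧ ∀ x y, ∀ u ∈ Icc 0 M, |H (x, u) - H (y, u)| ≤ C * u * |x - y| := by
  have hd : ∀ x u, HasDerivAt (fun y => H (y, u)) (fderiv ℝ H (x, u) (1, 0)) x := by
    intro x u
    have h1 : HasFDerivAt H (fderiv ℝ H (x, u)) (x, u) :=
      (hH.differentiable two_ne_zero (x, u)).hasFDerivAt
    have h2 : HasDerivAt (fun y : ℝ => (y, u)) ((1 : ℝ), (0 : ℝ)) x :=
      (hasDerivAt_id x).prodMk (hasDerivAt_const x u)
    exact h1.comp_hasDerivAt x h2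
  have hG : ContDiff ℝ 1 fun z => fderiv ℝ H z ((1 : ℝ), (0 : ℝ)) :=
    (hH.fderiv_right (m := 1) (by norm_num)).clm_apply contDiff_const
  have hGper : ∀ x u, fderiv ℝ H (x + 1, u) ((1 : ℝ), (0 : ℝ))
      = fderiv ℝ H (x, u) ((1 : ℝ), (0 : ℝ)) := by
    intro x u
    have e : (fun z : ℝ × ℝ => H (z + (1, 0))) = H := by
      ext ⟨a, b⟩; simpa using hper a b
    have := fderiv_comp_add_right (𝕜 := ℝ) (f := H) (x := (x, u)) ((1 : ℝ), (0 : ℝ))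
    rw [e] at this
    rw [this]; simp
  obtain ⟨C, hC0, hC⟩ := exists_lipschitz_of_periodic hG hGper M
  refine ⟨C, hC0, fun x y u hu => ?_⟩
  have hz : ∀ x, fderiv ℝ H (x, 0) ((1 : ℝ), (0 : ℝ)) = 0 := by
    intro x
    have h1 := hd x 0
    have e : (fun y : ℝ => H (y, 0)) = fun _ => 0 := funext h0
    rw [e] at h1
    exact h1.unique (hasDerivAt_const x 0)
  have hb : ∀ x ∈ (univ : Set ℝ), ‖fderiv ℝ H (x, u) ((1 : ℝ), (0 : ℝ))‖ ≤ C * u := by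
    intro x _
    have := hC x u hu 0 ⟨le_rfl, hu.1.trans hu.2⟩
    rwa [hz, sub_zero, sub_zero, abs_of_nonneg hu.1] at this
  exact convex_univ.norm_image_sub_le_of_norm_hasDerivWithin_le
    (fun x _ => (hd x u).hasDerivWithinAt) hb (mem_univ y) (mem_univ x)

lemma abs_rpow_sub_rpow_le {m M a b : ℝ} (hm : 1 < m) (ha : a ∈ Icc 0 M) (hb : b ∈ Icc 0 M) :
    |a ^ m - b ^ m| ≤ m * M ^ (m - 1) * |a - b| := by
  have := (convex_Icc (0 : ℝ) M).norm_image_sub_le_of_norm_hasDerivWithin_le (𝕜 := ℝ)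
    (f := fun u : ℝ => u ^ m) (f' := fun u => m * u ^ (m - 1)) (C := m * M ^ (m - 1))
    (fun u _ => (Real.hasDerivAt_rpow_const (Or.inr hm.le)).hasDerivWithinAt)
    (fun u hu => ?_) hb ha
  · simpa using this
  · have := Real.rpow_nonneg hu.1 (m - 1)
    rw [Real.norm_of_nonneg (by positivity)]
    have := Real.rpow_le_rpow hu.1 hu.2 (z := m - 1) (by linarith)
    gcongr

/-- The truncated coefficients of the equation satisfy all structural assumptions. -/
lemma exists_powCoeffs {m : ℝ} (hm : 1 < m) {f : ℝ → ℝ → ℝ} {κ : ℝ → ℝ} {θ M : ℝ}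
    (hF : CondF1 f κ θ) (hM : ∀ x, κ x ≤ M) :
    ∃ L, PowCoeffs m M (powTrunc m M) (reactTrunc f κ M) L := by
  obtain ⟨hf, hκ, hfp, hκp, hf0, hθ, hfpos, hκθ⟩ := hF
  have hθM : θ < M := (hκθ 0).trans_le (hM 0)
  have hM0 : 0 ≤ M := by linarith
  have hG : ContDiff ℝ 2 fun z : ℝ × ℝ => f z.1 z.2 * (κ z.1 - z.2) :=
    hf.mul ((hκ.comp contDiff_fst).sub contDiff_snd)
  have hGp : ∀ x u, (fun z : ℝ × ℝ => f z.1 z.2 * (κ z.1 - z.2)) (x + 1, u)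
      = (fun z : ℝ × ℝ => f z.1 z.2 * (κ z.1 - z.2)) (x, u) := by
    intro x u; simp [hfp, hκp]
  obtain ⟨C₁, h1, hC₁⟩ := exists_lipschitz_of_periodic (hG.of_le (by norm_num)) hGp M
  obtain ⟨C₂, h2, hC₂⟩ := exists_xlip_of_periodic hG hGp (by simp [hf0]) M
  have hmM : 0 ≤ m * M ^ (m - 1) := by positivity
  have hMm : 0 ≤ M ^ m := by positivity
  have hCM : 0 ≤ C₁ * M := by positivity
  set L := 1 + C₁ + C₂ + m * M ^ (m - 1) + M ^ m + C₁ * M with hL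
  refine ⟨L, ⟨by linarith, fun a b h => ?_, fun a b => ?_, fun a => ?_, ?_, fun x a b => ?_,
    fun x a => ?_⟩, fun u hu => ?_, fun x => ?_, fun x => ?_, fun x y u hu => ?_⟩
  · exact Real.rpow_le_rpow (clamp_mem hM0 a).1 (monotone_clamp M h) (by linarith)
  · refine (abs_rpow_sub_rpow_le hm (clamp_mem hM0 a) (clamp_mem hM0 b)).trans ?_
    have := abs_clamp_sub_le M a b
    gcongr; linarith
  · have ha := clamp_mem hM0 a
    have := Real.rpow_le_rpow ha.1 ha.2 (z := m) (by linarith)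
    rw [powTrunc, abs_of_nonneg (Real.rpow_nonneg ha.1 m)]
    linarith
  · have := hG.continuous.comp (continuous_fst.prodMk ((continuous_clamp M).comp continuous_snd))
    exact this
  · refine (hC₁ x _ (clamp_mem hM0 a) _ (clamp_mem hM0 b)).trans ?_
    have := abs_clamp_sub_le M a b
    gcongr; linarith
  · have ha := clamp_mem hM0 a
    have := hC₁ x _ ha 0 ⟨le_rfl, hM0⟩
    simp only [hf0, zero_mul, sub_zero, abs_of_nonneg ha.1] at this
    have h3 : C₁ * clamp M a ≤ C₁ * M := mul_le_mul_of_nonneg_left ha.2 h1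
    exact this.trans (by linarith)
  · rw [powTrunc, clamp_of_mem hu]
  · rw [reactTrunc, clamp_of_mem ⟨le_rfl, hM0⟩, hf0, zero_mul]
  · rw [reactTrunc, clamp_of_mem ⟨hM0, le_rfl⟩]
    exact mul_nonpos_of_nonneg_of_nonpos (hfpos x M hθM).le (by linarith [hM x])
  · rw [reactTrunc, reactTrunc, clamp_of_mem hu]
    refine (hC₂ x y u hu).trans ?_
    have := hu.1
    gcongr; linarith

lemma integral_swap_of_bdd {F : ℝ → ℝ → ℝ} (hF : Measurable (Function.uncurry F)) {a b A B : ℝ}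
    (hab : a ≤ b) (hB : ∀ x, ∀ s ∈ Ioc a b, |F x s| ≤ B) (hA : ∀ x, ∀ s ∈ Ioc a b, A < |x| → F x s = 0) :
    ∫ x, ∫ s in a..b, F x s = ∫ s in a..b, ∫ x, F x s := by
  refine (intervalIntegral_integral_swap (f := fun s x => F x s) ?_).symm
  rw [uIoc_of_le hab]
  have h1 : Integrable (fun z : ℝ × ℝ => (fun _ : ℝ => (1 : ℝ)) z.1 *
      (Icc (-A) A).indicator (fun _ => B) z.2) ((volume.restrict (Ioc a b)).prod volume) :=
    Integrable.mul_prod (μ := volume.restrict (Ioc a b)) (f := fun _ => (1 : ℝ))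
      (integrable_const _) ((integrable_indicator_iff measurableSet_Icc).2
        (integrableOn_const (by simp)))
  refine h1.mono' (hF.comp measurable_swap).aestronglyMeasurable ?_
  have e : (volume.restrict (Ioc a b)).prod (volume : Measure ℝ) =
      ((volume : Measure ℝ).prod (volume : Measure ℝ)).restrict (Ioc a b ×ˢ univ) := by
    rw [← Measure.prod_restrict, Measure.restrict_univ]
  rw [e]
  filter_upwards [ae_restrict_mem (measurableSet_Ioc.prod MeasurableSet.univ)] with z hz
  have h2 : ‖Function.uncurry (fun s x => F x s) z‖ = |F z.2 z.1| := rfl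
  rw [h2, one_mul]
  by_cases h3 : A < |z.2|
  · rw [hA _ _ hz.1 h3, abs_zero]
    refine indicator_nonneg (fun x _ => ?_) _
    exact (abs_nonneg _).trans (hB 0 _ hz.1)
  · rw [indicator_of_mem (show z.2 ∈ Icc (-A) A from abs_le.1 (not_lt.1 h3))]
    exact hB _ _ hz.1

lemma exists_support_bound {ρ : ℝ → ℝ} (hρ : Continuous ρ) (hs : HasCompactSupport ρ) :
    ∃ A B, 0 ≤ A ∧ 0 ≤ B ∧ (∀ x, A < |x| → ρ x = 0) ∧ ∀ x, |ρ x| ≤ B := by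
  obtain ⟨A, hA⟩ := hs.isCompact.isBounded.exists_norm_le
  obtain ⟨B, hB⟩ := hs.exists_bound_of_continuous hρ
  refine ⟨max A 0, B, le_max_right _ _, (norm_nonneg _).trans (hB 0), fun x hx => ?_, hB⟩
  by_contra h
  exact absurd (hA x (subset_tsupport _ h)) (not_le.2 ((le_max_left _ _).trans_lt hx))

lemma BddMeas.integrable_mul {q ρ : ℝ → ℝ} (hq : BddMeas q) (hρ : Continuous ρ)
    (hs : HasCompactSupport ρ) : Integrable fun x => q x * ρ x := by
  obtain ⟨B, hB⟩ := hq.2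
  exact (hρ.integrable_of_hasCompactSupport hs).bdd_mul hq.1.aestronglyMeasurable
    (Eventually.of_forall hB)

lemma integral_mul_translate (q ρ : ℝ → ℝ) (y : ℝ) :
    ∫ x, q x * ρ (x + y) = ∫ x, q (x - y) * ρ x := by
  rw [← integral_sub_right_eq_self (fun x => q x * ρ (x + y)) y]
  simp

lemma integral_mul_translate' (q ρ : ℝ → ℝ) (y : ℝ) :
    ∫ x, q x * ρ (x - y) = ∫ x, q (x + y) * ρ x := by
  rw [← integral_add_right_eq_self (fun x => q x * ρ (x - y)) y]
  simp

lemma integral_mul_symm_translate {q ρ : ℝ → ℝ} (hq : BddMeas q) (hρ : Continuous ρ)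
    (hs : HasCompactSupport ρ) (y : ℝ) :
    ∫ x, q x * (ρ (x + y) + ρ (x - y)) = ∫ x, (q (x + y) + q (x - y)) * ρ x := by
  have i1 := hq.integrable_mul (hρ.comp (continuous_add_const y))
    (hs.comp_homeomorph (Homeomorph.addRight y))
  have i2 := hq.integrable_mul (hρ.comp (continuous_sub_right y))
    (hs.comp_homeomorph (Homeomorph.subRight y))
  have i3 := (hq.translate y).integrable_mul hρ hs
  have i4 := (hq.translate (-y)).integrable_mul hρ hs
  simp only [Function.comp_def] at i1 i2
  simp only [mul_add, add_mul]
  simp only [← sub_eq_add_neg] at i4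
  rw [integral_add i1 i2, integral_add i3 i4, integral_mul_translate, integral_mul_translate',
    add_comm]

lemma integral_mul_lap {q ρ : ℝ → ℝ} (hq : BddMeas q) (hρ : Continuous ρ)
    (hs : HasCompactSupport ρ) (h : ℝ) :
    ∫ x, q x * lap h ρ x = ∫ x, lap h q x * ρ x := by
  have i1 := hq.integrable_mul (hρ.comp (continuous_add_const h))
    (hs.comp_homeomorph (Homeomorph.addRight h))
  have i2 := hq.integrable_mul (hρ.comp (continuous_sub_right h))
    (hs.comp_homeomorph (Homeomorph.subRight h))
  have i3 := (hq.translate h).integrable_mul hρ hs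
  have i4 := (hq.translate (-h)).integrable_mul hρ hs
  have i5 := hq.integrable_mul hρ hs
  simp only [Function.comp_def] at i1 i2
  simp only [← sub_eq_add_neg] at i4
  have e1 : ∀ x, q x * lap h ρ x =
      (q x * (ρ (x + h) + ρ (x - h)) - 2 * (q x * ρ x)) / h ^ 2 := by
    intro x; rw [lap]; ring
  have e2 : ∀ x, lap h q x * ρ x =
      ((q (x + h) + q (x - h)) * ρ x - 2 * (q x * ρ x)) / h ^ 2 := by
    intro x; rw [lap]; ring
  simp only [e1, e2, integral_div]
  rw [integral_sub _ (i5.const_mul 2), integral_sub _ (i5.const_mul 2),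
    integral_mul_symm_translate hq hρ hs]
  · simp only [add_mul]; exact i3.add i4
  · simp only [mul_add]; exact i1.add i2

lemma integral_mul_avg {q ρ : ℝ → ℝ} (hq : BddMeas q) (hρ : Continuous ρ)
    (hs : HasCompactSupport ρ) {h : ℝ} (hh : 0 < h) :
    ∫ x, q x * avg h ρ x = ∫ x, avg h q x * ρ x := by
  obtain ⟨A, B, hA0, hB0, hA, hB⟩ := exists_support_bound hρ hs
  obtain ⟨Q, hQ⟩ := hq.2
  have hQ0 : 0 ≤ Q := (abs_nonneg _).trans (hQ 0)
  have hqm := hq.1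
  have hρm := hρ.measurable
  simp only [avg, ← intervalIntegral.integral_const_mul, ← intervalIntegral.integral_mul_const]
  rw [integral_swap_of_bdd (A := A + h) (B := Q * (1 * (B + B))) _ zero_le_one,
    integral_swap_of_bdd (A := A) (B := 1 * (Q + Q) * B) _ zero_le_one]
  · congr 1; ext ξ
    have e1 : ∀ x, q x * ((1 - ξ) * (ρ (x + h * ξ) + ρ (x - h * ξ))) =
      (1 - ξ) * (q x * (ρ (x + h * ξ) + ρ (x - h * ξ))) := fun x => by ring
    simp only [e1, mul_assoc, integral_const_mul]
    rw [integral_mul_symm_translate hq hρ hs]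
  · intro x s hs
    rw [abs_mul, abs_mul, abs_of_nonneg (by linarith [hs.2] : 0 ≤ 1 - s)]
    have h1 := (abs_add_le (q (x + h * s)) (q (x - h * s))).trans (add_le_add (hQ _) (hQ _))
    have h2 : 1 - s ≤ 1 := by linarith [hs.1]
    have := hB x
    gcongr
  · intro x s _ hx; rw [hA x hx, mul_zero]
  · have h1 : Measurable fun z : ℝ × ℝ => q (z.1 + h * z.2) := hqm.comp (by fun_prop)
    have h2 : Measurable fun z : ℝ × ℝ => q (z.1 - h * z.2) := hqm.comp (by fun_prop)
    exact ((measurable_const.sub measurable_snd).mul (h1.add h2)).mul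
      (hρm.comp measurable_fst)
  · intro x s hs
    rw [abs_mul, abs_mul, abs_of_nonneg (by linarith [hs.2] : 0 ≤ 1 - s)]
    have h1 := (abs_add_le (ρ (x + h * s)) (ρ (x - h * s))).trans (add_le_add (hB _) (hB _))
    have h2 : 1 - s ≤ 1 := by linarith [hs.1]
    have := hQ x
    have h3 : 0 ≤ 1 - s := by linarith [hs.2]
    gcongr
  · intro x s hs hx
    have h1 : |h * s| ≤ h := by
      rw [abs_of_nonneg (mul_nonneg hh.le hs.1.le)]; exact mul_le_of_le_one_right hh.le hs.2
    have h2 := abs_sub_abs_le_abs_sub x (-(h * s))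
    have h3 := abs_sub_abs_le_abs_sub x (h * s)
    rw [abs_neg, sub_neg_eq_add] at h2
    rw [hA _ (by linarith), hA _ (by linarith)]
    ring
  · have h1 : Measurable fun z : ℝ × ℝ => ρ (z.1 + h * z.2) := hρm.comp (by fun_prop)
    have h2 : Measurable fun z : ℝ × ℝ => ρ (z.1 - h * z.2) := hρm.comp (by fun_prop)
    exact (hqm.comp measurable_fst).mul ((measurable_const.sub measurable_snd).mul (h1.add h2))

lemma exists_second_primitive {ρ : ℝ → ℝ} (hρ : ContDiff ℝ (⊤ : ℕ∞) ρ) :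
    ∃ R R₁ : ℝ → ℝ, ContDiff ℝ (⊤ : ℕ∞) R ∧ (∀ x, HasDerivAt R (R₁ x) x) ∧
      ∀ x, HasDerivAt R₁ (ρ x) x := by
  obtain ⟨R₁, h1⟩ := exists_primitive hρ.continuous
  have d1 : deriv R₁ = ρ := funext fun x => (h1 x).deriv
  have c1 : ContDiff ℝ (⊤ : ℕ∞) R₁ :=
    contDiff_infty_iff_deriv.2 ⟨fun x => (h1 x).differentiableAt, d1 ▸ hρ⟩
  obtain ⟨R, h0⟩ := exists_primitive c1.continuous
  have d0 : deriv R = R₁ := funext fun x => (h0 x).deriv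
  exact ⟨R, R₁, contDiff_infty_iff_deriv.2 ⟨fun x => (h0 x).differentiableAt, d0 ▸ c1⟩, h0, h1⟩

/-- Averaging a test function gives a test function whose second derivative is the discrete
Laplacian of the original one. -/
lemma avg_testFunction {ρ : ℝ → ℝ} (hρ : ContDiff ℝ (⊤ : ℕ∞) ρ) (hs : HasCompactSupport ρ)
    {h : ℝ} (hh : 0 < h) :
    ContDiff ℝ (⊤ : ℕ∞) (avg h ρ) ∧ HasCompactSupport (avg h ρ) ∧
      ∀ x, deriv (deriv (avg h ρ)) x = lap h ρ x := by
  obtain ⟨R, R₁, cR, h0, h1⟩ := exists_second_primitive hρ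
  have e : avg h ρ = lap h R := funext fun x => avg_eq_lap h0 h1 hρ.continuous hh x
  refine ⟨?_, ?_, fun x => ?_⟩
  · rw [e]; unfold lap
    have a1 : ContDiff ℝ (⊤ : ℕ∞) fun x => R (x + h) := cR.comp (contDiff_id.add contDiff_const)
    have a2 : ContDiff ℝ (⊤ : ℕ∞) fun x => R (x - h) := cR.comp (contDiff_id.sub contDiff_const)
    exact ((a1.sub (contDiff_const.mul cR)).add a2).div_const _
  · obtain ⟨A, B, -, -, hA, -⟩ := exists_support_bound hρ.continuous hs
    refine HasCompactSupport.intro (isCompact_Icc (a := -(A + h)) (b := A + h)) fun x hx => ?_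
    have hx : A + h < |x| := by
      by_contra hc; exact hx (abs_le.1 (not_lt.1 hc))
    have : ∀ ξ ∈ uIcc (0 : ℝ) 1, (1 - ξ) * (ρ (x + h * ξ) + ρ (x - h * ξ)) = 0 := by
      intro s hs
      rw [uIcc_of_le zero_le_one] at hs
      have h1 : |h * s| ≤ h := by
        rw [abs_of_nonneg (mul_nonneg hh.le hs.1)]; exact mul_le_of_le_one_right hh.le hs.2
      have h2 := abs_sub_abs_le_abs_sub x (-(h * s))
      have h3 := abs_sub_abs_le_abs_sub x (h * s)
      rw [abs_neg, sub_neg_eq_add] at h2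
      rw [hA _ (by linarith), hA _ (by linarith)]
      ring
    rw [avg, intervalIntegral.integral_congr this]; simp
  · have l0 : ∀ (F F₁ : ℝ → ℝ), (∀ x, HasDerivAt F (F₁ x) x) →
        ∀ x, HasDerivAt (lap h F) (lap h F₁ x) x := by
      intro F F₁ hF x
      exact ((((hF (x + h)).comp_add_const x h).sub ((hF x).const_mul 2)).add
        ((hF (x - h)).comp_sub_const x h)).div_const _
    have d1 : deriv (avg h ρ) = lap h R₁ := by
      rw [e]; exact funext fun x => (l0 R R₁ h0 x).deriv
    rw [d1, (l0 R₁ ρ h1 x).deriv]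

lemma continuous_avg {q : ℝ → ℝ} (hq : BddMeas q) (hc : ∀ x ≠ 0, ContinuousAt q x) {h : ℝ}
    (hh : 0 < h) : Continuous (avg h q) := by
  obtain ⟨B, hB⟩ := hq.2
  have hqm := hq.1
  refine continuous_iff_continuousAt.2 fun x => ?_
  refine intervalIntegral.continuousAt_of_dominated_interval (bound := fun _ => 1 * (B + B))
    (Eventually.of_forall fun y => ?_) (Eventually.of_forall fun y =>
      Eventually.of_forall fun ξ hξ => ?_) (by simp) ?_
  · have h1 : Measurable fun z : ℝ => q (y + h * z) := hqm.comp (by fun_prop)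
    have h2 : Measurable fun z : ℝ => q (y - h * z) := hqm.comp (by fun_prop)
    exact ((measurable_const.sub measurable_id).mul (h1.add h2)).aestronglyMeasurable
  · rw [uIoc_of_le zero_le_one] at hξ
    have h0 : 0 ≤ 1 - ξ := by linarith [hξ.2]
    rw [norm_mul, Real.norm_of_nonneg h0]
    have h1 := (abs_add_le (q (y + h * ξ)) (q (y - h * ξ))).trans (add_le_add (hB _) (hB _))
    have h2 : 1 - ξ ≤ 1 := by linarith [hξ.1]
    rw [Real.norm_eq_abs]
    gcongr
  · have n1 : ∀ᵐ ξ : ℝ, ξ ≠ -x / h := by simp [ae_iff]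
    have n2 : ∀ᵐ ξ : ℝ, ξ ≠ x / h := by simp [ae_iff]
    filter_upwards [n1, n2] with ξ h1 h2 _
    have c1 : ContinuousAt q (x + h * ξ) := hc _ fun h0 => h1 (by field_simp; linarith)
    have c2 : ContinuousAt q (x - h * ξ) := hc _ fun h0 => h2 (by field_simp; linarith)
    have t1 : ContinuousAt (fun y => q (y + h * ξ)) x :=
      ContinuousAt.comp (f := fun y => y + h * ξ) c1 (by fun_prop)
    have t2 : ContinuousAt (fun y => q (y - h * ξ)) x :=
      ContinuousAt.comp (f := fun y => y - h * ξ) c2 (by fun_prop)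
    exact continuousAt_const.mul (t1.add t2)

lemma continuous_integral_of_bdd {F : ℝ → ℝ → ℝ} (hF : Measurable (Function.uncurry F)) {B : ℝ}
    (hB : ∀ x s, |F x s| ≤ B) (hc : ∀ s, 0 < s → Continuous fun x => F x s) {t : ℝ}
    (ht : 0 ≤ t) : Continuous fun x => ∫ s in (0 : ℝ)..t, F x s := by
  refine intervalIntegral.continuous_of_dominated_interval (bound := fun _ => B)
    (fun x => (measurable_slice' hF x).aestronglyMeasurable)
    (fun x => Eventually.of_forall fun s _ => hB x s) (by simp)
    (Eventually.of_forall fun s hs => ?_)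
  rw [uIoc_of_le ht] at hs
  exact hc s hs.1

lemma measurable_lap {F : ℝ → ℝ → ℝ} (hF : Measurable (Function.uncurry F)) (h : ℝ) :
    Measurable fun z : ℝ × ℝ => lap h (fun y => F y z.2) z.1 := by
  have h1 : Measurable fun z : ℝ × ℝ => F (z.1 + h) z.2 :=
    hF.comp (f := fun z : ℝ × ℝ => (z.1 + h, z.2)) (by fun_prop)
  have h2 : Measurable fun z : ℝ × ℝ => F (z.1 - h) z.2 :=
    hF.comp (f := fun z : ℝ × ℝ => (z.1 - h, z.2)) (by fun_prop)
  have h3 : Measurable fun z : ℝ × ℝ => F z.1 z.2 := hF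
  unfold lap
  exact ((h1.sub (h3.const_mul 2)).add h2).div_const _

lemma abs_lap_le {q : ℝ → ℝ} {h B : ℝ} (hB : ∀ x, |q x| ≤ B) (x : ℝ) :
    |lap h q x| ≤ 4 * B / h ^ 2 := by
  rw [lap, abs_div, abs_of_nonneg (sq_nonneg h)]
  have h1 := abs_le.1 (hB (x + h))
  have h2 := abs_le.1 (hB x)
  have h3 := abs_le.1 (hB (x - h))
  gcongr
  rw [abs_le]; constructor <;> linarith

lemma continuous_lap {q : ℝ → ℝ} (hq : Continuous q) (h : ℝ) : Continuous (lap h q) := by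
  unfold lap; fun_prop

/-- Solutions tested against functions of the space variable only satisfy the integrated form
of the equation. -/
lemma sol_of_weak {Φ : ℝ → ℝ} {g : ℝ → ℝ → ℝ} {L T : ℝ} {U : ℝ → ℝ → ℝ} (hC : Coeffs Φ g L)
    (hcont : ContinuousOn (Function.uncurry U) (univ ×ˢ Ioi 0))
    (hmeas : Measurable (Function.uncurry U)) (hbdd : ∃ B, ∀ x, ∀ t ∈ Icc 0 T, |U x t| ≤ B)
    (hinit : ∀ x ≠ 0, ContinuousAt (fun y => U y 0) x)
    (hw : ∀ t ∈ Ioc 0 T, ∀ ψ : ℝ → ℝ, ContDiff ℝ (⊤ : ℕ∞) ψ → HasCompactSupport ψ →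
      ∫ x, U x t * ψ x = (∫ x, U x 0 * ψ x) + (∫ s in (0 : ℝ)..t, ∫ x, g x (U x s) * ψ x) +
        ∫ s in (0 : ℝ)..t, ∫ x, Φ (U x s) * deriv (deriv ψ) x) : Sol Φ g T U := by
  refine ⟨hcont, hmeas, hbdd, ?_, ?_⟩
  · have : ∀ᵐ x : ℝ, x ≠ 0 := by simp [ae_iff]
    filter_upwards [this] with x hx using hinit x hx
  obtain ⟨B, hB⟩ := hbdd
  have slice : ∀ s, 0 < s → Continuous fun x => U x s := fun s hs =>
    hcont.comp_continuous (f := fun x : ℝ => (x, s)) (by fun_prop) fun x => ⟨mem_univ _, hs⟩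
  have mΦ : Measurable (Function.uncurry fun y s => Φ (U y s)) :=
    hC.continuous.measurable.comp hmeas
  have mg : Measurable (Function.uncurry fun y s => g y (U y s)) :=
    hC.gcont.measurable.comp (measurable_fst.prodMk hmeas)
  have bΦ : ∀ s, BddMeas fun y => Φ (U y s) := fun s =>
    ⟨measurable_slice mΦ s, L, fun x => hC.bdd _⟩
  have bg : ∀ s, BddMeas fun y => g y (U y s) := fun s =>
    ⟨measurable_slice mg s, L, fun x => hC.gbdd _ _⟩
  intro h hh _ x t ht
  rcases ht.1.eq_or_lt with rfl | ht0
  · simp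
  have b0 : BddMeas fun y => U y 0 := ⟨measurable_slice hmeas 0, B, fun x => hB x 0 ⟨le_rfl, ht.1.trans ht.2⟩⟩
  have bt : BddMeas fun y => U y t := ⟨measurable_slice hmeas t, B, fun x => hB x t ht⟩
  have mK₁ : Measurable (Function.uncurry fun x s => lap h (fun y => Φ (U y s)) x) :=
    measurable_lap mΦ h
  have mK₂ : Measurable (Function.uncurry fun x s => avg h (fun y => g y (U y s)) x) :=
    measurable_avg mg h
  have bK₁ : ∀ x s, |lap h (fun y => Φ (U y s)) x| ≤ 4 * L / h ^ 2 := fun x s =>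
    abs_lap_le (fun y => hC.bdd _) x
  have bK₂ : ∀ x s, |avg h (fun y => g y (U y s)) x| ≤ L := fun x s =>
    abs_avg_le hh.le (bg s) (fun y => hC.gbdd _ _) x
  have bJ₁ := BddMeas.integral mK₁ bK₁ 0 t
  have bJ₂ := BddMeas.integral mK₂ bK₂ 0 t
  have cJ₁ := continuous_integral_of_bdd mK₁ bK₁
    (fun s hs => continuous_lap (hC.continuous.comp (slice s hs)) h) ht.1
  have cJ₂ := continuous_integral_of_bdd mK₂ bK₂
    (fun s hs => continuous_avg (bg s) (fun z _ => (hC.gcont.comp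
      (continuous_id.prodMk (slice s hs))).continuousAt) hh) ht.1
  have c0 := continuous_avg b0 hinit hh
  have ct := continuous_avg bt (fun z _ => (slice t ht0).continuousAt) hh
  have cD : Continuous fun x => avg h (fun y => U y t) x - avg h (fun y => U y 0) x -
      (∫ s in (0 : ℝ)..t, lap h (fun y => Φ (U y s)) x) -
      ∫ s in (0 : ℝ)..t, avg h (fun y => g y (U y s)) x := ((ct.sub c0).sub cJ₁).sub cJ₂
  have hz := ae_eq_zero_of_integral_contDiff_smul_eq_zero (μ := volume) cD.locallyIntegrable
    fun ρ hρ hs => by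
      have hρc := hρ.continuous
      obtain ⟨A, R, hA0, hR0, hA, hR⟩ := exists_support_bound hρc hs
      obtain ⟨a1, a2, a3⟩ := avg_testFunction hρ hs hh
      have key := hw t ⟨ht0, ht.2⟩ _ a1 a2
      simp only [a3] at key
      rw [integral_mul_avg bt hρc hs hh, integral_mul_avg b0 hρc hs hh] at key
      simp only [integral_mul_avg (bg _) hρc hs hh, integral_mul_lap (bΦ _) hρc hs] at key
      have s1 := integral_swap_of_bdd (F := fun x s => lap h (fun y => Φ (U y s)) x * ρ x)
        (mK₁.mul (hρc.measurable.comp measurable_fst)) (A := A) (B := 4 * L / h ^ 2 * R) ht.1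
        (fun x s _ => by
          rw [abs_mul]
          exact mul_le_mul (bK₁ x s) (hR x) (abs_nonneg _) ((abs_nonneg _).trans (bK₁ x s)))
        (fun x s _ hx => by rw [hA x hx, mul_zero])
      have s2 := integral_swap_of_bdd (F := fun x s => avg h (fun y => g y (U y s)) x * ρ x)
        (mK₂.mul (hρc.measurable.comp measurable_fst)) (A := A) (B := L * R) ht.1
        (fun x s _ => by
          rw [abs_mul]
          exact mul_le_mul (bK₂ x s) (hR x) (abs_nonneg _) ((abs_nonneg _).trans (bK₂ x s)))
        (fun x s _ hx => by rw [hA x hx, mul_zero])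
      simp only [intervalIntegral.integral_mul_const] at s1 s2
      rw [← s1, ← s2] at key
      have i0 := (b0.avg hh.le).integrable_mul hρc hs
      have i1 := (bt.avg hh.le).integrable_mul hρc hs
      have i2 := bJ₁.integrable_mul hρc hs
      have i3 := bJ₂.integrable_mul hρc hs
      simp only [smul_eq_mul, mul_comm (ρ _), sub_mul]
      have j1 := i1.sub i0
      have j2 := j1.sub i2
      simp only [Pi.sub_def] at j1 j2
      rw [integral_sub j2 i3, integral_sub j1 i2, integral_sub i1 i0, key]
      ring
  have hD := (Continuous.ae_eq_iff_eq volume cD continuous_const).1 hz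
  have hDx := congrFun hD x
  rw [intervalIntegral.integral_add
    (intervalIntegrable_of_bdd ⟨measurable_slice' mK₁ x, _, bK₁ x⟩ 0 t)
    (intervalIntegrable_of_bdd ⟨measurable_slice' mK₂ x, _, bK₂ x⟩ 0 t)]
  linarith only [hDx]

/-- Extension of a function on positive times by its initial data. -/
def extend (u₀ : ℝ → ℝ) (u : ℝ → ℝ → ℝ) (x t : ℝ) : ℝ := if t ≤ 0 then u₀ x else u x t

lemma extend_pos {u₀ : ℝ → ℝ} {u : ℝ → ℝ → ℝ} {t : ℝ} (ht : 0 < t) (x : ℝ) :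
    extend u₀ u x t = u x t := if_neg (not_le.2 ht)

lemma extend_zero (u₀ : ℝ → ℝ) (u : ℝ → ℝ → ℝ) (x : ℝ) : extend u₀ u x 0 = u₀ x := if_pos le_rfl

lemma measurable_extend {u₀ : ℝ → ℝ} {u : ℝ → ℝ → ℝ} (h₀ : Measurable u₀)
    (hu : ContinuousOn (Function.uncurry u) (univ ×ˢ Ioi 0)) :
    Measurable (Function.uncurry (extend u₀ u)) := by
  refine measurable_of_restrict_of_restrict_compl (s := univ ×ˢ Ioi (0 : ℝ))
    (MeasurableSet.univ.prod measurableSet_Ioi) ?_ ?_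
  · have := hu.domRestrict.measurable
    convert this using 1
    ext ⟨⟨x, t⟩, hz⟩
    exact extend_pos hz.2 x
  · have : Measurable (((univ ×ˢ Ioi (0 : ℝ))ᶜ : Set (ℝ × ℝ)).domRestrict fun z => u₀ z.1) :=
      (h₀.comp measurable_fst).comp measurable_subtype_coe
    convert this using 1
    ext ⟨⟨x, t⟩, hz⟩
    have : ¬ 0 < t := fun h => hz ⟨mem_univ _, h⟩
    exact if_pos (not_lt.1 this)

/-- Testing with functions of the space variable only. -/
lemma VeryWeakSol.integral_eq {m : ℝ} {f : ℝ → ℝ → ℝ} {κ : ℝ → ℝ} {t : ℝ} {u₀ : ℝ → ℝ}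
    {u : ℝ → ℝ → ℝ} (hu : VeryWeakSol m f κ t u₀ u) (ht : 0 < t) {ψ : ℝ → ℝ}
    (hψ : ContDiff ℝ (⊤ : ℕ∞) ψ) (hs : HasCompactSupport ψ) :
    ∫ x, u x t * ψ x = (∫ x, u₀ x * ψ x) +
      (∫ s in (0 : ℝ)..t, ∫ x, f x (u x s) * (κ x - u x s) * ψ x) +
      ∫ s in (0 : ℝ)..t, ∫ x, u x s ^ m * deriv (deriv ψ) x := by
  let χ : ContDiffBump (t / 2) := ⟨t, 2 * t, ht, by linarith⟩
  have ball : ∀ s ∈ Icc 0 t, s ∈ Metric.ball (t / 2) t := by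
    intro s hs
    rw [Metric.mem_ball, Real.dist_eq, abs_lt]
    constructor <;> linarith [hs.1, hs.2]
  have one : ∀ s ∈ Icc 0 t, χ s = 1 := fun s hs =>
    χ.one_of_mem_closedBall (Metric.ball_subset_closedBall (ball s hs))
  have h1 : ContDiff ℝ (⊤ : ℕ∞) (Function.uncurry fun x s => χ s * ψ x) :=
    (χ.contDiff.comp contDiff_snd).mul (hψ.comp contDiff_fst)
  have h2 : HasCompactSupport (Function.uncurry fun x s => χ s * ψ x) := by
    refine HasCompactSupport.intro (hs.isCompact.prod χ.hasCompactSupport.isCompact) ?_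
    rintro ⟨x, s⟩ hz
    rw [mem_prod, not_and_or] at hz
    show χ s * ψ x = 0
    rcases hz with hz | hz
    · rw [image_eq_zero_of_notMem_tsupport hz, mul_zero]
    · rw [image_eq_zero_of_notMem_tsupport hz, zero_mul]
  have key := hu.2.2 _ h1 h2
  simp only [one t ⟨ht.le, le_rfl⟩, one 0 ⟨le_rfl, ht.le⟩, one_mul] at key
  rw [key, intervalIntegral.integral_of_le ht.le, intervalIntegral.integral_of_le ht.le,
    integral_Ioc_eq_integral_Ioo, integral_Ioc_eq_integral_Ioo]
  congr 1
  · congr 1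
    refine setIntegral_congr_fun measurableSet_Ioo fun s hs => ?_
    simp only [one s ⟨hs.1.le, hs.2.le⟩, one_mul]
  · refine setIntegral_congr_fun measurableSet_Ioo fun s hs => ?_
    have hd : ∀ x, deriv (fun s => χ s * ψ x) s = 0 := by
      intro x
      have : (fun s => χ s * ψ x) =ᶠ[nhds s] fun _ => ψ x := by
        filter_upwards [χ.eventuallyEq_one_of_mem_ball (ball s ⟨hs.1.le, hs.2.le⟩)] with r hr
        rw [hr]; simp
      rw [this.deriv_eq]; simp
    simp only [hd, one s ⟨hs.1.le, hs.2.le⟩, one_mul, mul_zero, zero_add]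

lemma GlobalVeryWeakSol.continuousOn {m : ℝ} {f : ℝ → ℝ → ℝ} {κ : ℝ → ℝ} {u₀ : ℝ → ℝ}
    {u : ℝ → ℝ → ℝ} (hu : GlobalVeryWeakSol m f κ u₀ u) :
    ContinuousOn (Function.uncurry u) (univ ×ˢ Ioi 0) := by
  rintro ⟨x, t⟩ ⟨-, ht⟩
  have ht : 0 < t := ht
  refine ((hu (t + 1) (by linarith)).1.continuousAt ?_).continuousWithinAt
  exact prod_mem_nhds univ_mem (Ioc_mem_nhds ht (by linarith))

/-- Very weak solutions satisfy the integrated form of the truncated equation. -/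
lemma GlobalVeryWeakSol.sol {m : ℝ} (hm : 1 < m) {f : ℝ → ℝ → ℝ} {κ : ℝ → ℝ} {θ M T : ℝ}
    {u₀ : ℝ → ℝ} {u : ℝ → ℝ → ℝ} (hu : GlobalVeryWeakSol m f κ u₀ u) (hF : CondF1 f κ θ)
    (hM : ∀ x, κ x ≤ M) (h₀ : Measurable u₀) (h₀c : ∀ x ≠ 0, ContinuousAt u₀ x)
    (h₀M : ∀ x, u₀ x ∈ Icc 0 M) (huM : ∀ x, ∀ t ∈ Ioc 0 T, u x t ∈ Icc 0 M) :
    Sol (powTrunc m M) (reactTrunc f κ M) T (extend u₀ u) := by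
  obtain ⟨L, hL⟩ := exists_powCoeffs hm hF hM
  refine sol_of_weak hL.toCoeffs ?_ (measurable_extend h₀ hu.continuousOn) ⟨M, fun x t ht => ?_⟩
    ?_ fun t ht ψ hψ hs => ?_
  · exact hu.continuousOn.congr fun z hz => extend_pos hz.2 z.1
  · rcases ht.1.eq_or_lt with rfl | h
    · rw [extend_zero, abs_of_nonneg (h₀M x).1]; exact (h₀M x).2
    · rw [extend_pos h, abs_of_nonneg (huM x t ⟨h, ht.2⟩).1]; exact (huM x t ⟨h, ht.2⟩).2
  · simpa only [extend_zero] using h₀c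
  · have key := (hu t ht.1).integral_eq ht.1 hψ hs
    simp only [extend_zero, extend_pos ht.1]
    rw [key]
    congr 1
    · congr 1
      refine intervalIntegral.integral_congr_ae (Eventually.of_forall fun s hs => ?_)
      rw [uIoc_of_le ht.1.le] at hs
      simp only [extend_pos hs.1, reactTrunc, clamp_of_mem (huM _ s ⟨hs.1, hs.2.trans ht.2⟩)]
    · refine intervalIntegral.integral_congr_ae (Eventually.of_forall fun s hs => ?_)
      rw [uIoc_of_le ht.1.le] at hs
      simp only [extend_pos hs.1, powTrunc, clamp_of_mem (huM _ s ⟨hs.1, hs.2.trans ht.2⟩)]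

/-- Stationary solutions satisfy the integrated form of the truncated equation. -/
lemma sol_stationary {m : ℝ} {f : ℝ → ℝ → ℝ} {κ : ℝ → ℝ} {M : ℝ} {p : ℝ → ℝ}
    (hp : ContDiff ℝ 2 p) (hp0 : ∀ x, 0 < p x)
    (hpM : ∀ x, p x ≤ M)
    (hst : ∀ x, deriv (deriv (fun y => p y ^ m)) x + f x (p x) * (κ x - p x) = 0) (T : ℝ) :
    Sol (powTrunc m M) (reactTrunc f κ M) T fun x _ => p x := by
  have hmem : ∀ x, p x ∈ Icc 0 M := fun x => ⟨(hp0 x).le, hpM x⟩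
  refine ⟨(hp.continuous.comp continuous_fst).continuousOn,
    hp.continuous.measurable.comp measurable_fst, ⟨M, fun x t _ => ?_⟩,
    Eventually.of_forall fun x => hp.continuous.continuousAt, fun h hh _ x t _ => ?_⟩
  · rw [abs_of_pos (hp0 x)]; exact hpM x
  · have hF2 : ContDiff ℝ 2 fun y => p y ^ m := hp.rpow_const_of_ne fun x => (hp0 x).ne'
    have hF1 : ContDiff ℝ 1 (deriv fun y => p y ^ m) := ContDiff.deriv' hF2
    have e := avg_eq_lap (h := h) (fun x => ((hF2.differentiable two_ne_zero) x).hasDerivAt)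
      (fun x => ((hF1.differentiable one_ne_zero) x).hasDerivAt)
      (hF1.continuous_deriv le_rfl) hh x
    have e2 : (fun y => reactTrunc f κ M y (p y)) =
        fun y => (-1) * deriv (deriv (fun y => p y ^ m)) y := by
      ext y
      rw [reactTrunc, clamp_of_mem (hmem y)]
      linarith [hst y]
    have e3 : (fun y => powTrunc m M (p y)) = fun y => p y ^ m := by
      ext y
      rw [powTrunc, clamp_of_mem (hmem y)]
    simp only [e2, e3, avg_const_mul]
    change avg h (fun y => deriv (deriv fun y => p y ^ m) y) x = _ at e
    rw [e]; simp

section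
variable {Φ : ℝ → ℝ} {g : ℝ → ℝ → ℝ} {L T : ℝ} {U : ℝ → ℝ → ℝ}

/-- Restarting a solution at a positive time. -/
lemma Sol.restart (hC : Coeffs Φ g L) {s : ℝ} (hs : 0 < s) (hT : 0 ≤ T)
    (hU : Sol Φ g (T + s) U) : Sol Φ g T fun x t => U x (t + s) where
  cont := hU.cont.comp (f := fun z : ℝ × ℝ => (z.1, z.2 + s)) (by fun_prop) fun z hz =>
    ⟨mem_univ _, add_pos hz.2 hs⟩
  meas := hU.meas.comp (f := fun z : ℝ × ℝ => (z.1, z.2 + s)) (by fun_prop)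
  bdd := hU.bdd.imp fun _ hB x t ht => hB x _ ⟨by linarith [ht.1], by linarith [ht.2]⟩
  init := Eventually.of_forall fun x => by
    simpa using (hU.continuous_slice hs).continuousAt
  eqn := fun h hh h1 x t ht => by
    have e1 := hU.eqn h hh h1 x (t + s) ⟨by linarith [ht.1], by linarith [ht.2]⟩
    have e2 := hU.eqn h hh h1 x s ⟨hs.le, by linarith⟩
    have mΦ : Measurable (Function.uncurry fun y s => Φ (U y s)) :=
      hC.continuous.measurable.comp hU.meas
    have mg : Measurable (Function.uncurry fun y s => g y (U y s)) :=
      hC.gcont.measurable.comp (measurable_fst.prodMk hU.meas)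
    have bm : BddMeas fun s => lap h (fun y => Φ (U y s)) x + avg h (fun y => g y (U y s)) x :=
      BddMeas.add ⟨measurable_slice' (U := fun x s => lap h (fun y => Φ (U y s)) x)
        (measurable_lap mΦ h) x, _, fun s => abs_lap_le (fun y => hC.bdd _) x⟩
        ⟨measurable_slice' (U := fun x s => avg h (fun y => g y (U y s)) x)
        (measurable_avg mg h) x, _, fun s => abs_avg_le hh.le
          ⟨measurable_slice mg s, L, fun x => hC.gbdd _ _⟩ (fun y => hC.gbdd _ _) x⟩
    have e3 := intervalIntegral.integral_add_adjacent_intervals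
      (intervalIntegrable_of_bdd bm 0 s) (intervalIntegrable_of_bdd bm s (t + s))
    have e4 := intervalIntegral.integral_comp_add_right (a := 0) (b := t)
      (fun s => lap h (fun y => Φ (U y s)) x + avg h (fun y => g y (U y s)) x) s
    simp only [zero_add] at e4 ⊢
    linarith only [e1, e2, e3, e4]

lemma avg_translate (h : ℝ) (q : ℝ → ℝ) (c x : ℝ) :
    avg h (fun y => q (y - c)) x = avg h q (x - c) := by
  unfold avg
  congr 1; ext ξ
  beta_reduce
  rw [show x + h * ξ - c = x - c + h * ξ by ring, show x - h * ξ - c = x - c - h * ξ by ring]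

lemma lap_translate (h : ℝ) (q : ℝ → ℝ) (c x : ℝ) :
    lap h (fun y => q (y - c)) x = lap h q (x - c) := by
  unfold lap
  beta_reduce
  rw [show x + h - c = x - c + h by ring, show x - h - c = x - c - h by ring]

/-- Translating a solution by a period of the reaction term. -/
lemma Sol.translate {c : ℝ} (hg : ∀ x a, g (x - c) a = g x a) (hU : Sol Φ g T U) :
    Sol Φ g T fun x t => U (x - c) t where
  cont := hU.cont.comp (f := fun z : ℝ × ℝ => (z.1 - c, z.2)) (by fun_prop) fun z hz =>
    ⟨mem_univ _, hz.2⟩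
  meas := hU.meas.comp (f := fun z : ℝ × ℝ => (z.1 - c, z.2)) (by fun_prop)
  bdd := hU.bdd.imp fun _ hB x t ht => hB _ t ht
  init := by
    have := (measurePreserving_sub_right volume c).quasiMeasurePreserving.ae hU.init
    filter_upwards [this] with x hx
    exact ContinuousAt.comp (f := fun y => y - c) hx (by fun_prop)
  eqn := fun h hh h1 x t ht => by
    have e := hU.eqn h hh h1 (x - c) t ht
    have e2 : ∀ s, avg h (fun y => g y (U (y - c) s)) x =
        avg h (fun y => g y (U y s)) (x - c) := by
      intro s
      rw [← avg_translate h (fun y => g y (U y s))]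
      simp only [hg]
    have e3 : ∀ s, lap h (fun y => Φ (U (y - c) s)) x = lap h (fun y => Φ (U y s)) (x - c) :=
      fun s => lap_translate h (fun y => Φ (U y s)) c x
    have e4 : ∀ s, avg h (fun y => U (y - c) s) x = avg h (fun y => U y s) (x - c) :=
      fun s => avg_translate h (fun y => U y s) c x
    simp only [e2, e3, e4]
    exact e

end

lemma exists_bound_of_periodic {q : ℝ → ℝ} (hq : Continuous q) (hp : ∀ x, q (x + 1) = q x) :
    ∃ B, ∀ x, q x ≤ B := by
  obtain ⟨B, hB⟩ := isCompact_Icc (a := (0 : ℝ)) (b := 1) |>.exists_bound_of_continuousOn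
    hq.continuousOn
  refine ⟨B, fun x => ?_⟩
  have : Function.Periodic q 1 := hp
  have h2 := this.sub_int_mul_eq ⌊x⌋ (x := x)
  rw [mul_one] at h2
  rw [← h2]
  exact (le_abs_self _).trans (hB _ ⟨Int.fract_nonneg x, (Int.fract_lt_one x).le⟩)

/-- The consequences of the comparison principles used to control the pressure. -/
structure FrontFacts (m : ℝ) (u : ℝ → ℝ → ℝ) (b ty : ℝ → ℝ) : Prop where
  cont : ContinuousOn (Function.uncurry u) (univ ×ˢ Ioi 0)
  pos : ∀ t > 0, ∀ x < b t, 0 < u x t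
  zero : ∀ t > 0, ∀ x, b t ≤ x → u x t = 0
  mono : StrictMonoOn b (Ioi 0)
  bdiff : ∀ t > 0, DifferentiableAt ℝ b t
  udiff : ∀ x t, 0 < t → 0 < u x t → DifferentiableAt ℝ (fun y => u y t) x
  darcy : ∀ t > 0, deriv b t = -(pressureDx m u (b t) t)
  crossing : ∀ y > 0, 0 < ty y ∧ b (ty y) = y
  order : ∀ s > 0, ∀ T > 0, ∀ n : ℕ, ∀ x y, x < y →
    u x (T + s) ≤ u (x - n) T ∨ u (y - n) T ≤ u y (T + s)
  lip : ∀ t₀ > 0, ∃ D, 0 ≤ D ∧ ∀ t ≥ t₀, ∀ x y, x ≤ y →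
    prs m (u x t) - prs m (u y t) ≤ D * (y - x)

lemma RenormSetting.frontFacts {m : ℝ} (hm : 1 < m) {f : ℝ → ℝ → ℝ} {κ : ℝ → ℝ}
    {θ c₀ l₀ : ℝ} {φ₀ p : ℝ → ℝ} {u : ℝ → ℝ → ℝ} {b ty : ℝ → ℝ}
    (hset : RenormSetting m f κ θ c₀ l₀ φ₀ p u b ty) : FrontFacts m u b ty := by
  obtain ⟨hF, -, hp, hp0, hp1, hst, -, -, hu, hbd, -, hub, hbm, -, hud, hdarcy, hty⟩ := hset
  have hunn : ∀ x, ∀ t > 0, 0 ≤ u x t := by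
    intro x t ht
    rcases lt_or_ge x (b t) with h | h
    · exact ((hub t ht x).1 h).le
    · exact ((hub t ht x).2 h).ge
  obtain ⟨P, hP⟩ := exists_bound_of_periodic hp.continuous hp1
  obtain ⟨K, hK⟩ := exists_bound_of_periodic hF.2.1.continuous hF.2.2.2.1
  set u₀ : ℝ → ℝ := fun x => if x ≤ 0 then p x else 0 with hu₀
  have m₀ : Measurable u₀ :=
    Measurable.ite measurableSet_Iic hp.continuous.measurable measurable_const
  have c₀ : ∀ x ≠ 0, ContinuousAt u₀ x := by
    intro x hx
    rcases hx.lt_or_gt with h | h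
    · refine hp.continuous.continuousAt.congr ?_
      filter_upwards [Iio_mem_nhds h] with y hy
      exact (if_pos (le_of_lt hy)).symm
    · refine (continuousAt_const (y := (0 : ℝ))).congr ?_
      filter_upwards [Ioi_mem_nhds h] with y hy
      exact (if_neg (not_le.2 hy)).symm
  have u₀p : ∀ x, 0 ≤ u₀ x ∧ u₀ x ≤ p x := by
    intro x
    simp only [hu₀]
    split_ifs
    · exact ⟨(hp0 x).le, le_rfl⟩
    · exact ⟨le_rfl, (hp0 x).le⟩
  have hup : ∀ x, ∀ t > 0, u x t ≤ p x := by
    intro x T hT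
    obtain ⟨B, hB⟩ := (hu T hT).2.1
    obtain ⟨M, hM⟩ : ∃ M, M = max (max P K) B := ⟨_, rfl⟩
    have hPM : P ≤ M := hM ▸ (le_max_left _ _).trans (le_max_left _ _)
    have hKM : K ≤ M := hM ▸ (le_max_right _ _).trans (le_max_left _ _)
    have hBM : B ≤ M := hM ▸ le_max_right _ _
    obtain ⟨L, hL⟩ := exists_powCoeffs hm hF fun x => (hK x).trans hKM
    have s1 := hu.sol hm (T := T) hF (fun x => (hK x).trans hKM) m₀ c₀
      (fun x => ⟨(u₀p x).1, (u₀p x).2.trans ((hP x).trans hPM)⟩)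
      (fun x t ht => ⟨hunn x t ht.1, (le_abs_self _).trans ((hB x t ht).trans hBM)⟩)
    have s2 := sol_stationary (m := m) (f := f) (κ := κ) (M := M) hp hp0
      (fun x => (hP x).trans hPM) hst T
    have := Sol.le hL.toCoeffs hT s1 s2 (fun x => by rw [extend_zero]; exact (u₀p x).2) x
    rwa [extend_pos hT] at this
  obtain ⟨M, hM⟩ : ∃ M, M = max P K + 1 := ⟨_, rfl⟩
  have hPM : P ≤ M - 1 := by rw [hM]; linarith [le_max_left P K]
  have hKM : K ≤ M := by rw [hM]; linarith [le_max_right P K]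
  have hM1 : 1 ≤ M := by linarith [hP 0, hp0 0]
  obtain ⟨L, hL⟩ := exists_powCoeffs hm hF fun x => (hK x).trans hKM
  have hsol : ∀ T, Sol (powTrunc m M) (reactTrunc f κ M) T (extend u₀ u) := fun T =>
    hu.sol hm hF (fun x => (hK x).trans hKM) m₀ c₀
      (fun x => ⟨(u₀p x).1, (u₀p x).2.trans ((hP x).trans (by linarith))⟩)
      (fun x t ht => ⟨hunn x t ht.1, (hup x t ht.1).trans ((hP x).trans (by linarith))⟩)
  refine ⟨hu.continuousOn, fun t ht x hx => (hub t ht x).1 hx, fun t ht x hx => (hub t ht x).2 hx,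
    hbm, hbd, fun x t ht hx => (hud x t ht hx).2.1, fun t ht => (hdarcy t ht).1, hty, ?_, ?_⟩
  · intro s hs T hT n x y hxy
    have hg : ∀ x a, reactTrunc f κ M (x - n) a = reactTrunc f κ M x a := by
      intro x a
      have p1 : Function.Periodic (fun x => reactTrunc f κ M x a) 1 := fun x => by
        simp only [reactTrunc, hF.2.2.1, hF.2.2.2.1]
      simpa using p1.sub_nat_mul_eq n (x := x)
    have hpn : ∀ x, p (x - n) = p x := by
      intro x
      have p1 : Function.Periodic p 1 := hp1
      simpa using p1.sub_nat_mul_eq n (x := x)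
    have key := Sol.pattern hL.toCoeffs hT ((hsol (T + s)).restart hL.toCoeffs hs hT.le)
      ((hsol T).translate hg) (fun x y hxy => by
        simp only [zero_add, extend_pos hs, extend_zero]
        rcases le_or_gt (x - n) 0 with h | h
        · left
          rw [show u₀ (x - n) = p (x - n) from if_pos h, hpn]
          exact hup x s hs
        · right
          rw [show u₀ (y - n) = 0 from if_neg (by linarith)]
          exact hunn y s hs) hxy
    simpa only [extend_pos hT, extend_pos (add_pos hT hs)] using key
  · intro t₀ ht₀
    obtain ⟨T₀, hT₀, hlip⟩ := exists_pressure_lipschitz hm hL hM1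
    obtain ⟨T, hT⟩ : ∃ T, T = min T₀ (t₀ / 2) := ⟨_, rfl⟩
    have hT0 : 0 < T := by rw [hT]; exact lt_min hT₀ (by linarith)
    have hTt : T ≤ t₀ / 2 := hT ▸ min_le_right _ _
    obtain ⟨D, hD0, hD⟩ := hlip T ⟨hT0, hT ▸ min_le_left _ _⟩
    refine ⟨D, hD0, fun t ht x y hxy => ?_⟩
    have hs : 0 < t - T := by linarith
    have key := hD _ ((hsol (T + (t - T))).restart hL.toCoeffs hs hT0.le) ?_ ?_ x y hxy
    · simpa only [add_sub_cancel, extend_pos (hs.trans (by linarith : t - T < t))] using key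
    · simpa only [zero_add] using (hsol (t - T)).continuous_slice hs
    · intro x
      simp only [zero_add, extend_pos hs]
      exact ⟨hunn x _ hs, (hup x _ hs).trans ((hP x).trans hPM)⟩

lemma neg_le_derivWithin_Iic {v : ℝ → ℝ} {C y δ : ℝ} (hC : 0 ≤ C) (hδ : 0 < δ)
    (h : ∀ z ∈ Ioo (y - δ) y, v z - v y ≤ C * (y - z)) : -C ≤ derivWithin v (Iic y) y := by
  by_cases hd : DifferentiableWithinAt ℝ v (Iic y) y
  · have h1 := hasDerivWithinAt_iff_tendsto_slope.1 hd.hasDerivWithinAt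
    rw [Iic_sdiff_right] at h1
    refine ge_of_tendsto h1 ?_
    filter_upwards [Ioo_mem_nhdsLT (by linarith : y - δ < y)] with z hz
    rw [slope_def_field, le_div_iff_of_neg (by linarith [hz.2])]
    linarith [h z hz]
  · rw [derivWithin_zero_of_not_differentiableWithinAt hd]; linarith

lemma exists_sign_change {d : ℝ → ℝ} {d' x : ℝ} (hd : HasDerivAt d d' x) (hd' : d' < 0)
    (h0 : d x = 0) : (∃ z < x, 0 < d z) ∧ ∃ z > x, d z < 0 := by
  have h1 : ∀ᶠ z in nhdsWithin x {x}ᶜ, slope d x z < 0 :=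
    (hasDerivAt_iff_tendsto_slope.1 hd).eventually_lt_const hd'
  have hl : ∀ᶠ z in nhdsWithin x (Iio x), slope d x z < 0 :=
    h1.filter_mono (nhdsWithin_mono _ fun z (hz : z < x) => hz.ne)
  have hr : ∀ᶠ z in nhdsWithin x (Ioi x), slope d x z < 0 :=
    h1.filter_mono (nhdsWithin_mono _ fun z (hz : x < z) => hz.ne')
  obtain ⟨z, hz, hzx⟩ := (hl.and self_mem_nhdsWithin).exists
  obtain ⟨w, hw, hwx⟩ := (hr.and self_mem_nhdsWithin).exists
  have hzx : z < x := hzx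
  have hwx : x < w := hwx
  rw [slope_def_field, h0, sub_zero] at hz hw
  constructor
  · refine ⟨z, hzx, ?_⟩
    by_contra hc
    exact absurd hz (not_lt.2 (div_nonneg_of_nonpos (not_lt.1 hc) (by linarith)))
  · refine ⟨w, hwx, ?_⟩
    by_contra hc
    exact absurd hw (not_lt.2 (div_nonneg (not_lt.1 hc) (by linarith)))

section

variable {m : ℝ} {u : ℝ → ℝ → ℝ} {b ty : ℝ → ℝ}

lemma FrontFacts.nonneg (hu : FrontFacts m u b ty) {t : ℝ} (ht : 0 < t) (x : ℝ) : 0 ≤ u x t := by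
  rcases lt_or_ge x (b t) with h | h
  · exact (hu.pos t ht x h).le
  · exact (hu.zero t ht x h).ge

lemma FrontFacts.crossing_lt_iff (hu : FrontFacts m u b ty) {y z : ℝ} (hy : 0 < y) (hz : 0 < z) :
    ty y < ty z ↔ y < z := by
  rw [← hu.mono.lt_iff_lt (hu.crossing y hy).1 (hu.crossing z hz).1, (hu.crossing y hy).2,
    (hu.crossing z hz).2]

lemma FrontFacts.crossing_le_iff (hu : FrontFacts m u b ty) {y z : ℝ} (hy : 0 < y) (hz : 0 < z) :
    ty y ≤ ty z ↔ y ≤ z := by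
  rw [← not_lt, hu.crossing_lt_iff hz hy, not_lt]

lemma FrontFacts.hasDerivAt_prs (hm : 1 < m) (hu : FrontFacts m u b ty) {x t : ℝ} (ht : 0 < t)
    (hx : 0 < u x t) : HasDerivAt (fun y => prs m (u y t)) (pressureDx m u x t) x := by
  have h1 : DifferentiableAt ℝ (fun y => prs m (u y t)) x :=
    (_root_.hasDerivAt_prs hm hx).differentiableAt.comp (f := fun y => u y t) x (hu.udiff x t ht hx)
  have h2 : pressureDx m u x t = deriv (fun y => prs m (u y t)) x :=
    h1.derivWithin (uniqueDiffOn_Iic x x self_mem_Iic)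
  rw [h2]
  exact h1.hasDerivAt

lemma FrontFacts.continuous_pressure (hm : 1 < m) (hu : FrontFacts m u b ty) {t : ℝ}
    (ht : 0 < t) : Continuous fun y => prs m (u y t) :=
  (continuous_prs hm).comp (hu.cont.comp_continuous (f := fun x : ℝ => (x, t)) (by fun_prop)
    fun _ => ⟨mem_univ _, ht⟩)

lemma FrontFacts.continuousOn_time (hu : FrontFacts m u b ty) (x : ℝ) :
    ContinuousOn (fun t => u x t) (Ioi 0) :=
  hu.cont.comp (f := fun t : ℝ => (x, t)) (by fun_prop) fun _ ht => ⟨mem_univ _, ht⟩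

/-- The pressure gradients are bounded below for times bounded away from zero. -/
lemma FrontFacts.exists_pressureDx_bound (hu : FrontFacts m u b ty) {t₀ : ℝ} (ht₀ : 0 < t₀) :
    ∃ D, ∀ z, ∀ t ≥ t₀, -D ≤ pressureDx m u z t := by
  obtain ⟨D, hD0, hD⟩ := hu.lip t₀ ht₀
  exact ⟨D, fun z t ht => neg_le_derivWithin_Iic hD0 one_pos fun w hw => hD t ht w z hw.2.le⟩

/-- Among shifted solutions sharing a positive value, the later one is flatter. -/
lemma FrontFacts.pressureDx_le (hm : 1 < m) (hu : FrontFacts m u b ty) {t s x : ℝ} {n : ℕ}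
    (ht : 0 < t) (hts : t < s) (hx : 0 < u x s) (he : u (x - n) t = u x s) :
    pressureDx m u (x - n) t ≤ pressureDx m u x s := by
  by_contra! hc
  have hs := ht.trans hts
  have d1 := hu.hasDerivAt_prs hm hs hx
  have d2 := (hu.hasDerivAt_prs hm ht (he ▸ hx)).comp_sub_const x n
  obtain ⟨⟨z, hz, hz'⟩, w, hw, hw'⟩ := exists_sign_change (d1.sub d2) (by linarith)
    (by simp [he])
  simp only [Pi.sub_apply] at hz' hw'
  have := hu.order (s - t) (by linarith) t ht n z w (hz.trans hw)
  rw [add_sub_cancel] at this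
  rcases this with h | h
  · linarith [prs_le hm (hu.nonneg hs z) h]
  · linarith [prs_le hm (hu.nonneg ht _) h]

/-- The solution at the crossing time of `y` lies below the translate of the solution at the
crossing time of `y - n`. -/
lemma FrontFacts.le_translate (hu : FrontFacts m u b ty) {y : ℝ} {n : ℕ} (hn : 0 < n)
    (hy : 0 < y - n) {x : ℝ} (hx : x < y) : u x (ty y) ≤ u (x - n) (ty (y - n)) := by
  have hn' : (0 : ℝ) < n := by exact_mod_cast hn
  have hy0 : 0 < y := by linarith
  have hlt := (hu.crossing_lt_iff hy hy0).2 (by linarith)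
  obtain ⟨c0, c1⟩ := hu.crossing _ hy
  obtain ⟨e0, e1⟩ := hu.crossing _ hy0
  have hc : ContinuousAt (fun t => u (x - n) t) (ty (y - n)) :=
    (hu.continuousOn_time _).continuousAt (Ioi_mem_nhds c0)
  have hc' : Tendsto (fun t => u (x - n) t) (nhdsWithin (ty (y - n)) (Ioi (ty (y - n))))
      (nhds (u (x - n) (ty (y - n)))) := hc.tendsto.mono_left nhdsWithin_le_nhds
  refine ge_of_tendsto hc' ?_
  filter_upwards [Ioo_mem_nhdsGT hlt] with r hr
  have hr0 := c0.trans hr.1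
  have := hu.order (ty y - r) (by linarith [hr.2]) r hr0 n x y hx
  rw [add_sub_cancel] at this
  refine this.resolve_right fun h => ?_
  rw [hu.zero _ e0 y e1.le] at h
  have h2 := hu.mono c0 hr0 hr.1
  rw [c1] at h2
  linarith [hu.pos r hr0 _ h2]

lemma FrontFacts.pressure_gradient (hm : 1 < m) (hu : FrontFacts m u b ty) {C₁ : ℝ}
    (hC : C₁ = -sInf (Set.image2 (fun z t => pressureDx m u z t)
        (Icc (1 : ℝ) 3) (Icc (ty 1) (ty 3)))) :
    0 < C₁ ∧
      (∀ y > (3 : ℝ), ∀ x ∈ Icc (y - 1) y, -C₁ ≤ pressureDx m u x (ty y)) ∧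
      (∀ t : ℝ, ty 3 < t → ∀ x ∈ Icc (b t - 1) (b t),
        0 ≤ prs m (u x t) ∧ prs m (u x t) ≤ C₁ * (b t - x)) := by
  obtain ⟨a0, a1⟩ := hu.crossing 1 one_pos
  obtain ⟨b0, b1⟩ := hu.crossing 3 three_pos
  have h13 := (hu.crossing_lt_iff one_pos three_pos).2 (by norm_num)
  have hle : ∀ z ∈ Icc (1 : ℝ) 3, ∀ t ∈ Icc (ty 1) (ty 3), -C₁ ≤ pressureDx m u z t := by
    intro z hz t ht
    obtain ⟨D, hD⟩ := hu.exists_pressureDx_bound a0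
    rw [hC, neg_neg]
    refine csInf_le ⟨-D, ?_⟩ (mem_image2_of_mem hz ht)
    rintro _ ⟨z, -, t, ht, rfl⟩
    exact hD z t ht.1
  have hpos : 0 < C₁ := by
    obtain ⟨t, ht, hd⟩ := exists_deriv_eq_slope b h13
      (fun t ht => (hu.bdiff t (a0.trans_le ht.1)).continuousAt.continuousWithinAt)
      (fun t ht => (hu.bdiff t (a0.trans ht.1)).differentiableWithinAt)
    have ht0 := a0.trans ht.1
    have l1 := hu.mono a0 ht0 ht.1
    have l3 := hu.mono ht0 b0 ht.2
    rw [a1] at l1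
    rw [b1] at l3
    have h1 := hle (b t) ⟨l1.le, l3.le⟩ t ⟨ht.1.le, ht.2.le⟩
    have h2 := hu.darcy t ht0
    have h3 : 0 < (b (ty 3) - b (ty 1)) / (ty 3 - ty 1) := by
      rw [a1, b1]; exact div_pos (by norm_num) (by linarith)
    linarith
  have hint : ∀ y > (3 : ℝ), ∀ x ∈ Ico (y - 1) y, -C₁ ≤ pressureDx m u x (ty y) := by
    intro y hy x hx
    have hn1 := Nat.le_ceil (y - 3)
    have hn2 := Nat.ceil_lt_add_one (by linarith : 0 ≤ y - 3)
    have hn0 : 0 < ⌈y - 3⌉₊ := Nat.ceil_pos.2 (by linarith)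
    obtain ⟨n, hn⟩ : ∃ n, n = ⌈y - 3⌉₊ := ⟨_, rfl⟩
    rw [← hn] at hn1 hn2 hn0
    have hy' : 0 < y - n := by linarith
    have hx' : 1 < x - n := by linarith [hx.1]
    have hxy' : x - n < y - n := by linarith [hx.2]
    obtain ⟨e0, e1⟩ := hu.crossing y (by linarith)
    obtain ⟨f0, f1⟩ := hu.crossing (x - n) (by linarith)
    have hux : 0 < u x (ty y) := hu.pos _ e0 x (e1.symm ▸ hx.2)
    have htle := (hu.crossing_lt_iff (by linarith) hy').2 hxy'
    obtain ⟨t, ht, hte⟩ := intermediate_value_Icc htle.le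
      ((hu.continuousOn_time (x - n)).mono fun t ht => f0.trans_le ht.1)
      (show u x (ty y) ∈ Icc (u (x - n) (ty (x - n))) (u (x - n) (ty (y - n))) from
        ⟨(hu.zero _ f0 _ f1.le).trans_le hux.le, hu.le_translate hn0 hy' hx.2⟩)
    have g1 := (hu.crossing_le_iff one_pos (by linarith)).2 hx'.le
    have g2 := (hu.crossing_le_iff hy' three_pos).2 (by linarith)
    have g3 := (hu.crossing_lt_iff three_pos (by linarith)).2 hy
    refine (hle (x - n) ⟨hx'.le, by linarith⟩ t ⟨g1.trans ht.1, ht.2.trans g2⟩).trans ?_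
    exact hu.pressureDx_le hm (f0.trans_le ht.1) (ht.2.trans_lt (g2.trans_lt g3)) hux hte
  have hlin : ∀ y > (3 : ℝ), ∀ x ∈ Icc (y - 1) y, prs m (u x (ty y)) ≤ C₁ * (y - x) := by
    intro y hy x hx
    obtain ⟨e0, e1⟩ := hu.crossing y (by linarith)
    have hd : ∀ z ∈ Ico (y - 1) y,
        HasDerivAt (fun z => prs m (u z (ty y))) (pressureDx m u z (ty y)) z := fun z hz =>
      hu.hasDerivAt_prs hm e0 (hu.pos _ e0 z (e1.symm ▸ hz.2))
    have key := (convex_Icc (y - 1) y).mul_sub_le_image_sub_of_le_deriv (C := -C₁)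
      (hu.continuous_pressure hm e0).continuousOn
      (fun z hz => by
        rw [interior_Icc] at hz
        exact (hd z ⟨hz.1.le, hz.2⟩).differentiableAt.differentiableWithinAt)
      (fun z hz => by
        rw [interior_Icc] at hz
        rw [(hd z ⟨hz.1.le, hz.2⟩).deriv]
        exact hint y hy z ⟨hz.1.le, hz.2⟩)
      x hx y ⟨by linarith, le_rfl⟩ hx.2
    rw [hu.zero _ e0 y e1.le, prs_zero hm] at key
    linarith
  refine ⟨hpos, fun y hy x hx => ?_, fun t ht x hx => ?_⟩
  · rcases hx.2.lt_or_eq with h | rfl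
    · exact hint y hy x ⟨hx.1, h⟩
    · obtain ⟨e0, e1⟩ := hu.crossing x (by linarith)
      refine neg_le_derivWithin_Iic hpos.le one_pos fun z hz => ?_
      change prs m (u z (ty x)) - prs m (u x (ty x)) ≤ _
      rw [hu.zero _ e0 x e1.le, prs_zero hm, sub_zero]
      exact hlin x hy z ⟨hz.1.le, hz.2.le⟩
  · have ht0 := b0.trans ht
    have hb : 3 < b t := b1 ▸ hu.mono b0 ht0 ht
    obtain ⟨e0, e1⟩ := hu.crossing (b t) (by linarith)
    have he : ty (b t) = t := hu.mono.injOn e0 ht0 e1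
    have := hlin (b t) hb x hx
    rw [he] at this
    exact ⟨prs_nonneg hm (hu.nonneg ht0 x), this⟩


end

/-- In the renormalization setting, with
`C₁ := -min {v_x(z,t) : z ∈ [1,3], t ∈ [t₁,t₃]}` one has `C₁ > 0`, the pressure gradient is
bounded below by `-C₁` on `[y-1, y]` at the crossing time `t_y` for every `y > 3`, and
consequently `0 ≤ v(x,t) ≤ C₁ (b(t) - x)` for `t > t₃` and `x ∈ [b(t)-1, b(t)]`. -/
theorem pressure_gradient_lower_bound_near_boundary
    (m : ℝ) (hm : 1 < m) (f : ℝ → ℝ → ℝ) (κ : ℝ → ℝ) (θ c₀ l₀ : ℝ) (φ₀ p : ℝ → ℝ)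
    (u : ℝ → ℝ → ℝ) (b : ℝ → ℝ) (ty : ℝ → ℝ)
    (hset : RenormSetting m f κ θ c₀ l₀ φ₀ p u b ty) :
    ∀ C₁ : ℝ,
      C₁ = -sInf (Set.image2 (fun z t => pressureDx m u z t)
        (Icc (1:ℝ) 3) (Icc (ty 1) (ty 3))) →
      0 < C₁ ∧
      (∀ y > (3:ℝ), ∀ x ∈ Icc (y - 1) y, -C₁ ≤ pressureDx m u x (ty y)) ∧
      (∀ t : ℝ, ty 3 < t → ∀ x ∈ Icc (b t - 1) (b t),
        0 ≤ (m / (m - 1)) * u x t ^ (m - 1) ∧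
        (m / (m - 1)) * u x t ^ (m - 1) ≤ C₁ * (b t - x)) := by
  intro C₁ hC
  exact (RenormSetting.frontFacts hm hset).pressure_gradient hm hC
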